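/- In the setting of the discrete model operator $T_{\mathcal{R}}$ (finite collection $\mathcal{R}$ of dyadic rectangles, shifts $\mathbf{n}_1,\dots,\mathbf{n}_l\in\mathbb{Z}^2$, $\mathbf{n}_{l+1}=(0,0)$, adapted $L^2$-normalized bump families with at least two $\Psi$-type families in each variable): let $1<p_1,\dots,p_l<\infty$, let $f_j\in L^{p_j}(\mathbb{R}^2)$ with $\|f_j\|_{L^{p_j}}=1$ for $1\le j\le l$, and let $E\subseteq\mathbb{R}^2$ be measurable with $|E|=1$. Then there exists a measurable subset $E'\subseteq E$ with $|E'|\ge \tfrac12|E|$ such that, with $f_{l+1}:=\chi_{E'}$, $\sum_{R\in\mathcal{R}}|R|^{-(l-1)/2}\,|\langle f_1,\Phi^1_{R_{\mathbf{n}_1}}\rangle|\cdots|\langle f_l,\Phi^l_{R_{\mathbf{n}_l}}\rangle|\,|\langle f_{l+1},\Phi^{l+1}_R\rangle|\le C\prod_{j=1}^{2}\log^2\langle\mathbf{n}_1^j\rangle\cdots\log^2\langle\mathbf{n}_l^j\rangle$, where $C$ depends only on $l$, the exponents, and the adaptation constants of the bump families, and $\langle m\rangle:=2+|m|$. -/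

import Mathlib

open MeasureTheory Filter Topology ENNReal

/-- `φ` is a bump function adapted to the interval with left endpoint `a` and length `L`,
with adaptation constants `C M`:
`|∂^α φ(x)| ≤ C M * |I|^{-α} * (1 + dist(x, I)/|I|)^{-M}` for all `0 ≤ α ≤ 5`, `M`, `x`. -/
def IsBumpAdapted (C : ℕ → ℝ) (a L : ℝ) (φ : ℝ → ℂ) : Prop :=
  ContDiff ℝ 5 φ ∧ ∀ α : ℕ, α ≤ 5 → ∀ M : ℕ, ∀ x : ℝ,
    ‖iteratedDeriv α φ x‖ * L ^ α *
      (1 + Metric.infDist x (Set.Icc a (a + L)) / L) ^ M ≤ C M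

/-- The `L²`-normalized product bump `|I|^{-1/2}|J|^{-1/2} g(x) h(y)` on a dyadic rectangle
with side lengths `2^{k₁}, 2^{k₂}`. -/
noncomputable def rectBumpProd (k₁ k₂ : ℤ) (g h : ℝ → ℂ) : ℝ × ℝ → ℂ :=
  fun z => ((((2:ℝ)^k₁) ^ (-(1/2) : ℝ) * ((2:ℝ)^k₂) ^ (-(1/2) : ℝ) : ℝ) : ℂ) * g z.1 * h z.2

/-- The pairing `⟨f, g⟩ = ∫_{ℝ²} f \overline{g}`. -/
noncomputable def pairing (f g : ℝ × ℝ → ℂ) : ℂ :=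
  ∫ z : ℝ × ℝ, f z * (starRingEnd ℂ) (g z)

/-- The discrete model operator
`T_𝓡(f₁,…,f_l) = ∑_{R ∈ 𝓡} |R|^{-(l-1)/2} ⟨f₁, Φ¹_{R_{n₁}}⟩ ⋯ ⟨f_l, Φ^l_{R_{n_l}}⟩ Φ^{l+1}_R`.
A dyadic rectangle is encoded as `((k₁, m₁), (k₂, m₂))`, standing for
`[2^{k₁}m₁, 2^{k₁}(m₁+1)) × [2^{k₂}m₂, 2^{k₂}(m₂+1))`, of area `2^{k₁} 2^{k₂}`. -/
noncomputable def modelOp (l : ℕ) (𝓡 : Finset ((ℤ × ℤ) × (ℤ × ℤ)))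
    (Φ : Fin (l + 1) → ((ℤ × ℤ) × (ℤ × ℤ)) → ℝ × ℝ → ℂ)
    (f : Fin l → ℝ × ℝ → ℂ) (x : ℝ × ℝ) : ℂ :=
  ∑ r ∈ 𝓡,
    (((((2:ℝ)^r.1.1 * (2:ℝ)^r.2.1) ^ (-(((l : ℝ) - 1) / 2)) : ℝ)) : ℂ) *
      (∏ i : Fin l, pairing (f i) (Φ i.castSucc r)) * Φ (Fin.last l) r x

set_option linter.all false

local notation "EN" => ENNReal
local notation "RR" => ℝ × ℝ
local notation "oR" => ENNReal.ofReal

noncomputable def fl (k : ℤ) (x : ℝ) : ℤ := ⌊x / (2:ℝ)^k⌋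

def Dy (k m : ℤ) : Set ℝ := {x | fl k x = m}

lemma Dy_eq (k m : ℤ) : Dy k m = Set.Ico ((2:ℝ)^k * m) ((2:ℝ)^k * (m+1)) := by
  ext x
  have h : (0:ℝ) < 2^k := by positivity
  simp only [Dy, fl, Set.mem_setOf_eq, Int.floor_eq_iff, Set.mem_Ico]
  rw [le_div_iff₀ h, div_lt_iff₀ h, mul_comm, mul_comm ((2:ℝ)^k) ((m:ℝ)+1)]

lemma measurable_fl (k : ℤ) : Measurable (fl k) := by
  unfold fl; exact Int.measurable_floor.comp (measurable_id.div_const _)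

lemma meas_Dy (k m : ℤ) : MeasurableSet (Dy k m) := by
  rw [Dy_eq]; exact measurableSet_Ico

lemma ofReal_two_zpow (k : ℤ) : oR ((2:ℝ)^k) = (2:EN)^k := by
  cases k with
  | ofNat n => simp [ofReal_pow]
  | negSucc n =>
    rw [zpow_negSucc, zpow_negSucc, ofReal_inv_of_pos (by positivity), ofReal_pow (by norm_num)]
    simp

lemma vol_Dy (k m : ℤ) : volume (Dy k m) = (2:EN)^k := by
  rw [Dy_eq, Real.volume_Ico, ← ofReal_two_zpow]; congr 1; ring

lemma zp_ne0 (k : ℤ) : (2:EN)^k ≠ 0 := by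
  rw [← ofReal_two_zpow]; simp; positivity
lemma zp_netop (k : ℤ) : (2:EN)^k ≠ ⊤ := by
  rw [← ofReal_two_zpow]; simp
lemma zp_add (a b : ℤ) : (2:EN)^(a+b) = 2^a * 2^b := ENNReal.zpow_add (by simp) (by simp) a b
lemma zp_mul (k : ℤ) : (2:EN)^(-k) * 2^k = 1 := by rw [← zp_add]; simp
lemma zp_mul' (k : ℤ) : (2:EN)^k * 2^(-k) = 1 := by rw [← zp_add]; simp

lemma fl_add (k : ℤ) (j : ℕ) (x : ℝ) : fl (k+j) x = fl k x / 2^j := by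
  unfold fl
  have : x / (2:ℝ)^(k+(j:ℤ)) = (x / 2^k) / ((2^j : ℕ):ℝ) := by
    rw [zpow_add₀ (by norm_num)]; push_cast; rw [div_div, zpow_natCast]
  rw [this, Int.floor_div_natCast]; push_cast; rfl

/-- averages -/
noncomputable def av (k m : ℤ) (g : ℝ → EN) : EN := (2:EN)^(-k) * ∫⁻ x in Dy k m, g x

lemma lint_Dy (k m : ℤ) (g : ℝ → EN) : ∫⁻ x in Dy k m, g x = 2^k * av k m g := by
  unfold av; rw [← mul_assoc, zp_mul', one_mul]

lemma lint_cells (k : ℤ) (g : ℝ → EN) : ∫⁻ x, g x = ∑' m, ∫⁻ x in Dy k m, g x := by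
  have h : (⋃ m, Dy k m) = Set.univ := by ext x; simp [Dy]
  rw [← setLIntegral_univ, ← h]
  refine lintegral_iUnion (meas_Dy k) ?_ _
  intro a b hab
  rw [Function.onFun, Set.disjoint_left]
  intro x hx hy; exact hab (hx.symm.trans hy)

lemma lint_cell_av (k : ℤ) (c : ℤ → EN) {h : ℝ → EN} (hh : Measurable h) :
    ∫⁻ x, c (fl k x) * h x = ∑' m, 2^k * (c m * av k m h) := by
  rw [lint_cells k]
  congr 1; ext m
  rw [setLIntegral_congr_fun (g := fun x => c m * h x) (meas_Dy k m), lintegral_const_mul _ hh, lint_Dy]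
  · ring
  · intro x hx; simp only; rw [show fl k x = m from hx]

lemma av_mono {k m : ℤ} {g h : ℝ → EN} (H : ∀ x, g x ≤ h x) : av k m g ≤ av k m h := by
  unfold av; gcongr; exact H _

lemma av_const (k m : ℤ) (c : EN) : av k m (fun _ => c) = c := by
  unfold av; rw [setLIntegral_const, vol_Dy, mul_comm, mul_assoc, zp_mul', mul_one]

lemma meas_cell (k : ℤ) (c : ℤ → EN) : Measurable (fun x => c (fl k x)) :=
  (measurable_from_top (f := c)).comp (measurable_fl k)

/-- norms -/
noncomputable def Nm {α : Type*} [MeasurableSpace α] (p : ℝ) (μ : Measure α) (F : α → EN) : EN :=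
  (∫⁻ x, F x ^ p ∂μ) ^ (1/p)

lemma Nm_mono {α : Type*} [MeasurableSpace α] {p : ℝ} (hp : 0 < p) {μ : Measure α} {F G : α → EN}
    (h : ∀ x, F x ≤ G x) : Nm p μ F ≤ Nm p μ G := by
  unfold Nm; gcongr; exact h _

lemma Nm_mono_ae {α : Type*} [MeasurableSpace α] {p : ℝ} (hp : 0 < p) {μ : Measure α} {F G : α → EN}
    (h : ∀ᵐ x ∂μ, F x ≤ G x) : Nm p μ F ≤ Nm p μ G := by
  unfold Nm
  refine rpow_le_rpow (lintegral_mono_ae ?_) (by positivity)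
  filter_upwards [h] with x hx; gcongr

lemma Nm_pow {α : Type*} [MeasurableSpace α] {p : ℝ} (hp : 0 < p) {μ : Measure α} {F : α → EN} :
    Nm p μ F ^ p = ∫⁻ x, F x ^ p ∂μ := by
  unfold Nm; rw [← rpow_mul, one_div_mul_cancel hp.ne', rpow_one]

lemma Nm_le_iff {α β : Type*} [MeasurableSpace α] [MeasurableSpace β] {p : ℝ} (hp : 0 < p) {μ : Measure α} {ν : Measure β}
    {F : α → EN} {G : β → EN} {C : EN} :
    Nm p μ F ≤ C * Nm p ν G ↔ ∫⁻ x, F x ^ p ∂μ ≤ C ^ p * ∫⁻ x, G x ^ p ∂ν := by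
  rw [← Nm_pow hp, ← Nm_pow hp, ← mul_rpow_of_nonneg _ _ hp.le, rpow_le_rpow_iff hp]

lemma Nm_const_mul {α : Type*} [MeasurableSpace α] {p : ℝ} (hp : 0 < p) {μ : Measure α} {F : α → EN}
    (hF : AEMeasurable F μ) (C : EN) : Nm p μ (fun x => C * F x) = C * Nm p μ F := by
  unfold Nm
  simp_rw [mul_rpow_of_nonneg _ _ hp.le]
  rw [lintegral_const_mul'' _ (hF.pow_const p), mul_rpow_of_nonneg _ _ (by positivity), ← rpow_mul,
    mul_one_div_cancel hp.ne', rpow_one]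

lemma Nm_add_le {α : Type*} [MeasurableSpace α] {p : ℝ} (hp : 1 ≤ p) {μ : Measure α} {F G : α → EN}
    (hF : AEMeasurable F μ) (hG : AEMeasurable G μ) :
    Nm p μ (fun x => F x + G x) ≤ Nm p μ F + Nm p μ G :=
  lintegral_Lp_add_le hF hG hp

lemma Nm_iSup {α ι : Type*} [MeasurableSpace α] [Countable ι] [Nonempty ι] {p : ℝ} (hp : 0 < p) {μ : Measure α}
    {F : ι → α → EN} (hF : ∀ i, AEMeasurable (F i) μ) (hd : Directed (· ≤ ·) F) :
    Nm p μ (fun x => ⨆ i, F i x) = ⨆ i, Nm p μ (F i) := by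
  have e1 : ∀ q : ℝ, 0 < q → ∀ u : ι → EN, (⨆ i, u i) ^ q = ⨆ i, u i ^ q := by
    intro q hq u
    exact (orderIsoRpow q hq).map_iSup u
  unfold Nm
  simp_rw [e1 p hp]
  rw [lintegral_iSup_directed (fun i => (hF i).pow_const p), e1 _ (by positivity)]
  intro i j
  obtain ⟨k, h1, h2⟩ := hd i j
  exact ⟨k, fun x => rpow_le_rpow (h1 x) hp.le, fun x => rpow_le_rpow (h2 x) hp.le⟩

lemma Nm_tsum_le {α ι : Type*} [MeasurableSpace α] [Countable ι] {p : ℝ} (hp : 1 ≤ p) {μ : Measure α}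
    {F : ι → α → EN} (hF : ∀ i, AEMeasurable (F i) μ) :
    Nm p μ (fun x => ∑' i, F i x) ≤ ∑' i, Nm p μ (F i) := by
  classical
  simp_rw [ENNReal.tsum_eq_iSup_sum (f := fun i => F i _)]
  have h0 : ∀ s : Finset ι, AEMeasurable (fun x => ∑ i ∈ s, F i x) μ := fun s => Finset.aemeasurable_fun_sum s (fun i _ => hF i)
  rw [Nm_iSup (by linarith) h0]
  · refine iSup_le fun s => ?_
    refine le_trans ?_ (ENNReal.sum_le_tsum s)
    induction s using Finset.induction_on with
    | empty => simp [Nm, show 0 < p by linarith]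
    | insert a s ha ih =>
      simp_rw [Finset.sum_insert ha]
      refine (Nm_add_le hp (hF a) (h0 s)).trans ?_
      gcongr
  · intro s t
    refine ⟨s ∪ t, fun x => ?_, fun x => ?_⟩ <;> simp only <;> gcongr
    · exact Finset.subset_union_left
    · exact Finset.subset_union_right

noncomputable def l2 {ι : Type*} (F : ι → EN) : EN := (∑' i, F i ^ (2:ℝ)) ^ (1/2:ℝ)

lemma l2_eq_Nm {ι : Type*} (F : ι → EN) : l2 F = @Nm ι ⊤ 2 (@Measure.count ι ⊤) F := by
  letI : MeasurableSpace ι := ⊤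
  unfold l2 Nm; rw [lintegral_count]

lemma l2_sq {ι : Type*} (F : ι → EN) : l2 F ^ (2:ℝ) = ∑' i, F i ^ (2:ℝ) := by
  unfold l2; rw [← rpow_mul]; norm_num

lemma l2_mono {ι : Type*} {F G : ι → EN} (h : ∀ i, F i ≤ G i) : l2 F ≤ l2 G := by
  unfold l2; gcongr; exact h _

lemma l2_tsum_le {ι κ : Type*} [Countable κ] (F : κ → ι → EN) : l2 (fun i => ∑' s, F s i) ≤ ∑' s, l2 (F s) := by
  letI : MeasurableSpace ι := ⊤
  simp_rw [l2_eq_Nm]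
  exact Nm_tsum_le (by norm_num) (fun i => measurable_from_top.aemeasurable)

lemma l2_const_mul {ι : Type*} (c : EN) (F : ι → EN) : l2 (fun i => c * F i) = c * l2 F := by
  letI : MeasurableSpace ι := ⊤
  simp_rw [l2_eq_Nm]
  exact Nm_const_mul (by norm_num) (measurable_from_top.aemeasurable) c

lemma le_l2 {ι : Type*} (F : ι → EN) (i : ι) : F i ≤ l2 F := by
  unfold l2
  calc F i = (F i ^ (2:ℝ)) ^ (1/2:ℝ) := by rw [← rpow_mul]; norm_num
    _ ≤ _ := by gcongr; exact ENNReal.le_tsum i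

lemma meas_l2 {α ι : Type*} [MeasurableSpace α] [Countable ι] {F : ι → α → EN} (h : ∀ i, Measurable (F i)) :
    Measurable (fun x => l2 (fun i => F i x)) := by
  unfold l2
  exact (Measurable.ennreal_tsum fun i => (h i).pow_const _).pow_const _

lemma l2_comp_inj {ι κ : Type*} {e : κ → ι} (he : Function.Injective e) (F : ι → EN) : l2 (fun i => F (e i)) ≤ l2 F := by
  unfold l2; gcongr; exact tsum_comp_le_tsum_of_injective he _

/-- mixed norm -/
noncomputable def XN {α ι : Type*} [MeasurableSpace α] (p : ℝ) (μ : Measure α) (F : ι → α → EN) : EN :=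
  Nm p μ (fun x => l2 (fun i => F i x))

lemma XN_mono {α ι : Type*} [MeasurableSpace α] {p : ℝ} (hp : 0 < p) {μ : Measure α} {F G : ι → α → EN}
    (h : ∀ i x, F i x ≤ G i x) : XN p μ F ≤ XN p μ G :=
  Nm_mono hp fun x => l2_mono fun i => h i x

lemma XN_const_mul {α ι : Type*} [Countable ι] [MeasurableSpace α] {p : ℝ} (hp : 0 < p) {μ : Measure α} {F : ι → α → EN}
    (hF : ∀ i, Measurable (F i)) (c : EN) : XN p μ (fun i x => c * F i x) = c * XN p μ F := by
  unfold XN; simp_rw [l2_const_mul]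
  exact Nm_const_mul hp (meas_l2 hF).aemeasurable c

lemma XN_tsum_le {α ι κ : Type*} [Countable ι] [Countable κ] [MeasurableSpace α] {p : ℝ} (hp : 1 ≤ p) {μ : Measure α}
    {F : κ → ι → α → EN} (hF : ∀ s i, Measurable (F s i)) :
    XN p μ (fun i x => ∑' s, F s i x) ≤ ∑' s, XN p μ (F s) := by
  refine (Nm_mono (by linarith) fun x => l2_tsum_le (fun s i => F s i x)).trans ?_
  exact Nm_tsum_le hp fun s => (meas_l2 (hF s)).aemeasurable

noncomputable def Mx (s : ℤ) (g : ℝ → EN) (x : ℝ) : EN := ⨆ k : ℤ, av k (fl k x + s) g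

@[fun_prop] lemma meas_Mx (s : ℤ) (g : ℝ → EN) : Measurable (Mx s g) :=
  Measurable.iSup fun k => meas_cell k (fun m => av k (m+s) g)

lemma av_le_Mx (k s : ℤ) (g : ℝ → EN) (x : ℝ) : av k (fl k x + s) g ≤ Mx s g x :=
  le_iSup (fun k => av k (fl k x + s) g) k

noncomputable def kap (s : ℤ) : EN := ((Nat.size s.natAbs + 2 : ℕ) : EN)

def Jx (s : ℤ) : Finset (ℕ × ℕ) := Finset.range (Nat.size s.natAbs + 1) ×ˢ Finset.range 2
def tt (s : ℤ) (i : ℕ × ℕ) : ℤ := -(s / 2^i.1) - i.2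
noncomputable def Mp (s : ℤ) (h : ℝ → EN) (x : ℝ) : EN := ∑ i ∈ Jx s, Mx (tt s i) h x

@[fun_prop] lemma meas_Mp (s : ℤ) (g : ℝ → EN) : Measurable (Mp s g) :=
  Finset.measurable_fun_sum _ fun i _ => meas_Mx _ _

lemma kap_ge (s : ℤ) : 1 ≤ kap s := by unfold kap; norm_cast; omega
lemma kap_netop (s : ℤ) : kap s ≠ ⊤ := by unfold kap; exact natCast_ne_top _

lemma kap_tt {s : ℤ} {i : ℕ × ℕ} (hi : i ∈ Jx s) : kap (tt s i) ≤ 2 * kap s := by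
  unfold kap
  have h2 : i.2 < 2 := by simp [Jx] at hi; omega
  have hb : (tt s i).natAbs ≤ s.natAbs + 1 := by
    unfold tt
    have hp : (1:ℤ) ≤ 2^i.1 := by exact_mod_cast Nat.one_le_two_pow
    have h1 : |s / 2^i.1| ≤ |s| := by
      rw [abs_le]; constructor
      · rcases le_or_gt 0 s with h | h
        · have := Int.ediv_nonneg h (by omega : (0:ℤ) ≤ 2^i.1)
          have := abs_nonneg s; omega
        · rw [abs_of_neg h, neg_neg, Int.le_ediv_iff_mul_le (by omega)]; nlinarith
      · rcases le_or_gt 0 s with h | h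
        · rw [abs_of_nonneg h]; exact Int.ediv_le_self _ h
        · have := Int.ediv_neg_of_neg_of_pos h (by omega : (0:ℤ) < 2^i.1)
          have := abs_nonneg s; omega
    rcases le_or_gt 0 s with h | h
    · have := Int.ediv_nonneg h (by omega : (0:ℤ) ≤ 2^i.1)
      rw [abs_of_nonneg this, abs_of_nonneg h] at h1
      omega
    · have := Int.ediv_neg_of_neg_of_pos h (by omega : (0:ℤ) < 2^i.1)
      rw [abs_of_neg this, abs_of_neg h] at h1
      omega
  have h3 : Nat.size (tt s i).natAbs ≤ Nat.size s.natAbs + 1 := by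
    rw [Nat.size_le]
    have := Nat.lt_size_self s.natAbs
    rw [pow_succ]
    have := Nat.one_le_two_pow (n := s.natAbs.size)
    omega
  norm_cast; omega

lemma exists_tt (s q : ℤ) (j : ℕ) : ∃ i ∈ Jx s, q / 2^j = (q+s)/2^j + tt s i := by
  have hlt := Nat.lt_size_self s.natAbs
  set N := Nat.size s.natAbs
  have key : ∀ j : ℕ, ∃ e ∈ Finset.range 2, q / 2^j = (q+s)/2^j + (-(s/2^j) - (e:ℕ)) := by
    intro j
    have hp : (0:ℤ) < 2^j := by positivity
    have e1 := Int.mul_ediv_add_emod q (2^j)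
    have e2 := Int.mul_ediv_add_emod s (2^j)
    have e3 := Int.mul_ediv_add_emod (q+s) (2^j)
    have a1 := Int.emod_nonneg q hp.ne'
    have a2 := Int.emod_nonneg s hp.ne'
    have a3 := Int.emod_nonneg (q+s) hp.ne'
    have b1 := Int.emod_lt_of_pos q hp
    have b2 := Int.emod_lt_of_pos s hp
    have b3 := Int.emod_lt_of_pos (q+s) hp
    set P : ℤ := 2^j
    set A := q / P; set B := s / P; set C := (q+s)/P
    have h1 : P * (C - A - B) < P * 2 := by linarith [mul_sub P (C-A) B, mul_sub P C A]
    have h2 : P * (-1) < P * (C - A - B) := by linarith [mul_sub P (C-A) B, mul_sub P C A]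
    have h1' := lt_of_mul_lt_mul_left h1 hp.le
    have h2' := lt_of_mul_lt_mul_left h2 hp.le
    rcases (by omega : C - A - B = 0 ∨ C - A - B = 1) with h | h
    · exact ⟨0, by simp, by push_cast; omega⟩
    · exact ⟨1, by simp, by push_cast; omega⟩
  obtain ⟨e, he, h⟩ := key j
  by_cases hj : j ≤ N
  · exact ⟨(j, e), by simp only [Jx, Finset.mem_product]; exact ⟨by simp; omega, he⟩, h⟩
  · refine ⟨(N, e), by simp only [Jx, Finset.mem_product]; exact ⟨by simp; omega, he⟩, ?_⟩
    rw [h]; unfold tt; simp only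
    have hs : ∀ j, N ≤ j → s / 2^j = if 0 ≤ s then 0 else -1 := by
      intro j hj
      have h2 : 2^N ≤ 2^j := Nat.pow_le_pow_right (by norm_num) hj
      have h3 : (s.natAbs : ℤ) < 2^j := by exact_mod_cast lt_of_lt_of_le hlt h2
      split_ifs with h0
      · exact Int.ediv_eq_zero_of_lt h0 (by omega)
      · have hp : (0:ℤ) < 2^j := by positivity
        have u1 := Int.ediv_neg_of_neg_of_pos (by omega : s < 0) hp
        have u2 : -1 ≤ s / 2^j := by rw [Int.le_ediv_iff_mul_le hp]; omega
        omega
    rw [hs j (by omega), hs N le_rfl]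

lemma weakFS_trunc (s : ℤ) {g h : ℝ → EN} (hg : Measurable g) (hh : Measurable h) (lam : EN) (K : ℤ) :
    lam * ∫⁻ x in {x | ∃ k : ℤ, k ≤ K ∧ lam < av k (fl k x + s) g}, h x ≤ ∫⁻ x, g x * Mp s h x := by
  let Sel : Set (ℤ × ℤ) := {Q | Q.1 ≤ K ∧ lam < av Q.1 Q.2 g ∧ ∀ j : ℕ, 0 < j → Q.1 + j ≤ K → av (Q.1+j) (Q.2/2^j) g ≤ lam}
  have hcov : {x | ∃ k : ℤ, k ≤ K ∧ lam < av k (fl k x + s) g} ⊆ ⋃ Q : Sel, ⋃ i ∈ Jx s, Dy Q.1.1 (Q.1.2 + tt s i) := by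
    rintro x ⟨k, hk, hx⟩
    classical
    let P : ℕ → Prop := fun j => k + j ≤ K ∧ lam < av (k+j) ((fl k x + s)/2^j) g
    have hP0 : P 0 := by simp [P]; exact ⟨hk, hx⟩
    let j := Nat.findGreatest P (K - k).toNat
    have hj : P j := Nat.findGreatest_spec (m := 0) (by omega) hP0
    obtain ⟨i, hi, hi2⟩ := exists_tt s (fl k x) j
    simp only [Set.mem_iUnion]
    refine ⟨⟨(k+j, (fl k x + s)/2^j), hj.1, hj.2, ?_⟩, i, hi, ?_⟩
    · intro j' hj' hK
      simp only at hK ⊢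
      by_contra hcon
      push Not at hcon
      have : P (j + j') := by
        refine ⟨by push_cast; omega, ?_⟩
        rw [Int.ediv_ediv_of_nonneg (by positivity), ← pow_add, add_assoc] at hcon
        push_cast; exact hcon
      have h3 := Nat.le_findGreatest (P := P) (n := (K-k).toNat) (by omega) this
      omega
    · show fl (k+j) x = _
      rw [fl_add]; exact hi2
  have hdisj : Pairwise (Function.onFun Disjoint fun Q : Sel => Dy Q.1.1 Q.1.2) := by
    have main : ∀ Q Q' : ℤ × ℤ, Q ∈ Sel → Q' ∈ Sel → ∀ x, x ∈ Dy Q.1 Q.2 → x ∈ Dy Q'.1 Q'.2 → ¬ Q.1 < Q'.1 := by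
      rintro ⟨k, m⟩ ⟨k', m'⟩ hQ hQ' x hx hx' hlt
      simp only at hx hx' hlt
      obtain ⟨j, rfl⟩ := Int.exists_add_of_le hlt.le
      have e := fl_add k j x
      rw [show fl (k+j) x = m' from hx', show fl k x = m from hx] at e
      have := hQ.2.2 j (by omega) hQ'.1
      rw [← e] at this
      exact absurd hQ'.2.1 (not_lt.mpr this)
    rintro ⟨⟨k,m⟩,hQ⟩ ⟨⟨k',m'⟩,hQ'⟩ hne
    rw [Function.onFun, Set.disjoint_left]
    intro x hx hx'
    have h1 := main _ _ hQ hQ' x hx hx'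
    have h2 := main _ _ hQ' hQ x hx' hx
    simp only at h1 h2 hx hx'
    have : k = k' := by omega
    subst this
    exact hne (by simp only [Subtype.mk.injEq, Prod.mk.injEq, true_and]; exact hx.symm.trans hx')
  calc lam * ∫⁻ x in {x | ∃ k : ℤ, k ≤ K ∧ lam < av k (fl k x + s) g}, h x
      ≤ lam * ∑' Q : Sel, ∑ i ∈ Jx s, ∫⁻ x in Dy Q.1.1 (Q.1.2 + tt s i), h x := by
        gcongr
        refine (lintegral_mono_set hcov).trans ((lintegral_iUnion_le _ _).trans ?_)
        gcongr with Q
        rw [← Finset.sum_coe_sort (Jx s) (fun i => ∫⁻ x in Dy Q.1.1 (Q.1.2 + tt s i), h x), ← tsum_fintype (L := .unconditional _)]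
        refine (lintegral_mono_set (t := ⋃ b : Jx s, Dy Q.1.1 (Q.1.2 + tt s b)) ?_).trans (lintegral_iUnion_le _ _)
        intro x hx; simpa using hx
    _ = ∑' Q : Sel, ∑ i ∈ Jx s, lam * (2^Q.1.1 * av Q.1.1 (Q.1.2 + tt s i) h) := by
        rw [← ENNReal.tsum_mul_left]; congr 1; ext Q; rw [Finset.mul_sum]; simp_rw [lint_Dy]
    _ ≤ ∑' Q : Sel, ∑ i ∈ Jx s, ∫⁻ x in Dy Q.1.1 Q.1.2, g x * Mx (tt s i) h x := by
        gcongr with Q i hi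
        calc lam * (2^Q.1.1 * av Q.1.1 (Q.1.2 + tt s i) h) ≤ av Q.1.1 Q.1.2 g * (2^Q.1.1 * av Q.1.1 (Q.1.2 + tt s i) h) := by
              gcongr; exact Q.2.2.1.le
          _ = (∫⁻ x in Dy Q.1.1 Q.1.2, g x) * av Q.1.1 (Q.1.2 + tt s i) h := by rw [lint_Dy]; ring
          _ = ∫⁻ x in Dy Q.1.1 Q.1.2, g x * av Q.1.1 (Q.1.2 + tt s i) h := by rw [lintegral_mul_const _ hg]
          _ ≤ _ := by
            refine setLIntegral_mono (hg.mul (meas_Mx _ _)) fun x hx => ?_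
            gcongr
            rw [← show fl Q.1.1 x = Q.1.2 from hx]
            exact av_le_Mx _ _ _ _
    _ = ∑' Q : Sel, ∫⁻ x in Dy Q.1.1 Q.1.2, g x * Mp s h x := by
        congr 1; ext Q
        rw [← lintegral_finset_sum _ fun i _ => (by fun_prop)]
        simp_rw [Mp, Finset.mul_sum]
    _ = ∫⁻ x in ⋃ Q : Sel, Dy Q.1.1 Q.1.2, g x * Mp s h x :=
        (lintegral_iUnion (fun Q => meas_Dy _ _) hdisj _).symm
    _ ≤ _ := setLIntegral_le_lintegral _ _

lemma weakFS (s : ℤ) {g h : ℝ → EN} (hg : Measurable g) (hh : Measurable h) (lam : EN) :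
    lam * ∫⁻ x in {x | lam < Mx s g x}, h x ≤ ∫⁻ x, g x * Mp s h x := by
  have e : {x | lam < Mx s g x} = ⋃ K : ℕ, {x | ∃ k : ℤ, k ≤ (K:ℤ) ∧ lam < av k (fl k x + s) g} := by
    ext x
    simp only [Mx, Set.mem_setOf_eq, lt_iSup_iff, Set.mem_iUnion]
    constructor
    · rintro ⟨k, hk⟩; exact ⟨k.toNat, k, by omega, hk⟩
    · rintro ⟨K, k, _, hk⟩; exact ⟨k, hk⟩
  have hm : Monotone fun K : ℕ => {x | ∃ k : ℤ, k ≤ (K:ℤ) ∧ lam < av k (fl k x + s) g} := by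
    rintro K K' hK x ⟨k, hk, h⟩
    exact ⟨k, by omega, h⟩
  rw [e, setLIntegral_iUnion_of_directed _ hm.directed_le, mul_iSup]
  exact iSup_le fun K => weakFS_trunc s hg hh lam K

lemma geo_a {a : ℝ} (ha : 0 < a) : ∑' n : ℕ, ((2:EN)^(-a)) ^ n ≠ ⊤ := by
  rw [tsum_geometric]
  simp only [ne_eq, inv_eq_top, tsub_eq_zero_iff_le, not_le]
  exact rpow_lt_one_of_one_lt_of_neg (by norm_num) (by linarith)

lemma geo_lt {a : ℝ} (ha : 0 < a) (g : EN) :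
    ∑' j : ℤ, (if (2:EN)^j < g then ((2:EN)^j)^a else 0) ≤ (∑' n : ℕ, ((2:EN)^(-a)) ^ n) * g ^ a := by
  rcases eq_or_ne g 0 with rfl | h0
  · simp
  rcases eq_or_ne g ⊤ with rfl | ht
  · rw [top_rpow_of_pos ha, mul_top]
    · exact le_top
    · refine (lt_of_lt_of_le zero_lt_one ?_).ne'
      simpa using ENNReal.le_tsum (f := fun n : ℕ => ((2:EN)^(-a)) ^ n) 0
  obtain ⟨J, hJ1, hJ2⟩ := ENNReal.exists_mem_Ioc_zpow h0 ht (y := 2) (by norm_num) (by norm_num)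
  have hinj : Function.Injective fun n : ℕ => J - (n:ℤ) := by intro a b h; simp at h; exact h
  rw [← hinj.tsum_eq (f := fun j : ℤ => (if (2:EN)^j < g then ((2:EN)^j)^a else 0)), ← ENNReal.tsum_mul_right]
  · refine ENNReal.tsum_le_tsum fun n => ?_
    split_ifs
    · calc ((2:EN)^(J - (n:ℤ)))^a = ((2:EN)^(-a))^n * ((2:EN)^J)^a := by
            rw [sub_eq_add_neg, zp_add, mul_rpow_of_nonneg _ _ ha.le, mul_comm]
            congr 1
            rw [← rpow_intCast, ← rpow_natCast, ← rpow_mul, ← rpow_mul]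
            congr 1; push_cast; ring
        _ ≤ _ := by gcongr
    · exact zero_le
  · intro j hj
    simp only [Function.mem_support, ne_eq, ite_eq_right_iff, Classical.not_imp] at hj
    have : j ≤ J := by
      by_contra hc
      have h1 : (2:EN)^(J+1) ≤ 2^j := zpow_le_of_le (by norm_num) (by omega)
      exact absurd (lt_of_lt_of_le hj.1 hJ2) (not_lt.mpr h1)
    exact ⟨(J-j).toNat, by simp only; omega⟩

lemma le_layers {q : ℝ} (hq : 0 < q) (X : EN) :
    X ^ q ≤ ∑' j : ℤ, (if (2:EN)^j < X then ((2:EN)^(j+1))^q else 0) := by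
  rcases eq_or_ne X 0 with rfl | h0
  · simp [hq]
  rcases eq_or_ne X ⊤ with rfl | ht
  · rw [top_rpow_of_pos hq]
    refine le_of_eq (Eq.symm ?_)
    refine eq_top_of_forall_nnreal_le fun r => ?_
    obtain ⟨n, hn⟩ : ∃ n : ℕ, (r:EN) ≤ ((2:EN)^((n:ℤ)+1))^q := by
      obtain ⟨n, hn⟩ := ENNReal.exists_nat_gt (r := (r:EN)^(1/q)) (by simp [rpow_ne_top_of_nonneg, hq.le])
      refine ⟨n, ?_⟩
      calc (r:EN) = ((r:EN)^(1/q))^q := by rw [← rpow_mul, one_div_mul_cancel hq.ne', rpow_one]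
        _ ≤ _ := by
          gcongr
          refine hn.le.trans ?_
          have : (n:EN) ≤ 2^(n+1) := by exact_mod_cast (Nat.lt_two_pow_self.le.trans (Nat.pow_le_pow_right (by norm_num) (by omega)))
          exact_mod_cast this
    refine hn.trans ?_
    refine le_trans (le_of_eq ?_) (ENNReal.le_tsum (n:ℤ))
    rw [if_pos (lt_top_iff_ne_top.mpr (zp_netop _))]
  obtain ⟨J, hJ1, hJ2⟩ := ENNReal.exists_mem_Ioc_zpow h0 ht (y := 2) (by norm_num) (by norm_num)
  refine le_trans ?_ (ENNReal.le_tsum J)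
  rw [if_pos hJ1]; gcongr

lemma Mx_split (s : ℤ) {g : ℝ → EN} (hg : Measurable g) (t : EN) (x : ℝ) :
    Mx s g x ≤ Mx s ({x | t < g x}.indicator g) x + t := by
  refine iSup_le fun k => ?_
  refine le_trans ?_ (add_le_add_left (av_le_Mx k s _ x) t)
  nth_rewrite 2 [← av_const k (fl k x + s) t]
  unfold av
  rw [← mul_add, ← lintegral_add_right _ measurable_const]
  gcongr with y
  by_cases h : t < g y
  · rw [Set.indicator_of_mem (by exact h)]; exact le_self_add
  · exact (not_lt.mp h).trans le_add_self

/-- strong weighted bound -/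
lemma strongFS {q : ℝ} (hq : 1 < q) : ∃ C : EN, C ≠ ⊤ ∧ ∀ (s : ℤ) (g h : ℝ → EN), Measurable g → Measurable h →
    ∫⁻ x, (Mx s g x)^q * h x ≤ C * ∫⁻ x, (g x)^q * Mp s h x := by
  set S := ∑' n : ℕ, ((2:EN)^(-(q-1))) ^ n with hS
  refine ⟨2^(2*q) * S, mul_ne_top (by simp [rpow_ne_top_of_nonneg, show 0 ≤ 2*q by linarith]) (geo_a (by linarith)), ?_⟩
  intro s g h hg hh
  have hlev : ∀ j : ℤ, ∫⁻ x, (if (2:EN)^j < Mx s g x then ((2:EN)^(j+1))^q else 0) * h x ≤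
      ∫⁻ x, 2^(2*q) * ((if (2:EN)^(j-1) < g x then ((2:EN)^(j-1))^(q-1) else 0) * (g x * Mp s h x)) := by
    intro j
    have hset : {x | (2:EN)^j < Mx s g x} ⊆ {x | (2:EN)^(j-1) < Mx s ({x | (2:EN)^(j-1) < g x}.indicator g) x} := by
      intro x hx
      simp only [Set.mem_setOf_eq] at hx ⊢
      by_contra hc
      have := (Mx_split s hg (2^(j-1)) x).trans (add_le_add_left (not_lt.mp hc) _)
      rw [← two_mul] at this
      have e : (2:EN) * 2^(j-1) = 2^j := by
        conv_lhs => rw [← zpow_one (2:EN), zpow_one]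
        have := zp_add 1 (j-1)
        rw [zpow_one] at this; rw [← this]; congr 1; ring
      rw [e] at this
      exact absurd hx (not_lt.mpr this)
    have hms : MeasurableSet {x | (2:EN)^j < Mx s g x} := measurableSet_lt measurable_const (meas_Mx _ _)
    have hmg : MeasurableSet {x | (2:EN)^(j-1) < g x} := measurableSet_lt measurable_const hg
    calc ∫⁻ x, (if (2:EN)^j < Mx s g x then ((2:EN)^(j+1))^q else 0) * h x
        = ∫⁻ x, ((2:EN)^(j+1))^q * {x | (2:EN)^j < Mx s g x}.indicator h x := by
          congr 1; ext x
          by_cases hx : (2:EN)^j < Mx s g x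
          · rw [if_pos hx, Set.indicator_of_mem (by exact hx)]
          · rw [if_neg hx, Set.indicator_of_notMem (by exact hx)]; simp
      _ = ((2:EN)^(j+1))^q * ∫⁻ x in {x | (2:EN)^j < Mx s g x}, h x := by
          rw [lintegral_const_mul _ (hh.indicator hms), lintegral_indicator hms]
      _ ≤ (2^(2*q) * ((2:EN)^(j-1))^(q-1)) * (2^(j-1) * ∫⁻ x in {x | (2:EN)^(j-1) < Mx s ({x | (2:EN)^(j-1) < g x}.indicator g) x}, h x) := by
          rw [← mul_assoc]
          refine mul_le_mul' (le_of_eq ?_) (lintegral_mono_set hset)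
          have e2 : ((2:EN)^(j-1)) = ((2:EN)^(j-1))^(1:ℝ) := by simp
          conv_rhs => rhs; rw [e2]
          rw [mul_assoc, ← rpow_add _ _ (zp_ne0 _) (zp_netop _), show j + 1 = 2 + (j-1) by ring, zp_add,
            mul_rpow_of_nonneg _ _ (by linarith), sub_add_cancel, rpow_mul]
          norm_cast
      _ ≤ (2^(2*q) * ((2:EN)^(j-1))^(q-1)) * ∫⁻ x, {x | (2:EN)^(j-1) < g x}.indicator g x * Mp s h x := by
          gcongr; exact weakFS s (hg.indicator hmg) hh _
      _ = _ := by
          rw [← lintegral_const_mul _ (f := fun x => {x | (2:EN)^(j-1) < g x}.indicator g x * Mp s h x) (Measurable.mul (hg.indicator hmg) (meas_Mp s h))]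
          congr 1; ext x
          by_cases hx : (2:EN)^(j-1) < g x
          · rw [if_pos hx, Set.indicator_of_mem (by exact hx)]; ring
          · rw [if_neg hx, Set.indicator_of_notMem (by exact hx)]; simp
  calc ∫⁻ x, (Mx s g x)^q * h x ≤ ∫⁻ x, ∑' j : ℤ, (if (2:EN)^j < Mx s g x then ((2:EN)^(j+1))^q else 0) * h x := by
        refine lintegral_mono fun x => ?_
        simp only
        rw [ENNReal.tsum_mul_right]; gcongr; exact le_layers (by linarith) _
    _ = ∑' j : ℤ, ∫⁻ x, (if (2:EN)^j < Mx s g x then ((2:EN)^(j+1))^q else 0) * h x := by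
        refine lintegral_tsum fun j => (Measurable.mul ?_ hh).aemeasurable
        exact Measurable.ite (measurableSet_lt measurable_const (meas_Mx _ _)) measurable_const measurable_const
    _ ≤ ∑' j : ℤ, ∫⁻ x, 2^(2*q) * ((if (2:EN)^(j-1) < g x then ((2:EN)^(j-1))^(q-1) else 0) * (g x * Mp s h x)) :=
        ENNReal.tsum_le_tsum hlev
    _ = ∫⁻ x, ∑' j : ℤ, 2^(2*q) * ((if (2:EN)^(j-1) < g x then ((2:EN)^(j-1))^(q-1) else 0) * (g x * Mp s h x)) := by
        refine (lintegral_tsum fun j => (Measurable.const_mul (Measurable.mul ?_ (hg.mul (meas_Mp _ _))) _).aemeasurable).symm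
        exact Measurable.ite (measurableSet_lt measurable_const hg) measurable_const measurable_const
    _ ≤ ∫⁻ x, 2^(2*q) * S * ((g x)^q * Mp s h x) := by
        refine lintegral_mono fun x => ?_
        simp only
        have e3 := (Equiv.subRight (1:ℤ)).tsum_eq (fun j : ℤ => if (2:EN)^j < g x then ((2:EN)^j)^(q-1) else 0)
        simp only [Equiv.subRight_apply] at e3
        rw [ENNReal.tsum_mul_left, ENNReal.tsum_mul_right, e3, mul_assoc]
        refine mul_le_mul_right ?_ _
        refine (mul_le_mul_left (geo_lt (by linarith : 0 < q-1) (g x)) _).trans (le_of_eq ?_)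
        rw [← hS]
        have : g x ^ q = g x ^ (q-1) * g x := by
          conv_rhs => rw [← rpow_one (g x), ← rpow_mul, one_mul]
          rw [← rpow_add_of_nonneg _ _ (by linarith) (by norm_num)]; congr 1; ring
        rw [this]; ring
    _ = _ := lintegral_const_mul _ ((hg.pow_const q).mul (meas_Mp _ _))

lemma Mx_const (s : ℤ) (c : EN) (x : ℝ) : Mx s (fun _ => c) x = c := by
  unfold Mx; simp_rw [av_const]; exact ciSup_const

lemma Mp_one (s : ℤ) (x : ℝ) : Mp s (fun _ => 1) x ≤ 2 * kap s := by
  unfold Mp Jx kap; simp_rw [Mx_const]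
  simp only [Finset.sum_const, Finset.card_product, Finset.card_range, nsmul_eq_mul, mul_one]
  norm_cast; omega

lemma strongM {q : ℝ} (hq : 1 < q) : ∃ C : EN, C ≠ ⊤ ∧ ∀ (s : ℤ) (g : ℝ → EN), Measurable g →
    ∫⁻ x, (Mx s g x)^q ≤ C * kap s * ∫⁻ x, (g x)^q := by
  obtain ⟨C, hC, h⟩ := strongFS hq
  refine ⟨C * 2, mul_ne_top hC (by norm_num), fun s g hg => ?_⟩
  have := h s g (fun _ => 1) hg measurable_const
  simp only [mul_one] at this
  refine this.trans ?_
  rw [mul_assoc C 2, mul_assoc C]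
  gcongr
  rw [← lintegral_const_mul _ (hg.pow_const q)]
  refine lintegral_mono fun x => ?_
  simp only
  rw [mul_comm]; gcongr; exact Mp_one s x

lemma holder_lt {α : Type*} [MeasurableSpace α] {μ : Measure α} {p : ℝ} (hp : 0 < p) (hp2 : p < 2) {F X B : α → EN}
    (hX : AEMeasurable X μ) (hB : AEMeasurable B μ) (h : ∀ᵐ x ∂μ, F x ^ (2:ℝ) ≤ X x * B x) :
    ∫⁻ x, F x ^ p ∂μ ≤ (∫⁻ x, X x ∂μ) ^ (p/2) * (∫⁻ x, B x ^ (p/(2-p)) ∂μ) ^ (1 - p/2) := by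
  have h2 : 0 < 2 - p := by linarith
  refine le_trans (lintegral_mono_ae ?_) (lintegral_mul_norm_pow_le hX (hB.pow_const _) (by positivity) (by linarith) (by ring))
  filter_upwards [h] with x hx
  calc F x ^ p = (F x ^ (2:ℝ)) ^ (p/2) := by rw [← rpow_mul]; congr 1; ring
    _ ≤ (X x * B x) ^ (p/2) := by gcongr
    _ = _ := by
      rw [mul_rpow_of_nonneg _ _ (by positivity), ← rpow_mul (B x)]
      congr 2; field_simp

lemma duality_gt {α : Type*} [MeasurableSpace α] {μ : Measure α} {p : ℝ} (hp : 2 < p) {F G T : α → EN} {A : EN}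
    (hG : AEMeasurable G μ) (hT : AEMeasurable T μ) (hfin : ∫⁻ x, F x ^ p ∂μ ≠ ⊤)
    (h1 : ∫⁻ x, F x ^ p ∂μ ≤ ∫⁻ x, G x ^ (2:ℝ) * T x ∂μ)
    (h2 : ∫⁻ x, T x ^ (p/(p-2)) ∂μ ≤ A ^ (p/(p-2)) * ∫⁻ x, F x ^ p ∂μ) :
    ∫⁻ x, F x ^ p ∂μ ≤ A ^ (p/2) * ∫⁻ x, G x ^ p ∂μ := by
  set I := ∫⁻ x, F x ^ p ∂μ
  set Jg := ∫⁻ x, G x ^ p ∂μ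
  have hp2 : 0 < p - 2 := by linarith
  have hp0 : 0 < p := by linarith
  have hle : 2/p ≤ 1 := by rw [div_le_one hp0]; linarith
  have h3 : I ≤ Jg ^ (2/p) * (A * I ^ (1-2/p)) := by
    refine h1.trans ?_
    have := lintegral_mul_norm_pow_le (hG.pow_const p) (hT.pow_const (p/(p-2))) (by positivity : 0 ≤ 2/p) (by linarith : 0 ≤ 1 - 2/p) (by ring)
    refine le_trans (le_of_eq ?_) (this.trans ?_)
    · congr 1; ext x
      rw [← rpow_mul, ← rpow_mul]
      congr 2
      · field_simp
      · rw [show p/(p-2) * (1-2/p) = 1 by field_simp, rpow_one]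
    · refine mul_le_mul' le_rfl ((rpow_le_rpow h2 (by linarith)).trans (le_of_eq ?_))
      rw [mul_rpow_of_nonneg _ _ (by linarith), ← rpow_mul, show p/(p-2) * (1-2/p) = 1 by field_simp, rpow_one]
  rcases eq_or_ne I 0 with h0 | h0
  · rw [h0]; exact zero_le
  have h4 : I ^ (2/p) ≤ A * Jg ^ (2/p) := by
    have hI : I = I ^ (2/p) * I ^ (1-2/p) := by
      rw [← rpow_add _ _ h0 hfin]; simp
    rw [hI] at h3
    have hI0 : I ^ (1-2/p) ≠ 0 := by simp [rpow_eq_zero_iff, h0, hfin]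
    have hIt : I ^ (1-2/p) ≠ ⊤ := rpow_ne_top_of_nonneg (by linarith) hfin
    have h5 : I ^ (2/p) * I ^ (1-2/p) ≤ (A * Jg ^ (2/p)) * I ^ (1-2/p) := by
      rw [← hI] at h3 ⊢; exact h3.trans (le_of_eq (by ring))
    exact (ENNReal.mul_le_mul_iff_left hI0 hIt).mp h5
  calc I = (I ^ (2/p)) ^ (p/2) := by rw [← rpow_mul, show 2/p*(p/2) = 1 by field_simp, rpow_one]
    _ ≤ (A * Jg ^ (2/p)) ^ (p/2) := by gcongr
    _ = _ := by rw [mul_rpow_of_nonneg _ _ (by positivity), ← rpow_mul, show 2/p*(p/2) = 1 by field_simp, rpow_one]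

lemma l2_iSup {ι : Type*} (F : ι → EN) : l2 F = ⨆ S : Finset ι, l2 (fun i : S => F i) := by
  unfold l2
  rw [ENNReal.tsum_eq_iSup_sum]
  have := (orderIsoRpow (1/2) (by norm_num)).map_iSup (fun S : Finset ι => ∑ i ∈ S, F i ^ (2:ℝ))
  simp only [orderIsoRpow_apply] at this
  rw [this]
  congr 1; ext S; congr 1
  rw [tsum_fintype, Finset.sum_coe_sort S (fun i => F i ^ (2:ℝ))]

lemma XN_iSup {α ι : Type*} [Countable ι] [MeasurableSpace α] {p : ℝ} (hp : 0 < p) {μ : Measure α} {F : ι → α → EN}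
    (hF : ∀ i, Measurable (F i)) : XN p μ F = ⨆ S : Finset ι, XN p μ (fun i : S => F i) := by
  classical
  unfold XN
  have : ∀ x, l2 (fun i => F i x) = ⨆ S : Finset ι, l2 (fun i : S => F i x) := fun x => l2_iSup _
  simp_rw [this]
  rw [Nm_iSup hp]
  · intro S; exact (meas_l2 fun i => hF _).aemeasurable
  · intro S T
    refine ⟨S ∪ T, fun x => ?_, fun x => ?_⟩
    · exact l2_comp_inj (e := fun i : S => (⟨i.1, Finset.mem_union_left _ i.2⟩ : ↥(S ∪ T))) (fun a b h => by ext; simpa using h) (fun i => F i x)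
    · exact l2_comp_inj (e := fun i : T => (⟨i.1, Finset.mem_union_right _ i.2⟩ : ↥(S ∪ T))) (fun a b h => by ext; simpa using h) (fun i => F i x)

lemma XN_fin_top {α ι : Type*} [Fintype ι] [MeasurableSpace α] {p : ℝ} (hp : 1 ≤ p) {μ : Measure α} {F : ι → α → EN}
    (hF : ∀ i, Measurable (F i)) (h : ∀ i, Nm p μ (F i) ≠ ⊤) : XN p μ F ≠ ⊤ := by
  have h1 : XN p μ F ≤ ∑' i, Nm p μ (F i) := by
    refine le_trans (Nm_mono (by linarith) fun x => ?_) (Nm_tsum_le hp fun i => (hF i).aemeasurable)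
    classical
    have := l2_tsum_le (fun s i : ι => if s = i then F i x else 0)
    simp only [tsum_ite_eq] at this
    refine this.trans (le_of_eq ?_)
    congr 1; ext s
    unfold l2
    rw [tsum_eq_single s]
    · simp only [if_true]; rw [← rpow_mul]; norm_num
    · intro b hb; simp [hb.symm]
  refine ne_top_of_le_ne_top ?_ h1
  rw [tsum_fintype]; exact ENNReal.sum_ne_top.mpr fun i _ => h i

lemma Nm_top_iff {α : Type*} [MeasurableSpace α] {p : ℝ} (hp : 0 < p) {μ : Measure α} {F : α → EN} :
    Nm p μ F ≠ ⊤ ↔ ∫⁻ x, F x ^ p ∂μ ≠ ⊤ := by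
  unfold Nm; simp [rpow_eq_top_iff, hp, not_lt.mpr hp.le]

lemma NmM {q : ℝ} (hq : 1 < q) : ∃ C : EN, C ≠ ⊤ ∧ 1 ≤ C ∧ ∀ (s : ℤ) (g : ℝ → EN), Measurable g →
    Nm q volume (Mx s g) ≤ C * kap s * Nm q volume g := by
  obtain ⟨C, hC, h⟩ := strongM hq
  refine ⟨max C 1, by simp [hC], le_max_right _ _, fun s g hg => ?_⟩
  rw [Nm_le_iff (by linarith)]
  refine (h s g hg).trans ?_
  gcongr
  calc C * kap s ≤ max C 1 * kap s := by gcongr; exact le_max_left _ _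
    _ = (max C 1 * kap s) ^ (1:ℝ) := by simp
    _ ≤ _ := rpow_le_rpow_of_exponent_le (by have := mul_le_mul' (le_max_right C 1) (kap_ge s); simpa using this) hq.le

lemma av_holder {k m : ℤ} {r r' : ℝ} (hr : r.HolderConjugate r') {f g : ℝ → EN} (hf : Measurable f) (hg : Measurable g) :
    av k m (fun x => f x * g x) ≤ (av k m (fun x => f x ^ r)) ^ (1/r) * (av k m (fun x => g x ^ r')) ^ (1/r') := by
  unfold av
  rw [mul_rpow_of_nonneg _ _ (by have := hr.pos; positivity), mul_rpow_of_nonneg _ _ (by have := hr.symm.pos; positivity)]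
  have := lintegral_mul_le_Lp_mul_Lq (volume.restrict (Dy k m)) hr hf.aemeasurable hg.aemeasurable
  calc _ ≤ (2:EN)^(-k) * _ := mul_le_mul_right this _
    _ = ((2:EN)^(-k)) ^ (1/r + 1/r') * _ := by rw [one_div, one_div, hr.inv_add_inv_eq_one, rpow_one]
    _ = _ := by rw [rpow_add _ _ (zp_ne0 _) (zp_netop _)]; ring

lemma lint_l2_sq {α ι : Type*} [Countable ι] [MeasurableSpace α] {μ : Measure α} {F : ι → α → EN} {h : α → EN}
    (hF : ∀ i, Measurable (F i)) (hh : Measurable h) :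
    ∫⁻ x, l2 (fun i => F i x) ^ (2:ℝ) * h x ∂μ = ∑' i, ∫⁻ x, F i x ^ (2:ℝ) * h x ∂μ := by
  simp_rw [l2_sq, ← ENNReal.tsum_mul_right]
  exact lintegral_tsum fun i => (((hF i).pow_const _).mul hh).aemeasurable

lemma Nm_Mp {q : ℝ} (hq : 1 < q) : ∃ C : EN, C ≠ ⊤ ∧ ∀ (s : ℤ) (h : ℝ → EN), Measurable h →
    Nm q volume (Mp s h) ≤ C * kap s ^ (2:ℝ) * Nm q volume h := by
  obtain ⟨C, hC, _, H⟩ := NmM hq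
  refine ⟨4 * C, mul_ne_top (by norm_num) hC, fun s h hh => ?_⟩
  calc Nm q volume (Mp s h) = Nm q volume (fun x => ∑' i : Jx s, Mx (tt s i) h x) := by
        congr 1; ext x; rw [tsum_fintype, Finset.sum_coe_sort (Jx s) (fun i => Mx (tt s i) h x)]; rfl
    _ ≤ ∑' i : Jx s, Nm q volume (Mx (tt s i) h) := Nm_tsum_le hq.le fun i => (meas_Mx _ _).aemeasurable
    _ ≤ ∑' i : Jx s, C * (2 * kap s) * Nm q volume h := by
        gcongr with i
        refine (H _ h hh).trans ?_
        gcongr; exact kap_tt i.2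
    _ ≤ (2 * kap s) * (C * (2 * kap s) * Nm q volume h) := by
        rw [tsum_fintype, Finset.sum_const, nsmul_eq_mul]
        gcongr
        rw [Finset.card_univ, Fintype.card_coe]
        simp only [Jx, Finset.card_product, Finset.card_range, kap]
        norm_cast; omega
    _ = _ := by rw [show (2:ℝ) = 1 + 1 by norm_num, rpow_add_of_nonneg _ _ (by norm_num) (by norm_num), rpow_one]; ring

lemma FS_gt {p : ℝ} (hp : 2 < p) : ∃ C : EN, C ≠ ⊤ ∧ ∀ (ι : Type) (_ : Countable ι) (s : ℤ) (g : ι → ℝ → EN), (∀ i, Measurable (g i)) →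
    XN p volume (fun i => Mx s (g i)) ≤ C * kap s * XN p volume g := by
  have hp0 : 0 < p := by linarith
  have hr : 1 < p/(p-2) := by rw [lt_div_iff₀ (by linarith)]; linarith
  obtain ⟨C1, hC1, H1⟩ := strongFS (q := 2) (by norm_num)
  obtain ⟨C2, hC2, H2⟩ := Nm_Mp hr
  obtain ⟨C3, hC3, _, H3⟩ := NmM (q := p) (by linarith)
  refine ⟨(C1 * C2)^(1/2:ℝ) + 1, by simp [rpow_ne_top_of_nonneg, mul_ne_top, hC1, hC2], ?_⟩
  intro ι _ s g hg
  rw [XN_iSup hp0 fun i => meas_Mx s (g i)]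
  refine iSup_le fun S => ?_
  by_cases htop : XN p volume g = ⊤
  · rw [htop, mul_top]
    · exact le_top
    · exact mul_ne_zero (by simp) (lt_of_lt_of_le zero_lt_one (kap_ge s)).ne'
  set F : ℝ → EN := fun x => l2 (fun i : S => Mx s (g i) x) with hF
  set G : ℝ → EN := fun x => l2 (fun i : S => g i x) with hG
  have hFm : Measurable F := meas_l2 fun i => meas_Mx _ _
  have hGm : Measurable G := meas_l2 fun i => hg _
  have hGle : XN p volume (fun i : S => g i) ≤ XN p volume g := Nm_mono hp0 fun x => l2_comp_inj Subtype.val_injective (fun i => g i x)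
  refine le_trans ?_ (mul_le_mul_right hGle _)
  have hfin : ∫⁻ x, F x ^ p ≠ ⊤ := by
    rw [← Nm_top_iff hp0]
    refine XN_fin_top (by linarith) (fun i : S => meas_Mx s (g i)) fun i => ?_
    refine ne_top_of_le_ne_top ?_ (H3 s (g i) (hg i))
    refine mul_ne_top (mul_ne_top hC3 (kap_netop s)) (ne_top_of_le_ne_top htop ?_)
    exact Nm_mono hp0 fun x => le_l2 (fun i => g i x) i
  have hhm : Measurable (fun x => F x ^ (p-2)) := hFm.pow_const _
  have e1 : ∀ x, F x ^ p = F x ^ (2:ℝ) * F x ^ (p-2) := by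
    intro x; rw [← rpow_add_of_nonneg _ _ (by norm_num) (by linarith)]; congr 1; ring
  refine (Nm_le_iff hp0).mpr ?_
  have key := duality_gt (A := C1 * C2 * kap s ^ (2:ℝ)) hp hGm.aemeasurable (T := fun x => C1 * Mp s (fun x => F x ^ (p-2)) x)
    ((meas_Mp _ _).const_mul _).aemeasurable hfin ?_ ?_
  · refine key.trans ?_
    gcongr
    calc _ = ((C1 * C2)^(1/2:ℝ) * kap s) ^ p := by
          rw [mul_rpow_of_nonneg (C1*C2) _ (by positivity), mul_rpow_of_nonneg ((C1*C2)^(1/2:ℝ)) _ (by positivity), ← rpow_mul, ← rpow_mul]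
          congr 2 <;> ring
      _ ≤ _ := by gcongr; exact le_self_add
  · simp_rw [e1]
    rw [lint_l2_sq (fun i : S => meas_Mx s (g i)) hhm, lint_l2_sq (fun i : S => hg i) (by fun_prop)]
    refine ENNReal.tsum_le_tsum fun i => (H1 s (g i) _ (hg i) hhm).trans (le_of_eq ?_)
    have hm1 := hg i.1
    rw [← lintegral_const_mul _ (by fun_prop)]
    congr 1; ext x; ring
  · have h3 := H2 s _ hhm
    have h4 : Nm (p/(p-2)) volume (fun x => C1 * Mp s (fun x => F x ^ (p-2)) x) ≤ C1 * C2 * kap s ^ (2:ℝ) * Nm (p/(p-2)) volume (fun x => F x ^ (p-2)) := by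
      rw [Nm_const_mul (by linarith) (meas_Mp _ _).aemeasurable, mul_assoc C1, mul_assoc C1]
      gcongr
    rw [Nm_le_iff (by linarith)] at h4
    refine h4.trans (le_of_eq ?_)
    congr 2; ext x; rw [← rpow_mul]; congr 1; have : p - 2 ≠ 0 := by linarith
    field_simp

lemma FS_two : ∃ C : EN, C ≠ ⊤ ∧ ∀ (ι : Type) (_ : Countable ι) (s : ℤ) (g : ι → ℝ → EN), (∀ i, Measurable (g i)) →
    XN 2 volume (fun i => Mx s (g i)) ≤ C * kap s * XN 2 volume g := by
  obtain ⟨C1, hC1, H1⟩ := strongM (q := 2) (by norm_num)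
  refine ⟨max C1 1, by simp [hC1], fun ι _ s g hg => ?_⟩
  refine (Nm_le_iff (by norm_num)).mpr ?_
  have e := lint_l2_sq (μ := volume) (fun i => meas_Mx s (g i)) (measurable_const (a := (1:EN)))
  have e' := lint_l2_sq (μ := volume) hg (measurable_const (a := (1:EN)))
  simp only [mul_one] at e e'
  rw [e, e', ← ENNReal.tsum_mul_left]
  refine ENNReal.tsum_le_tsum fun i => (H1 s (g i) (hg i)).trans ?_
  gcongr
  calc C1 * kap s ≤ max C1 1 * kap s := by gcongr; exact le_max_left _ _
    _ = (max C1 1 * kap s) ^ (1:ℝ) := by simp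
    _ ≤ _ := rpow_le_rpow_of_exponent_le (by have := mul_le_mul' (le_max_right C1 1) (kap_ge s); simpa using this) (by norm_num)

lemma FS_lt {p : ℝ} (hp : 1 < p) (hp2 : p < 2) : ∃ C : EN, C ≠ ⊤ ∧ ∀ (ι : Type) (_ : Countable ι) (s : ℤ) (g : ι → ℝ → EN), (∀ i, Measurable (g i)) →
    XN p volume (fun i => Mx s (g i)) ≤ C * kap s * XN p volume g := by
  have hp0 : 0 < p := by linarith
  have h2p : 0 < 2 - p := by linarith
  set σ := p/(2-p) with hσ
  have hσ1 : 1 < σ := by rw [hσ, lt_div_iff₀ h2p]; linarith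
  set τ := Real.sqrt σ with hτ
  have hτ1 : 1 < τ := by rw [hτ, Real.lt_sqrt (by norm_num)]; simpa using hσ1
  have hτσ : τ * τ = σ := Real.mul_self_sqrt (by linarith)
  set r := 2*τ/(2*τ-1) with hr
  have h2τ : 0 < 2*τ - 1 := by linarith
  have hr1 : 1 < r := by rw [hr, lt_div_iff₀ h2τ]; linarith
  have hr2 : 1 < 2/r := by rw [hr, lt_div_iff₀ (by linarith), one_mul, div_lt_iff₀ h2τ]; linarith
  have hconj : r.HolderConjugate (2*τ) := by
    rw [Real.holderConjugate_iff]; refine ⟨hr1, ?_⟩; rw [hr]; field_simp; ring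
  obtain ⟨C1, hC1, H1⟩ := strongM hr2
  obtain ⟨C2, hC2, H2⟩ := strongM hτ1
  set C := max (max C1 C2) 1 with hC
  have hCt : C ≠ ⊤ := by simp [hC, hC1, hC2]
  refine ⟨C, hCt, fun ι _ s g hg => ?_⟩
  have hCk : 1 ≤ C * kap s := by have := mul_le_mul' (le_max_right (max C1 C2) 1) (kap_ge s); simpa using this
  by_cases htop : XN p volume g = ⊤
  · rw [htop, mul_top (lt_of_lt_of_le zero_lt_one hCk).ne']; exact le_top
  set G : ℝ → EN := fun x => l2 (fun i => g i x) with hG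
  have hGm : Measurable G := meas_l2 hg
  have hGfin : ∀ᵐ x, G x ≠ ⊤ := by
    have := (Nm_top_iff hp0).mp htop
    filter_upwards [ae_lt_top (hGm.pow_const p) this] with x hx
    intro h; rw [h, top_rpow_of_pos hp0] at hx; simp at hx
  set ρ : ℝ → EN := fun x => G x ^ (2-p) with hρ
  have hρm : Measurable ρ := hGm.pow_const _
  set u : ι → ℝ → EN := fun i x => (g i x ^ (2:ℝ) / ρ x) ^ (r/2) with hu
  have hum : ∀ i, Measurable (u i) := fun i => (((hg i).pow_const _).div hρm).pow_const _
  have hgle : ∀ i x, g i x ≤ G x := fun i x => le_l2 (fun i => g i x) i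
  have hav : ∀ i k m, av k m (g i) ≤ (av k m (u i)) ^ (1/r) * (av k m (fun x => ρ x ^ τ)) ^ (1/(2*τ)) := by
    intro i k m
    have h := av_holder (k := k) (m := m) hconj (f := fun x => (g i x ^ (2:ℝ) / ρ x) ^ (1/2:ℝ)) (g := fun x => ρ x ^ (1/2:ℝ))
      ((((hg i).pow_const _).div hρm).pow_const _) (hρm.pow_const _)
    simp only [← rpow_mul] at h
    rw [show 1/2*(2*τ) = τ by ring, show 1/2*r = r/2 by ring] at h
    refine le_trans ?_ h
    unfold av; gcongr 1
    refine lintegral_mono_ae (ae_restrict_of_ae ?_)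
    filter_upwards [hGfin] with x hx
    rcases eq_or_ne (G x) 0 with h0 | h0
    · have := hgle i x; rw [h0] at this; rw [nonpos_iff_eq_zero.mp this]; exact zero_le
    rw [← mul_rpow_of_nonneg _ _ (by norm_num), ENNReal.div_mul_cancel, ← rpow_mul]
    · norm_num
    · simp [hρ, rpow_eq_zero_iff, h0, hx]
    · exact rpow_ne_top_of_nonneg h2p.le hx
  have hMle : ∀ i x, Mx s (g i) x ^ (2:ℝ) ≤ (Mx s (u i) x) ^ (2/r) * (Mx s (fun x => ρ x ^ τ) x) ^ (1/τ) := by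
    intro i x
    have : Mx s (g i) x ≤ (Mx s (u i) x) ^ (1/r) * (Mx s (fun x => ρ x ^ τ) x) ^ (1/(2*τ)) := by
      refine iSup_le fun k => (hav i k _).trans ?_
      have : 0 < r := by linarith
      gcongr <;> exact av_le_Mx _ _ _ _
    calc _ ≤ _ := rpow_le_rpow this (by norm_num : (0:ℝ) ≤ 2)
      _ = _ := by
        rw [mul_rpow_of_nonneg _ _ (by norm_num), ← rpow_mul, ← rpow_mul]
        congr 2
        · ring
        · field_simp
  have hX : ∫⁻ x, ∑' i, (Mx s (u i) x) ^ (2/r) ≤ (C * kap s) * ∫⁻ x, G x ^ p := by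
    rw [lintegral_tsum fun i => ((meas_Mx s (u i)).pow_const _).aemeasurable]
    calc ∑' i, ∫⁻ x, (Mx s (u i) x) ^ (2/r) ≤ ∑' i, C1 * kap s * ∫⁻ x, u i x ^ (2/r) := ENNReal.tsum_le_tsum fun i => H1 s _ (hum i)
      _ = C1 * kap s * ∫⁻ x, ∑' i, u i x ^ (2/r) := by
        rw [ENNReal.tsum_mul_left, lintegral_tsum fun i => ((hum i).pow_const _).aemeasurable]
      _ ≤ _ := by
        gcongr ?_ * _ * ?_
        · exact (le_max_left _ _).trans (le_max_left _ _)
        · refine lintegral_mono_ae ?_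
          filter_upwards [hGfin] with x hx
          simp only [hu, ← rpow_mul]
          rw [show r/2*(2/r) = 1 by have : r ≠ 0 := by linarith
                                    field_simp]
          simp only [rpow_one, div_eq_mul_inv, ENNReal.tsum_mul_right]
          rw [← l2_sq]
          show G x ^ (2:ℝ) * (G x ^ (2-p))⁻¹ ≤ G x ^ p
          rcases eq_or_ne (G x) 0 with h0 | h0
          · simp [h0]
          rw [← rpow_neg, ← rpow_add _ _ h0 hx]; apply le_of_eq; congr 1; ring
  have hB : ∫⁻ x, ((Mx s (fun x => ρ x ^ τ) x) ^ (1/τ)) ^ (p/(2-p)) ≤ (C * kap s) * ∫⁻ x, G x ^ p := by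
    have e : ∀ x, ((Mx s (fun x => ρ x ^ τ) x) ^ (1/τ)) ^ (p/(2-p)) = (Mx s (fun x => ρ x ^ τ) x) ^ τ := by
      intro x; rw [← rpow_mul]; congr 1; rw [← hσ, ← hτσ]; field_simp
    simp_rw [e]
    refine (H2 s _ (hρm.pow_const _)).trans ?_
    gcongr ?_ * _ * ?_
    · exact (le_max_right _ _).trans (le_max_left _ _)
    · refine le_of_eq ?_
      congr 1; ext x; rw [← rpow_mul, ← rpow_mul, hτσ, hσ]; congr 1; field_simp
  refine (Nm_le_iff hp0).mpr ?_
  refine (holder_lt hp0 hp2 (X := fun x => ∑' i, (Mx s (u i) x) ^ (2/r)) (B := fun x => (Mx s (fun x => ρ x ^ τ) x) ^ (1/τ))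
    (Measurable.ennreal_tsum fun i => (meas_Mx s (u i)).pow_const _).aemeasurable ((meas_Mx _ _).pow_const _).aemeasurable ?_).trans ?_
  · refine ae_of_all _ fun x => ?_
    rw [l2_sq, ← ENNReal.tsum_mul_right]
    exact ENNReal.tsum_le_tsum fun i => hMle i x
  · calc _ ≤ (C * kap s * ∫⁻ x, G x ^ p) ^ (p/2) * (C * kap s * ∫⁻ x, G x ^ p) ^ (1-p/2) := by
          gcongr
          linarith
      _ = C * kap s * ∫⁻ x, G x ^ p := by
        rw [← rpow_add_of_nonneg _ _ (by positivity) (by linarith)]; simp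
      _ ≤ _ := by
        gcongr
        calc C * kap s = (C * kap s) ^ (1:ℝ) := by simp
          _ ≤ _ := rpow_le_rpow_of_exponent_le hCk hp.le

theorem FSp {p : ℝ} (hp : 1 < p) : ∃ C : EN, C ≠ ⊤ ∧ ∀ (ι : Type) (_ : Countable ι) (s : ℤ) (g : ι → ℝ → EN), (∀ i, Measurable (g i)) →
    XN p volume (fun i => Mx s (g i)) ≤ C * kap s * XN p volume g := by
  rcases lt_trichotomy p 2 with h | rfl | h
  · exact FS_lt hp h
  · exact FS_two
  · exact FS_gt h

lemma cell_le {k : ℤ} {c : ℤ → EN} {h B : ℝ → EN} (hh : Measurable h) (hB : Measurable B)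
    (H : ∀ m, c m ≠ 0 → av k m h ≤ av k m B) :
    ∫⁻ x, c (fl k x) ^ (2:ℝ) * h x ≤ ∫⁻ x, c (fl k x) ^ (2:ℝ) * B x := by
  rw [lint_cell_av k (fun m => c m ^ (2:ℝ)) hh, lint_cell_av k (fun m => c m ^ (2:ℝ)) hB]
  refine ENNReal.tsum_le_tsum fun m => ?_
  rcases eq_or_ne (c m) 0 with h0 | h0
  · simp [h0]
  · gcongr; exact H m h0

lemma av_ind {k m : ℤ} {N : Set ℝ} (hN : MeasurableSet N) {θ : EN} (h : volume (N ∩ Dy k m) ≤ θ * 2^k) :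
    av k m (N.indicator fun _ => 1) ≤ θ := by
  unfold av
  rw [lintegral_indicator hN, Measure.restrict_restrict hN, lintegral_one, Measure.restrict_apply_univ]
  calc _ ≤ (2:EN)^(-k) * (θ * 2^k) := by gcongr
    _ = θ := by rw [mul_comm, mul_assoc, zp_mul', mul_one]

lemma ind_mul_sq (N : Set ℝ) (a : EN) (x : ℝ) : (a * N.indicator (fun _ => 1) x) ^ (2:ℝ) = a ^ (2:ℝ) * N.indicator (fun _ => 1) x := by
  by_cases h : x ∈ N <;> simp [h]

def SSLp (p : ℝ) : Prop := ∃ C : EN, C ≠ ⊤ ∧ ∃ ε : ℝ, 0 < ε ∧ ∀ (ι : Type) (_ : Countable ι) (κ : ι → ℤ) (c : ι → ℤ → EN)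
    (N : ι → Set ℝ) (θ : EN), (∀ i, MeasurableSet (N i)) → (∀ i m, volume (N i ∩ Dy (κ i) m) ≤ θ * 2^(κ i)) → θ ≠ ⊤ →
    XN p volume (fun i x => c i (fl (κ i) x) * (N i).indicator (fun _ => 1) x) ≤ C * θ ^ ε * XN p volume (fun i x => c i (fl (κ i) x))

lemma SSL_two : SSLp 2 := by
  refine ⟨1, by simp, 1/2, by norm_num, fun ι _ κ c N θ hN hθ _ => ?_⟩
  refine (Nm_le_iff (by norm_num)).mpr ?_
  have hm : ∀ i, Measurable (fun x => c i (fl (κ i) x)) := fun i => meas_cell _ _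
  have hm2 : ∀ i, Measurable ((N i).indicator (fun _ => (1:EN))) := fun i => measurable_const.indicator (hN i)
  have e := lint_l2_sq (μ := volume) (fun i => (hm i).mul (hm2 i)) (measurable_const (a := (1:EN)))
  have e' := lint_l2_sq (μ := volume) hm (measurable_const (a := (1:EN)))
  simp only [mul_one, Pi.mul_apply] at e e'
  rw [e, e', ← ENNReal.tsum_mul_left]
  refine ENNReal.tsum_le_tsum fun i => ?_
  simp_rw [ind_mul_sq]
  refine (cell_le (B := fun _ => θ) (hm2 i) measurable_const fun m _ => ?_).trans (le_of_eq ?_)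
  · rw [av_const]; exact av_ind (hN i) (hθ i m)
  · rw [lintegral_mul_const _ ((hm i).pow_const _), mul_comm, one_mul, ← rpow_mul]; norm_num

lemma SSL_gt {p : ℝ} (hp : 2 < p) : SSLp p := by
  have hp0 : 0 < p := by linarith
  have h2p : 0 < p - 2 := by linarith
  set σ := p/(p-2) with hσ
  have hσ1 : 1 < σ := by rw [hσ, lt_div_iff₀ h2p]; linarith
  set r := Real.sqrt σ with hr
  have hr1 : 1 < r := by rw [hr, Real.lt_sqrt (by norm_num)]; simpa using hσ1
  have hrσ : r * r = σ := Real.mul_self_sqrt (by linarith)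
  have hconj := (Real.HolderConjugate.conjExponent hr1).symm
  set r' := r.conjExponent with hr'
  have hr'0 : 0 < r' := hconj.pos
  obtain ⟨C1, hC1, H1⟩ := strongM hr1
  have h2le : 2/p ≤ 1 := by rw [div_le_one hp0]; linarith
  refine ⟨((C1 * kap 0) ^ (1-2/p)) ^ (1/p), rpow_ne_top_of_nonneg (by positivity) (rpow_ne_top_of_nonneg (by linarith)
    (mul_ne_top hC1 (kap_netop 0))), 1/r'*(1/p), by positivity, fun ι _ κ c N θ hN hθ hθt => ?_⟩
  have hm : ∀ i, Measurable (fun x => c i (fl (κ i) x)) := fun i => meas_cell _ _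
  have hm2 : ∀ i, Measurable ((N i).indicator (fun _ => (1:EN))) := fun i => measurable_const.indicator (hN i)
  set F : ℝ → EN := fun x => l2 (fun i => c i (fl (κ i) x) * (N i).indicator (fun _ => 1) x) with hF
  set G : ℝ → EN := fun x => l2 (fun i => c i (fl (κ i) x)) with hG
  have hGm : Measurable G := meas_l2 hm
  have hFG : ∀ x, F x ≤ G x := fun x => l2_mono fun i => by
    by_cases h : x ∈ N i <;> simp [h]
  set h : ℝ → EN := fun x => G x ^ (p-2) with hh
  have hhm : Measurable h := hGm.pow_const _
  set T : ℝ → EN := fun x => (Mx 0 (fun x => h x ^ r) x) ^ (1/r) with hT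
  have hTm : Measurable T := (meas_Mx _ _).pow_const _
  refine (Nm_le_iff hp0).mpr ?_
  calc ∫⁻ x, F x ^ p ≤ ∫⁻ x, F x ^ (2:ℝ) * h x := by
        refine lintegral_mono fun x => ?_
        have : F x ^ p = F x ^ (2:ℝ) * F x ^ (p-2) := by
          rw [← rpow_add_of_nonneg _ _ (by norm_num) (by linarith)]; congr 1; ring
        rw [this]; simp only [hh]; gcongr; exact hFG x
    _ = ∑' i, ∫⁻ x, c i (fl (κ i) x) ^ (2:ℝ) * ((N i).indicator (fun _ => 1) x * h x) := by
        have e := lint_l2_sq (μ := volume) (F := fun i x => c i (fl (κ i) x) * (N i).indicator (fun _ => 1) x) (fun i => (hm i).mul (hm2 i)) hhm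
        refine e.trans ?_
        congr 1; ext i; congr 1; ext x; rw [ind_mul_sq]; ring
    _ ≤ ∑' i, ∫⁻ x, c i (fl (κ i) x) ^ (2:ℝ) * (θ^(1/r') * T x) := by
        refine ENNReal.tsum_le_tsum fun i => cell_le ((hm2 i).mul hhm) (hTm.const_mul _) fun m _ => ?_
        have h1 := av_holder (k := κ i) (m := m) hconj (hm2 i) hhm
        have e1 : ∀ x, (N i).indicator (fun _ => (1:EN)) x ^ r' = (N i).indicator (fun _ => (1:EN)) x := by
          intro x; by_cases h : x ∈ N i <;> simp [h, hr'0]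
        simp_rw [e1] at h1
        refine h1.trans ?_
        have h2 : av (κ i) m (fun x => θ^(1/r') * T x) = θ^(1/r') * av (κ i) m T := by
          unfold av; rw [lintegral_const_mul _ hTm]; ring
        rw [h2]
        gcongr
        · exact av_ind (hN i) (hθ i m)
        · rw [← av_const (κ i) m ((av (κ i) m fun x => h x ^ r) ^ (1/r))]
          unfold av
          refine mul_le_mul_right ?_ _
          refine setLIntegral_mono hTm fun x hx => ?_
          simp only [hT]
          gcongr
          have := av_le_Mx (κ i) 0 (fun x => h x ^ r) x
          rw [add_zero, show fl (κ i) x = m from hx] at this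
          exact this
    _ = θ^(1/r') * ∫⁻ x, G x ^ (2:ℝ) * T x := by
        rw [hG, lint_l2_sq hm hTm, ← ENNReal.tsum_mul_left]
        congr 1; ext i
        have hmi := hm i
        rw [← lintegral_const_mul (f := fun x => c i (fl (κ i) x) ^ (2:ℝ) * T x) _ ((hmi.pow_const _).mul hTm)]
        congr 1; ext x; ring
    _ ≤ θ^(1/r') * ((∫⁻ x, G x ^ p) ^ (2/p) * (∫⁻ x, T x ^ σ) ^ (1-2/p)) := by
        gcongr
        refine le_trans (le_of_eq ?_) (lintegral_mul_norm_pow_le (hGm.pow_const p).aemeasurable (hTm.pow_const σ).aemeasurable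
          (by positivity : 0 ≤ 2/p) (by linarith : 0 ≤ 1 - 2/p) (by ring))
        congr 1; ext x
        rw [← rpow_mul, ← rpow_mul]
        congr 2
        · field_simp
        · rw [hσ, show p/(p-2) * (1-2/p) = 1 by field_simp, rpow_one]
    _ ≤ θ^(1/r') * ((∫⁻ x, G x ^ p) ^ (2/p) * (C1 * kap 0 * ∫⁻ x, G x ^ p) ^ (1-2/p)) := by
        gcongr θ^(1/r') * (_ * ?_)
        refine rpow_le_rpow ?_ (by linarith)
        have e : ∀ x, T x ^ σ = (Mx 0 (fun x => h x ^ r) x) ^ r := by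
          intro x; simp only [hT]; rw [← rpow_mul, ← hrσ]; congr 1; field_simp
        simp_rw [e]
        refine (H1 0 _ (hhm.pow_const _)).trans (le_of_eq ?_)
        congr 2; ext x; simp only [hh]; rw [← rpow_mul, ← rpow_mul, hrσ, hσ]; congr 1; field_simp
    _ = _ := by
        rw [mul_rpow_of_nonneg (C1 * kap 0) _ (by linarith), mul_rpow_of_nonneg _ _ hp0.le, ← rpow_mul θ, ← rpow_mul (_ ^ (1-2/p)),
          show 1/p*p = 1 by field_simp, show 1/r'*(1/p)*p = 1/r' by field_simp, rpow_one]
        have : (∫⁻ x, G x ^ p) = (∫⁻ x, G x ^ p) ^ (2/p) * (∫⁻ x, G x ^ p) ^ (1-2/p) := by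
          rw [← rpow_add_of_nonneg _ _ (by positivity) (by linarith)]; simp
        conv_rhs => rw [this]
        ring

lemma SSL_lt {p : ℝ} (hp : 1 < p) (hp2 : p < 2) : SSLp p := by
  have hp0 : 0 < p := by linarith
  have h2p : 0 < 2 - p := by linarith
  set σ := p/(2-p) with hσ
  have hσ1 : 1 < σ := by rw [hσ, lt_div_iff₀ h2p]; linarith
  obtain ⟨C1, hC1, H1⟩ := strongM hσ1
  set C := ((C1 * kap 0) ^ (1-p/2)) ^ (1/p) + 1 with hC
  refine ⟨C, by
    have := rpow_ne_top_of_nonneg (by positivity : 0 ≤ 1/p) (rpow_ne_top_of_nonneg (by linarith : 0 ≤ 1-p/2)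
     (mul_ne_top hC1 (kap_netop 0)))
    rw [hC]; exact ENNReal.add_ne_top.mpr ⟨this, by simp⟩, 1/2, by positivity, fun ι _ κ c N θ hN hθ hθt => ?_⟩
  have hm : ∀ i, Measurable (fun x => c i (fl (κ i) x)) := fun i => meas_cell _ _
  have hm2 : ∀ i, Measurable ((N i).indicator (fun _ => (1:EN))) := fun i => measurable_const.indicator (hN i)
  set F : ℝ → EN := fun x => l2 (fun i => c i (fl (κ i) x) * (N i).indicator (fun _ => 1) x) with hF
  set G : ℝ → EN := fun x => l2 (fun i => c i (fl (κ i) x)) with hG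
  have hGm : Measurable G := meas_l2 hm
  have hFG : ∀ x, F x ≤ G x := fun x => l2_mono fun i => by
    by_cases h : x ∈ N i <;> simp [h]
  rcases eq_or_ne θ 0 with rfl | hθ0
  · have hz : ∀ i, ∀ᵐ x, x ∉ N i := by
      intro i
      rw [ae_iff]; simp only [not_not, Set.setOf_mem_eq]
      have : N i = ⋃ m, N i ∩ Dy (κ i) m := by ext x; simp [Dy]
      rw [this, measure_iUnion_null_iff]
      intro m; have := hθ i m; rwa [zero_mul, nonpos_iff_eq_zero] at this
    have : XN p volume (fun i x => c i (fl (κ i) x) * (N i).indicator (fun _ => 1) x) ≤ Nm p volume (fun _ : ℝ => 0) := by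
      refine Nm_mono_ae hp0 ?_
      filter_upwards [ae_all_iff.mpr hz] with x hx
      simp [l2, hx]
    refine this.trans ?_
    simp [Nm, hp0]
  by_cases htop : Nm p volume G = ⊤
  · show _ ≤ C * θ ^ (1/2:ℝ) * Nm p volume G
    rw [htop, mul_top]
    · exact le_top
    · refine mul_ne_zero (by simp [hC]) ?_
      simp [hθ0, hθt]
  have hGfin : ∀ᵐ x, G x ≠ ⊤ := by
    have := (Nm_top_iff hp0).mp htop
    filter_upwards [ae_lt_top (hGm.pow_const p) this] with x hx
    intro h; rw [h, top_rpow_of_pos hp0] at hx; simp at hx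
  set ρ : ℝ → EN := fun x => G x ^ (2-p) with hρ
  have hρm : Measurable ρ := hGm.pow_const _
  have hcρ : ∀ i x, c i (fl (κ i) x) ^ (2-p) ≤ ρ x := fun i x => by
    simp only [hρ]; gcongr; exact le_l2 (fun i => c i (fl (κ i) x)) i
  set B := Mx 0 ρ with hB
  have hBm : Measurable B := meas_Mx _ _
  have hIB : ∫⁻ x, B x ^ σ ≤ C1 * kap 0 * ∫⁻ x, G x ^ p := by
    refine (H1 0 ρ hρm).trans (le_of_eq ?_)
    congr 2; ext x; simp only [hρ]; rw [← rpow_mul, hσ]; congr 1; field_simp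
  have hBfin : ∀ᵐ x, B x ≠ ⊤ := by
    have h1 := (Nm_top_iff hp0).mp htop
    have : ∫⁻ x, B x ^ σ ≠ ⊤ := ne_top_of_le_ne_top (mul_ne_top (mul_ne_top hC1 (kap_netop 0)) h1) hIB
    filter_upwards [ae_lt_top (hBm.pow_const σ) this] with x hx
    intro h; rw [h, top_rpow_of_pos (by linarith)] at hx; simp at hx
  have hcav : ∀ i m, c i m ^ (2-p) ≤ av (κ i) m ρ := by
    intro i m
    rw [← av_const (κ i) m (c i m ^ (2-p))]
    unfold av
    refine mul_le_mul_right ?_ _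
    refine setLIntegral_mono hρm fun x hx => ?_
    have := hcρ i x; rwa [show fl (κ i) x = m from hx] at this
  have hcB : ∀ i x, c i (fl (κ i) x) ^ (2-p) ≤ B x := fun i x => (hcav i _).trans (by simpa using av_le_Mx (κ i) 0 ρ x)
  set X : ℝ → EN := fun x => ∑' i, c i (fl (κ i) x) ^ (2:ℝ) * ((N i).indicator (fun _ => 1) x * (B x)⁻¹) with hX
  have hXt : ∀ i, Measurable fun x => c i (fl (κ i) x) ^ (2:ℝ) * ((N i).indicator (fun _ => 1) x * (B x)⁻¹) := fun i =>
    ((hm i).pow_const _).mul ((hm2 i).mul hBm.inv)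
  have hIX : ∫⁻ x, X x ≤ θ * ∫⁻ x, G x ^ p := by
    calc ∫⁻ x, X x = ∑' i, ∫⁻ x, c i (fl (κ i) x) ^ (2:ℝ) * ((N i).indicator (fun _ => 1) x * (B x)⁻¹) :=
          lintegral_tsum fun i => (hXt i).aemeasurable
      _ ≤ ∑' i, ∫⁻ x, c i (fl (κ i) x) ^ (2:ℝ) * (θ * (ρ x)⁻¹) := by
          refine ENNReal.tsum_le_tsum fun i => cell_le ((hm2 i).mul hBm.inv) (hρm.inv.const_mul _) fun m hcm => ?_
          have h2 : av (κ i) m (fun x => θ * (ρ x)⁻¹) = θ * av (κ i) m (fun x => (ρ x)⁻¹) := by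
            unfold av; rw [lintegral_const_mul (f := fun x => (ρ x)⁻¹) _ hρm.inv]; ring
          rw [h2]
          have hc0 : c i m ^ (2-p) ≠ 0 := by simp [rpow_eq_zero_iff, hcm, h2p.le, h2p.not_gt]
          have hJ : (av (κ i) m ρ)⁻¹ ≤ av (κ i) m (fun x => (ρ x)⁻¹) := by
            have h3 := av_holder (k := κ i) (m := m) Real.HolderConjugate.two_two (f := fun x => ρ x ^ (1/2:ℝ)) (g := fun x => (ρ x)⁻¹ ^ (1/2:ℝ)) (hρm.pow_const (1/2)) (hρm.inv.pow_const (1/2))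
            simp only [← rpow_mul] at h3
            norm_num at h3
            have h4 : (1:EN) ≤ av (κ i) m ρ ^ (1/2:ℝ) * av (κ i) m (fun x => (ρ x)⁻¹) ^ (1/2:ℝ) := by
              norm_num
              refine le_trans ?_ h3
              rw [← av_const (κ i) m 1]
              unfold av
              refine mul_le_mul_right ?_ _
              refine lintegral_mono_ae ?_
              filter_upwards [ae_restrict_mem (meas_Dy (κ i) m), ae_restrict_of_ae hGfin] with x hx hx2
              have h5 := hcρ i x
              rw [show fl (κ i) x = m from hx] at h5
              have h6 : ρ x ≠ 0 := fun h => hc0 (nonpos_iff_eq_zero.mp (h ▸ h5))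
              have h7 : ρ x ≠ ⊤ := rpow_ne_top_of_nonneg h2p.le hx2
              rw [← mul_rpow_of_nonneg _ _ (by norm_num), ENNReal.mul_inv_cancel h6 h7]; simp
            rw [← mul_rpow_of_nonneg _ _ (by norm_num)] at h4
            have h8 : 1 ≤ av (κ i) m ρ * av (κ i) m (fun x => (ρ x)⁻¹) := by
              by_contra hlt
              exact absurd h4 (not_le.mpr (rpow_lt_one (not_le.mp hlt) (by norm_num)))
            rw [inv_le_iff_le_mul]
            · rw [mul_comm]; rwa [mul_comm] at h8
            · intro _ h; exact hc0 (nonpos_iff_eq_zero.mp (h ▸ hcav i m))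
            · intro h h9; rw [h9, mul_zero] at h8; simp at h8
          calc av (κ i) m (fun x => (N i).indicator (fun _ => 1) x * (B x)⁻¹)
              ≤ av (κ i) m (fun x => (N i).indicator (fun _ => 1) x) * (av (κ i) m ρ)⁻¹ := by
                unfold av
                rw [mul_assoc, ← lintegral_mul_const _ (hm2 i)]
                refine mul_le_mul_right ?_ _
                refine setLIntegral_mono ((hm2 i).mul_const _) fun x hx => ?_
                gcongr
                have := av_le_Mx (κ i) 0 ρ x
                rw [add_zero, show fl (κ i) x = m from hx] at this
                exact this
            _ ≤ _ := mul_le_mul' (av_ind (hN i) (hθ i m)) hJ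
      _ = ∫⁻ x, ∑' i, c i (fl (κ i) x) ^ (2:ℝ) * (θ * (ρ x)⁻¹) :=
          (lintegral_tsum fun i => (((hm i).pow_const _).mul (hρm.inv.const_mul _)).aemeasurable).symm
      _ ≤ ∫⁻ x, θ * G x ^ p := by
          refine lintegral_mono_ae ?_
          filter_upwards [hGfin] with x hx
          rw [ENNReal.tsum_mul_right, ← l2_sq]
          show G x ^ (2:ℝ) * (θ * (G x ^ (2-p))⁻¹) ≤ θ * G x ^ p
          rcases eq_or_ne (G x) 0 with h0 | h0
          · simp [h0]
          rw [← rpow_neg, mul_left_comm, ← rpow_add _ _ h0 hx]; apply le_of_eq; congr 2; ring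
      _ = _ := lintegral_const_mul _ (hGm.pow_const _)
  refine (Nm_le_iff hp0).mpr ?_
  refine (holder_lt hp0 hp2 (X := X) (B := B) (Measurable.ennreal_tsum hXt).aemeasurable hBm.aemeasurable ?_).trans ?_
  · filter_upwards [hBfin] with x hx
    rw [l2_sq]; simp only [hX]; rw [← ENNReal.tsum_mul_right]
    refine ENNReal.tsum_le_tsum fun i => ?_
    rw [ind_mul_sq]
    rcases eq_or_ne (B x) 0 with h0 | h0
    · have := hcB i x; rw [h0, nonpos_iff_eq_zero, rpow_eq_zero_iff] at this
      rcases this with h | h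
      · simp [h.1]
      · exact absurd h.2 (by linarith)
    · rw [mul_assoc, mul_assoc, ENNReal.inv_mul_cancel h0 hx, mul_one]
  · calc _ ≤ (θ * ∫⁻ x, G x ^ p) ^ (p/2) * (C1 * kap 0 * ∫⁻ x, G x ^ p) ^ (1-p/2) := by
          gcongr
          linarith
      _ = (C1 * kap 0) ^ (1-p/2) * θ ^ (p/2) * ∫⁻ x, G x ^ p := by
        rw [mul_rpow_of_nonneg _ _ (by positivity), mul_rpow_of_nonneg (C1 * kap 0) _ (by linarith)]
        have : (∫⁻ x, G x ^ p) = (∫⁻ x, G x ^ p) ^ (p/2) * (∫⁻ x, G x ^ p) ^ (1-p/2) := by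
          rw [← rpow_add_of_nonneg _ _ (by positivity) (by linarith)]; simp
        conv_rhs => rw [this]
        ring
      _ ≤ _ := by
        gcongr
        rw [mul_rpow_of_nonneg _ _ hp0.le, ← rpow_mul, show 1/2*p = p/2 by ring]
        gcongr
        calc _ = (((C1 * kap 0) ^ (1-p/2)) ^ (1/p)) ^ p := by rw [← rpow_mul, one_div_mul_cancel hp0.ne', rpow_one]
          _ ≤ _ := by gcongr; exact le_self_add

theorem SSL {p : ℝ} (hp : 1 < p) : SSLp p := by
  rcases lt_trichotomy p 2 with h | rfl | h
  · exact SSL_lt hp h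
  · exact SSL_two
  · exact SSL_gt h

noncomputable def wd (a : ℕ) (s : ℤ) : EN := (((1 + s.natAbs : ℕ) : EN) ^ a)⁻¹

lemma wd_ne0 (a : ℕ) (s : ℤ) : ((1 + s.natAbs : ℕ) : EN) ^ a ≠ 0 := pow_ne_zero _ (by simp)
lemma wd_netop (a : ℕ) (s : ℤ) : ((1 + s.natAbs : ℕ) : EN) ^ a ≠ ⊤ := pow_ne_top (natCast_ne_top _)

lemma wd_add (a b : ℕ) (s : ℤ) : wd (a+b) s = wd a s * wd b s := by
  unfold wd
  rw [pow_add, ENNReal.mul_inv (Or.inl (wd_ne0 a s)) (Or.inl (wd_netop a s))]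

lemma wd_anti (a : ℕ) {s t : ℤ} (h : s.natAbs ≤ t.natAbs) : wd a t ≤ wd a s := by
  unfold wd; gcongr

lemma wd_le_one (a : ℕ) (s : ℤ) : wd a s ≤ 1 := by
  unfold wd
  rw [ENNReal.inv_le_one]
  exact one_le_pow₀ (by norm_cast; omega)

lemma wd_mono {a b : ℕ} (h : a ≤ b) (s : ℤ) : wd b s ≤ wd a s := by
  obtain ⟨c, rfl⟩ := Nat.exists_eq_add_of_le h
  rw [wd_add]; exact mul_le_of_le_one_right' (wd_le_one _ _)

lemma wd_sum : ∑' s : ℤ, wd 2 s ≠ ⊤ := by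
  have e : ∀ s : ℤ, wd 2 s = (((((1 + s.natAbs : ℕ) : NNReal) ^ 2)⁻¹ : NNReal) : EN) := by
    intro s; unfold wd
    rw [coe_inv (by positivity)]; push_cast; rfl
  simp_rw [e]
  rw [tsum_coe_ne_top_iff_summable, ← NNReal.summable_coe]
  have h0 : Summable (fun n : ℕ => (((n+1:ℕ) : ℝ) ^ 2)⁻¹) :=
    (summable_nat_add_iff 1).mpr (Real.summable_nat_pow_inv.mpr (by norm_num))
  refine Summable.of_nat_of_neg_add_one ?_ ?_
  · refine h0.congr fun n => ?_
    push_cast; simp [add_comm]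
  · refine ((summable_nat_add_iff 1).mpr h0).congr fun n => ?_
    have : (-((n:ℤ)+1)).natAbs = n+1 := by omega
    rw [this]; push_cast; ring_nf

lemma size_le_self (m : ℕ) : Nat.size m ≤ m := by
  rw [Nat.size_le]; exact Nat.lt_two_pow_self

lemma kap_add (n s : ℤ) : kap (n + s) ≤ kap n * kap s := by
  unfold kap
  norm_cast
  set a := Nat.size n.natAbs with ha
  set b := Nat.size s.natAbs with hb
  have h1 : n.natAbs < 2^a := Nat.size_le.mp le_rfl
  have h2 : s.natAbs < 2^b := Nat.size_le.mp le_rfl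
  have h3 : Nat.size (n+s).natAbs ≤ a + b + 1 := by
    rw [Nat.size_le]
    have h4 : (2:ℕ)^a ≤ 2^(a+b) := Nat.pow_le_pow_right (by norm_num) (by omega)
    have h5 : (2:ℕ)^b ≤ 2^(a+b) := Nat.pow_le_pow_right (by norm_num) (by omega)
    have h6 := Int.natAbs_add_le n s
    rw [pow_succ]; omega
  nlinarith

lemma wd_kap_sum : ∃ C : EN, C ≠ ⊤ ∧ ∀ n : ℤ, ∑' s, wd 3 s * kap (n + s) ≤ C * kap n := by
  refine ⟨2 * ∑' s, wd 2 s, mul_ne_top (by simp) wd_sum, fun n => ?_⟩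
  rw [mul_assoc, ← ENNReal.tsum_mul_right, ← ENNReal.tsum_mul_left]
  refine ENNReal.tsum_le_tsum fun s => ?_
  have h : wd 1 s * kap s ≤ 2 := by
    unfold wd kap
    rw [pow_one, mul_comm, ← div_eq_mul_inv]
    refine div_le_of_le_mul ?_
    norm_cast
    have := size_le_self s.natAbs
    omega
  calc wd 3 s * kap (n+s) ≤ (wd 2 s * wd 1 s) * (kap n * kap s) := by
        rw [← wd_add]; gcongr; exact kap_add n s
    _ = (wd 1 s * kap s) * (wd 2 s * kap n) := by ring
    _ ≤ _ := by gcongr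

/-- edge cells -/
def NN (j : ℕ) (k : ℤ) : Set ℝ := {y | fl k y % 2^j = 0 ∨ fl k y % 2^j = 2^j - 1}

lemma meas_NN (j : ℕ) (k : ℤ) : MeasurableSet (NN j k) :=
  measurable_fl k (MeasurableSet.of_discrete (s := {m : ℤ | m % 2^j = 0 ∨ m % 2^j = 2^j - 1}))

lemma vol_NN (j : ℕ) (k m : ℤ) : volume (NN j k ∩ Dy (k+j+1) m) ≤ (4 * (2⁻¹)^(j+1)) * 2^(k+j+1) := by
  have h : NN j k ∩ Dy (k+j+1) m ⊆ (Dy k (2^(j+1)*m) ∪ Dy k (2^(j+1)*m+2^j-1)) ∪ (Dy k (2^(j+1)*m+2^j) ∪ Dy k (2^(j+1)*m+2^(j+1)-1)) := by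
    rintro x ⟨h1, h2⟩
    have h3 : fl k x / 2^(j+1) = m := by
      have := fl_add k (j+1) x
      rw [← this]; push_cast; rw [← add_assoc]; exact h2
    simp only [Dy, Set.mem_union, Set.mem_setOf_eq]
    simp only [NN, Set.mem_setOf_eq] at h1
    set t := fl k x
    have hp : (0:ℤ) < 2^j := by positivity
    have h4 := Int.emod_add_mul_ediv t (2^j)
    have h5 : t / 2^j / 2 = m := by rw [← h3, pow_succ, Int.ediv_ediv_of_nonneg (by positivity)]
    set u := t / 2^j
    have h6 : u = 2*m ∨ u = 2*m+1 := by omega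
    rw [pow_succ]
    rcases h6 with h6 | h6 <;> rw [h6] at h4 <;> rcases h1 with h1 | h1 <;> rw [h1] at h4
    · left; left; linarith
    · left; right; linarith
    · right; left; linarith
    · right; right; linarith
  refine (measure_mono h).trans ((measure_union_le _ _).trans ((add_le_add (measure_union_le _ _) (measure_union_le _ _)).trans (le_of_eq ?_)))
  simp only [vol_Dy]
  have : (2:EN)^(k+j+1) = 2^k * 2^(j+1) := by
    rw [add_assoc, zp_add]; congr 1; rw [← zpow_natCast]; push_cast; rfl
  rw [this, ← ENNReal.inv_pow]
  have h2 : ((2:EN)^(j+1))⁻¹ * 2^(j+1) = 1 := ENNReal.inv_mul_cancel (by simp) (by simp)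
  calc _ = 4 * (2:EN)^k * 1 := by ring
    _ = _ := by rw [← h2]; ring

noncomputable def gK (c : ℤ → ℤ → EN) (j : ℕ) (k : ℤ) (y : ℝ) : EN :=
  (2⁻¹)^j * c (k-j) (fl (k-j) y) + c (k+j+1) (fl (k+j+1) y) * (NN j k).indicator (fun _ => 1) y

noncomputable def KK (c : ℤ → ℤ → EN) (k q : ℤ) : EN := ∑' j : ℕ, ∑' s : ℤ, wd 3 s * av k (q+s) (gK c j k)

lemma meas_gK (c : ℤ → ℤ → EN) (j : ℕ) (k : ℤ) : Measurable (gK c j k) :=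
  ((meas_cell _ _).const_mul _).add ((meas_cell _ _).mul (measurable_const.indicator (meas_NN j k)))

lemma XN_comp_inj {α ι κ : Type*} [MeasurableSpace α] {p : ℝ} (hp : 0 < p) {μ : Measure α} {e : κ → ι} (he : Function.Injective e)
    (F : ι → α → EN) : XN p μ (fun i => F (e i)) ≤ XN p μ F := Nm_mono hp fun x => l2_comp_inj he fun i => F i x

lemma XN_add_le {α ι : Type*} [Countable ι] [MeasurableSpace α] {p : ℝ} (hp : 1 ≤ p) {μ : Measure α} {F G : ι → α → EN}
    (hF : ∀ i, Measurable (F i)) (hG : ∀ i, Measurable (G i)) : XN p μ (fun i x => F i x + G i x) ≤ XN p μ F + XN p μ G := by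
  refine le_trans (Nm_mono (by linarith) fun x => ?_) (Nm_add_le hp (meas_l2 hF).aemeasurable (meas_l2 hG).aemeasurable)
  have := l2_tsum_le (κ := Bool) (fun b i => if b then F i x else G i x)
  simpa [tsum_bool, add_comm] using this

theorem MAT {p : ℝ} (hp : 1 < p) : ∃ C : EN, C ≠ ⊤ ∧ ∀ (ι : Type) (_ : Countable ι) (n : ℤ) (c : ι → ℤ → ℤ → EN),
    XN p volume (fun (i : ι × ℤ) x => KK (c i.1) i.2 (fl i.2 x + n)) ≤ C * kap n * XN p volume (fun (i : ι × ℤ) x => c i.1 i.2 (fl i.2 x)) := by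
  obtain ⟨C1, hC1, H1⟩ := FSp hp
  obtain ⟨C2, hC2, ε, hε, H2⟩ := SSL hp
  obtain ⟨C3, hC3, H3⟩ := wd_kap_sum
  set Z : EN := ∑' j : ℕ, ((2⁻¹)^j + C2 * (4 * (2⁻¹)^(j+1)) ^ ε) with hZ
  have hZt : Z ≠ ⊤ := by
    rw [hZ, ENNReal.tsum_add, ENNReal.tsum_mul_left]
    refine ENNReal.add_ne_top.mpr ⟨by rw [tsum_geometric]; simp [one_sub_inv_two], mul_ne_top hC2 ?_⟩
    have e : ∀ j : ℕ, ((4:EN) * (2⁻¹)^(j+1)) ^ ε = (4 * 2⁻¹) ^ ε * ((2:EN) ^ (-ε)) ^ j := by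
      intro j
      rw [pow_succ', ← mul_assoc, mul_rpow_of_nonneg _ _ hε.le]
      congr 1
      rw [rpow_neg, ← inv_rpow, ← rpow_natCast, ← rpow_natCast, ← rpow_mul, ← rpow_mul, mul_comm]
    simp_rw [e, ENNReal.tsum_mul_left]
    exact mul_ne_top (rpow_ne_top_of_nonneg hε.le (mul_ne_top (by simp) (by simp))) (geo_a hε)
  have hp0 : 0 < p := by linarith
  refine ⟨Z * C1 * C3, mul_ne_top (mul_ne_top hZt hC1) hC3, fun ι _ n c => ?_⟩
  set Q := XN p volume (fun (i : ι × ℤ) x => c i.1 i.2 (fl i.2 x)) with hQ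
  have hm : ∀ (k : ℤ) (g : ℤ → EN), Measurable fun x => g (fl k x) := fun k g => meas_cell k g
  have hg : ∀ j : ℕ, XN p volume (fun (i : ι × ℤ) => gK (c i.1) j i.2) ≤ ((2⁻¹)^j + C2 * (4 * (2⁻¹)^(j+1)) ^ ε) * Q := by
    intro j
    rw [add_mul]
    refine (XN_add_le hp.le (F := fun (i : ι × ℤ) y => (2⁻¹)^j * c i.1 (i.2-j) (fl (i.2-j) y))
      (G := fun i y => c i.1 (i.2+j+1) (fl (i.2+j+1) y) * (NN j i.2).indicator (fun _ => 1) y) (fun i => (hm _ _).const_mul _)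
      fun i => (hm _ _).mul (measurable_const.indicator (meas_NN _ _))).trans (add_le_add ?_ ?_)
    · rw [XN_const_mul hp0 (fun i => hm _ _)]
      refine mul_le_mul_right ?_ _
      refine XN_comp_inj hp0 (e := fun i : ι × ℤ => ((i.1, i.2 - j) : ι × ℤ)) ?_ (fun i x => c i.1 i.2 (fl i.2 x))
      rintro ⟨a, b⟩ ⟨a', b'⟩ h; simp at h; simp [h]
    · refine (H2 (ι × ℤ) inferInstance (fun i => i.2 + j + 1) (fun i => c i.1 (i.2+j+1)) (fun i => NN j i.2) (4 * (2⁻¹)^(j+1)) (fun i => meas_NN _ _)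
        (fun i m => vol_NN _ _ _) (mul_ne_top (by simp) (by simp))).trans ?_
      refine mul_le_mul_right ?_ _
      refine XN_comp_inj hp0 (e := fun i : ι × ℤ => ((i.1, i.2 + j + 1) : ι × ℤ)) ?_ (fun i x => c i.1 i.2 (fl i.2 x))
      rintro ⟨a, b⟩ ⟨a', b'⟩ h; simp at h; simp [h]
  have hma : ∀ (j : ℕ) (s : ℤ) (i : ι × ℤ), Measurable fun x => wd 3 s * av i.2 (fl i.2 x + n + s) (gK (c i.1) j i.2) := fun j s i =>
    hm i.2 (fun m => wd 3 s * av i.2 (m + n + s) (gK (c i.1) j i.2))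
  calc _ ≤ ∑' j : ℕ, ∑' s : ℤ, XN p volume (fun (i : ι × ℤ) x => wd 3 s * av i.2 (fl i.2 x + n + s) (gK (c i.1) j i.2)) := by
        refine (XN_tsum_le hp.le fun j i => (Measurable.ennreal_tsum fun s => hma j s i)).trans (ENNReal.tsum_le_tsum fun j => ?_)
        exact XN_tsum_le hp.le fun s i => hma j s i
    _ ≤ ∑' j : ℕ, ∑' s : ℤ, wd 3 s * (C1 * kap (n+s) * (((2⁻¹)^j + C2 * (4 * (2⁻¹)^(j+1)) ^ ε) * Q)) := by
        refine ENNReal.tsum_le_tsum fun j => ENNReal.tsum_le_tsum fun s => ?_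
        refine (XN_mono hp0 (G := fun i x => wd 3 s * Mx (n+s) (gK (c i.1) j i.2) x) fun i x => ?_).trans ?_
        · gcongr; rw [add_assoc]; exact av_le_Mx _ _ _ _
        · rw [XN_const_mul hp0 (fun i => meas_Mx _ _)]
          refine mul_le_mul_right ?_ _
          exact (H1 (ι × ℤ) inferInstance (n+s) _ (fun i => meas_gK _ _ _)).trans (mul_le_mul_right (hg j) _)
    _ = Z * (C1 * (∑' s : ℤ, wd 3 s * kap (n+s)) * Q) := by
        rw [hZ, ← ENNReal.tsum_mul_right]
        congr 1; ext j
        rw [← ENNReal.tsum_mul_left, ← ENNReal.tsum_mul_right, ← ENNReal.tsum_mul_left]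
        congr 1; ext s; ring
    _ ≤ Z * (C1 * (C3 * kap n) * Q) := by gcongr; exact H3 n
    _ = _ := by ring

lemma conv_aux {p M : ℝ} (hp : 1 < p) (hp2 : p ≤ 2) (hM : 0 < M) :
    ConvexOn ℝ (Set.Icc 0 M) (fun x => x^p - p*(p-1)/2 * M^(p-2) * x^2) ∧
    MonotoneOn (fun x => x^p - p*(p-1)/2 * M^(p-2) * x^2) (Set.Icc 0 M) := by
  set c := p*(p-1)/2 * M^(p-2) with hc
  have hcont : ContinuousOn (fun x : ℝ => x^p - c * x^2) (Set.Icc 0 M) := by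
    refine ContinuousOn.sub (fun x _ => (Real.continuousAt_rpow_const x p (Or.inr (by linarith))).continuousWithinAt) (by fun_prop)
  have hd : ∀ x ∈ Set.Ioo 0 M, HasDerivAt (fun x : ℝ => x^p - c * x^2) (p * x^(p-1) - c * (2 * x)) x := by
    intro x hx
    have h1 := Real.hasDerivAt_rpow_const (x := x) (p := p) (Or.inl hx.1.ne')
    have h2 := ((hasDerivAt_pow 2 x).const_mul c)
    have h3 := h1.sub h2
    simp only [Nat.cast_ofNat, Nat.add_one_sub_one, pow_one] at h3
    exact h3
  have hdiff : DifferentiableOn ℝ (fun x : ℝ => x^p - c * x^2) (interior (Set.Icc 0 M)) := by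
    rw [interior_Icc]; exact fun x hx => (hd x hx).differentiableAt.differentiableWithinAt
  have hpow : ∀ y ∈ Set.Ioo 0 M, M^(p-2) ≤ y^(p-2) := fun y hy =>
    Real.rpow_le_rpow_of_nonpos hy.1 hy.2.le (by linarith)
  constructor
  · refine MonotoneOn.convexOn_of_deriv (convex_Icc 0 M) hcont hdiff ?_
    rw [interior_Icc]
    intro x hx y hy hxy
    rw [(hd x hx).deriv, (hd y hy).deriv]
    have h1 : x^(p-1) ≤ y^(p-1) + (p-1) * y^(p-2) * (x - y) := by
      have hb := rpow_one_add_le_one_add_mul_self (s := x/y-1) (by have := div_pos hx.1 hy.1; linarith) (p := p-1) (by linarith) (by linarith)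
      rw [show 1 + (x/y-1) = x/y by ring, Real.div_rpow hx.1.le hy.1.le, div_le_iff₀ (Real.rpow_pos_of_pos hy.1 _)] at hb
      refine hb.trans (le_of_eq ?_)
      have : y^(p-1) = y^(p-2) * y := by rw [← Real.rpow_add_one hy.1.ne']; congr 1; ring
      have hy0 := hy.1.ne'
      rw [this]; field_simp
    have h2 := hpow y hy
    have h3 : 0 ≤ p*(p-1)*(y-x) := mul_nonneg (mul_nonneg (by linarith) (by linarith)) (by linarith)
    have h4 := mul_le_mul_of_nonneg_left h2 h3
    have h5 := mul_le_mul_of_nonneg_left h1 (by linarith : 0 ≤ p)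
    rw [hc]; nlinarith
  · refine monotoneOn_of_deriv_nonneg (convex_Icc 0 M) hcont hdiff ?_
    rw [interior_Icc]
    intro y hy
    rw [(hd y hy).deriv]
    have h2 := hpow y hy
    have : y^(p-1) = y^(p-2) * y := by rw [← Real.rpow_add_one hy.1.ne']; congr 1; ring
    rw [this, hc]
    have h6 : 0 ≤ M^(p-2) := by positivity
    have h7 : (p-1) * M^(p-2) ≤ y^(p-2) := by nlinarith
    have h8 := mul_le_mul_of_nonneg_left h7 (mul_nonneg (by linarith : 0 ≤ p) hy.1.le)
    nlinarith

lemma two_point {E : Type*} [NormedAddCommGroup E] [InnerProductSpace ℝ E] {p : ℝ} (hp : 1 < p) (hp2 : p ≤ 2) (a d : E) :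
    ‖a‖^p + p*(p-1)/2 * (‖d‖^2 * (‖a‖+‖d‖)^(p-2)) ≤ (‖a+d‖^p + ‖a-d‖^p)/2 := by
  rcases eq_or_ne d 0 with rfl | hd
  · simp
  have hM : 0 < ‖a‖+‖d‖ := by positivity
  obtain ⟨h1, h2⟩ := conv_aux hp hp2 hM
  have hu : ‖a+d‖ ∈ Set.Icc 0 (‖a‖+‖d‖) := ⟨by positivity, norm_add_le _ _⟩
  have hv : ‖a-d‖ ∈ Set.Icc 0 (‖a‖+‖d‖) := ⟨by positivity, norm_sub_le _ _⟩
  have ha : ‖a‖ ≤ (1/2:ℝ) * ‖a+d‖ + (1/2) * ‖a-d‖ := by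
    have : ‖(a+d)+(a-d)‖ ≤ ‖a+d‖+‖a-d‖ := norm_add_le _ _
    rw [show (a+d)+(a-d) = (2:ℝ)•a by rw [two_smul]; abel, norm_smul] at this
    norm_num at this; linarith
  have h3 := h1.2 hu hv (by norm_num : (0:ℝ) ≤ 1/2) (by norm_num : (0:ℝ) ≤ 1/2) (by norm_num)
  have h4 := h2 (a := ‖a‖) ⟨by positivity, by linarith [norm_nonneg d]⟩ (h1.1 hu hv (by norm_num : (0:ℝ) ≤ 1/2) (by norm_num : (0:ℝ) ≤ 1/2) (by norm_num)) (by simpa using ha)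
  have h5 := h4.trans h3
  simp only [smul_eq_mul] at h5
  have h6 := parallelogram_law_with_norm ℝ a d
  set c := p*(p-1)/2 * (‖a‖+‖d‖)^(p-2)
  have : p*(p-1)/2 * (‖d‖^2 * (‖a‖+‖d‖)^(p-2)) = c * ‖d‖^2 := by ring
  rw [this]
  have h7 : c * (‖a+d‖^2+‖a-d‖^2) = c * (2 * (‖a‖^2+‖d‖^2)) := by rw [h6]
  nlinarith

section AD
variable {E : Type*} [NormedAddCommGroup E] [NormedSpace ℝ E]

noncomputable def AA (k m : ℤ) (f : ℝ → E) : E := (2:ℝ)^(-k) • ∫ x in Dy k m, f x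
noncomputable def dd (k m : ℤ) (f : ℝ → E) : E := (1/2:ℝ) • (AA (k-1) (2*m+1) f - AA (k-1) (2*m) f)

lemma fl_half (k : ℤ) (x : ℝ) : fl k x = fl (k-1) x / 2 := by
  have := fl_add (k-1) 1 x
  simpa using this

lemma Dy_split (k m : ℤ) : Dy k m = Dy (k-1) (2*m) ∪ Dy (k-1) (2*m+1) := by
  ext x; simp only [Dy, Set.mem_setOf_eq, Set.mem_union, fl_half k x]; omega

lemma Dy_disj (k : ℤ) {m m' : ℤ} (h : m ≠ m') : Disjoint (Dy k m) (Dy k m') :=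
  Set.disjoint_left.mpr fun x (hx : fl k x = m) (hx' : fl k x = m') => h (hx ▸ hx')

lemma AA_split {k m : ℤ} {f : ℝ → E} (hf : Integrable f) : AA (k-1) (2*m+1) f = AA k m f + dd k m f ∧ AA (k-1) (2*m) f = AA k m f - dd k m f := by
  have h : AA k m f = (1/2:ℝ) • (AA (k-1) (2*m) f + AA (k-1) (2*m+1) f) := by
    unfold AA
    rw [Dy_split, setIntegral_union (Dy_disj _ (by omega)) (meas_Dy _ _) hf.integrableOn hf.integrableOn, ← smul_add, smul_smul]
    congr 1
    rw [show -k = -(k-1) - 1 by ring, zpow_sub₀ (by norm_num)]; norm_num; ring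
  rw [h, dd]
  constructor
  · rw [← smul_add, show (AA (k-1) (2*m) f + AA (k-1) (2*m+1) f + (AA (k-1) (2*m+1) f - AA (k-1) (2*m) f)) = (2:ℝ) • AA (k-1) (2*m+1) f by rw [two_smul]; abel, smul_smul]; norm_num
  · rw [← smul_sub, show (AA (k-1) (2*m) f + AA (k-1) (2*m+1) f - (AA (k-1) (2*m+1) f - AA (k-1) (2*m) f)) = (2:ℝ) • AA (k-1) (2*m) f by rw [two_smul]; abel, smul_smul]; norm_num

lemma AA_le (k m : ℤ) (f : ℝ → E) : ‖AA k m f‖ₑ ≤ av k m (fun x => ‖f x‖ₑ) := by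
  unfold AA av
  rw [enorm_smul]
  have : ‖(2:ℝ)^(-k)‖ₑ = (2:EN)^(-k) := by
    rw [Real.enorm_eq_ofReal (by positivity), ofReal_two_zpow]
  rw [this]
  exact mul_le_mul_right (enorm_integral_le_lintegral_enorm _) _

lemma av_split (k m : ℤ) (g : ℝ → EN) : av k m g = 2⁻¹ * (av (k-1) (2*m) g + av (k-1) (2*m+1) g) := by
  unfold av
  rw [Dy_split, lintegral_union (meas_Dy _ _) (Dy_disj _ (by omega)), ← mul_add, ← mul_assoc]
  congr 1
  rw [show -k = -1 + -(k-1) by ring, zp_add, zpow_neg_one]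

lemma dd_le (k m : ℤ) (f : ℝ → E) : ‖dd k m f‖ₑ ≤ av k m (fun x => ‖f x‖ₑ) := by
  rw [av_split, dd, enorm_smul]
  have : ‖(1/2:ℝ)‖ₑ = 2⁻¹ := by
    rw [Real.enorm_eq_ofReal (by norm_num), one_div, ofReal_inv_of_pos (by norm_num)]; simp
  rw [this]
  refine mul_le_mul_right (enorm_sub_le.trans ?_) _
  rw [add_comm]
  exact add_le_add (AA_le _ _ _) (AA_le _ _ _)
end AD

lemma lint_cell (k : ℤ) (c : ℤ → EN) : ∫⁻ x, c (fl k x) = ∑' m, 2^k * c m := by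
  have := lint_cell_av k c (measurable_const (a := (1:EN)))
  simpa [av_const] using this

lemma lint_cell_half (k : ℤ) (c : ℤ → EN) : ∫⁻ x, c (fl (k-1) x) = ∑' m, 2^k * (2⁻¹ * (c (2*m) + c (2*m+1))) := by
  rw [lint_cells k]
  congr 1; ext m
  rw [lint_Dy, av_split]
  have h : ∀ m', av (k-1) m' (fun x => c (fl (k-1) x)) = c m' := by
    intro m'
    rw [← av_const (k-1) m' (c m')]; unfold av; congr 1
    exact setLIntegral_congr_fun (meas_Dy _ _) fun x hx => by simp only [show fl (k-1) x = m' from hx]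
  rw [h, h]

/-- telescoping -/
lemma tele {E : Type*} [NormedAddCommGroup E] [InnerProductSpace ℝ E] {p : ℝ} (hp : 1 < p) (hp2 : p ≤ 2) {f : ℝ → E} (hf : Integrable f)
    (hfm : Measurable fun x => ‖f x‖ₑ) :
    ∑' k, ∫⁻ x, oR (p*(p-1)/2 * (‖dd k (fl k x) f‖^2 * (‖AA k (fl k x) f‖ + ‖dd k (fl k x) f‖)^(p-2))) ≤ ∫⁻ x, ‖f x‖ₑ ^ p := by
  set Y : ℤ → ℤ → EN := fun k m => oR (p*(p-1)/2 * (‖dd k m f‖^2 * (‖AA k m f‖ + ‖dd k m f‖)^(p-2))) with hY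
  set e : ℤ → EN := fun k => ∫⁻ x, ‖AA k (fl k x) f‖ₑ ^ p with he
  have hp0 : 0 < p := by linarith
  have hnorm : ∀ v : E, ‖v‖ₑ ^ p = oR (‖v‖^p) := fun v => by
    rw [← ofReal_norm, ofReal_rpow_of_nonneg (norm_nonneg _) hp0.le]
  have step : ∀ k, e k + ∫⁻ x, Y k (fl k x) ≤ e (k-1) := by
    intro k
    simp only [he]
    rw [lint_cell k (fun m => ‖AA k m f‖ₑ ^ p), lint_cell k (Y k), lint_cell_half k (fun m => ‖AA (k-1) m f‖ₑ ^ p), ← ENNReal.tsum_add]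
    refine ENNReal.tsum_le_tsum fun m => ?_
    rw [← mul_add]
    refine mul_le_mul_right ?_ _
    obtain ⟨h1, h2⟩ := AA_split (k := k) (m := m) hf
    rw [h1, h2]
    have h3 := two_point hp hp2 (AA k m f) (dd k m f)
    simp only [hnorm, hY]
    have hn : 0 ≤ p*(p-1)/2 * (‖dd k m f‖^2 * (‖AA k m f‖ + ‖dd k m f‖)^(p-2)) := by
      have : 0 ≤ p*(p-1)/2 := by nlinarith
      positivity
    rw [← ofReal_add (by positivity) hn, ← ofReal_add (by positivity) (by positivity),
      show (2:EN)⁻¹ = oR (1/2) by rw [one_div, ofReal_inv_of_pos (by norm_num)]; simp, ← ofReal_mul (by norm_num)]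
    refine ofReal_le_ofReal ?_
    linarith
  have ub : ∀ k, e k ≤ ∫⁻ x, ‖f x‖ₑ ^ p := by
    intro k
    simp only [he]
    rw [lint_cell k (fun m => ‖AA k m f‖ₑ ^ p), lint_cells k]
    refine ENNReal.tsum_le_tsum fun m => ?_
    rw [lint_Dy]
    refine mul_le_mul_right ?_ _
    have hc := Real.HolderConjugate.conjExponent hp
    have h1 := av_holder (k := k) (m := m) hc hfm (measurable_const (a := (1:EN)))
    simp only [mul_one, one_rpow, av_const] at h1
    calc _ ≤ ((av k m fun x => ‖f x‖ₑ ^ p) ^ (1/p)) ^ p := by gcongr; exact (AA_le k m f).trans h1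
      _ = _ := by rw [← rpow_mul, one_div_mul_cancel hp0.ne', rpow_one]
  have ind : ∀ (K : ℤ) (n : ℕ), e (K + n) + ∑ i ∈ Finset.range n, ∫⁻ x, Y (K+i+1) (fl (K+i+1) x) ≤ e K := by
    intro K n
    induction n with
    | zero => simp
    | succ n ih =>
      rw [Finset.sum_range_succ]
      have := step (K+n+1)
      rw [add_sub_cancel_right] at this
      push_cast
      rw [← add_assoc K]
      calc _ = (e (K+n+1) + ∫⁻ x, Y (K+n+1) (fl (K+n+1) x)) + ∑ i ∈ Finset.range n, ∫⁻ x, Y (K+i+1) (fl (K+i+1) x) := by ring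
        _ ≤ _ := (add_le_add_left this _).trans ih
  refine ENNReal.summable.tsum_le_of_sum_le fun S => ?_
  obtain ⟨K, hK⟩ := S.bddBelow
  obtain ⟨L, hL⟩ := S.bddAbove
  set n := (L - K + 1).toNat with hn
  have h1 : S ⊆ (Finset.range n).map ⟨fun i : ℕ => (K - 1) + (i:ℤ) + 1, fun a b h => by simpa using h⟩ := by
    intro k hk
    have h2 : K ≤ k := hK hk
    have h3 : k ≤ L := hL hk
    simp only [Finset.mem_map, Finset.mem_range, Function.Embedding.coeFn_mk]
    exact ⟨(k - K).toNat, by omega, by show (K - 1) + (((k-K).toNat : ℕ) : ℤ) + 1 = k; omega⟩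
  refine (Finset.sum_le_sum_of_subset h1).trans ?_
  rw [Finset.sum_map]
  exact (le_add_self.trans (ind (K-1) n)).trans (ub _)

lemma bessel {E : Type*} [NormedAddCommGroup E] [InnerProductSpace ℝ E] {f : ℝ → E} (hf : Integrable f)
    (hfm : Measurable fun x => ‖f x‖ₑ) :
    ∑' k, ∫⁻ x, ‖dd k (fl k x) f‖ₑ ^ (2:ℝ) ≤ ∫⁻ x, ‖f x‖ₑ ^ (2:ℝ) := by
  have h := tele (p := 2) (by norm_num) le_rfl hf hfm
  refine le_trans (le_of_eq ?_) h
  congr 1; ext k; congr 1; ext x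
  rw [← ofReal_norm, ofReal_rpow_of_nonneg (norm_nonneg _) (by norm_num)]
  congr 1; norm_num

def VEp (p : ℝ) : Prop := ∃ C : EN, C ≠ ⊤ ∧ ∀ (E : Type) [NormedAddCommGroup E] [InnerProductSpace ℝ E] (f : ℝ → E),
    Integrable f → Measurable (fun x => ‖f x‖ₑ) →
    XN p volume (fun (k:ℤ) x => ‖dd k (fl k x) f‖ₑ) ≤ C * Nm p volume (fun x => ‖f x‖ₑ)

lemma VE_two : VEp 2 := by
  refine ⟨1, by simp, fun E _ _ f hf hfm => ?_⟩
  refine (Nm_le_iff (by norm_num)).mpr ?_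
  rw [one_rpow, one_mul]
  refine le_trans (le_of_eq ?_) (bessel hf hfm)
  have := lint_l2_sq (μ := volume) (F := fun (k:ℤ) x => ‖dd k (fl k x) f‖ₑ) (fun k => meas_cell k (fun m => ‖dd k m f‖ₑ)) (measurable_const (a := (1:EN)))
  simpa using this

lemma VE_lt {p : ℝ} (hp : 1 < p) (hp2 : p < 2) : VEp p := by
  have hp0 : 0 < p := by linarith
  have h2p : 0 < 2 - p := by linarith
  set c := p*(p-1)/2 with hc
  have hc0 : 0 < c := by rw [hc]; have : 0 < p - 1 := by linarith
                         positivity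
  have hcE : oR c ≠ 0 := by simpa using hc0
  obtain ⟨C1, hC1, H1⟩ := strongM hp
  set D := ((oR c)⁻¹ ^ (p/2) * ((2:EN)^p * (C1 * kap 0)) ^ (1-p/2)) with hD
  have hDt : D ≠ ⊤ := mul_ne_top (rpow_ne_top_of_nonneg (by positivity) (by simpa using hc0))
    (rpow_ne_top_of_nonneg (by linarith) (mul_ne_top (rpow_ne_top_of_nonneg hp0.le (by simp)) (mul_ne_top hC1 (kap_netop 0))))
  refine ⟨D ^ (1/p), rpow_ne_top_of_nonneg (by positivity) hDt, fun E _ _ f hf hfm => ?_⟩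
  set I := ∫⁻ x, ‖f x‖ₑ ^ p with hI
  refine (Nm_le_iff hp0).mpr ?_
  set Y : ℤ → ℤ → EN := fun k m => oR (c * (‖dd k m f‖^2 * (‖AA k m f‖ + ‖dd k m f‖)^(p-2))) with hY
  have ht := tele hp hp2.le hf hfm
  set B : ℝ → EN := fun x => (2 * Mx 0 (fun x => ‖f x‖ₑ) x) ^ (2-p) with hB
  have hYm : ∀ k, Measurable fun x => Y k (fl k x) := fun k => meas_cell k _
  refine (holder_lt hp0 hp2 (X := fun x => (oR c)⁻¹ * ∑' k, Y k (fl k x)) (B := B)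
    ((Measurable.ennreal_tsum hYm).const_mul _).aemeasurable (by fun_prop) (ae_of_all _ fun x => ?_)).trans ?_
  · rw [l2_sq, ← ENNReal.tsum_mul_left, ← ENNReal.tsum_mul_right]
    refine ENNReal.tsum_le_tsum fun k => ?_
    rcases eq_or_ne (dd k (fl k x) f) 0 with h0 | h0
    · simp [h0]
    set a := AA k (fl k x) f with ha
    set d := dd k (fl k x) f with hd
    have hM : 0 < ‖a‖+‖d‖ := by positivity
    have h1 : oR (‖a‖+‖d‖) ≤ 2 * Mx 0 (fun x => ‖f x‖ₑ) x := by
      rw [ofReal_add (norm_nonneg _) (norm_nonneg _), ofReal_norm, ofReal_norm, two_mul]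
      have h3 := av_le_Mx k 0 (fun x => ‖f x‖ₑ) x
      rw [add_zero] at h3
      exact add_le_add ((AA_le _ _ _).trans h3) ((dd_le _ _ _).trans h3)
    have h2 : ‖d‖^2 = (‖d‖^2 * (‖a‖+‖d‖)^(p-2)) * (‖a‖+‖d‖)^(2-p) := by
      rw [mul_assoc, ← Real.rpow_add hM]; simp
    calc ‖d‖ₑ ^ (2:ℝ) = oR (‖d‖^2) := by
          rw [← ofReal_norm, ofReal_rpow_of_nonneg (norm_nonneg _) (by norm_num)]; norm_num
      _ = oR (‖d‖^2 * (‖a‖+‖d‖)^(p-2)) * (oR (‖a‖+‖d‖)) ^ (2-p) := by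
          rw [ofReal_rpow_of_pos hM, ← ofReal_mul (by positivity), ← h2]
      _ ≤ (oR c)⁻¹ * Y k (fl k x) * B x := by
          simp only [hY, hB, ofReal_mul hc0.le]
          rw [← mul_assoc (oR c)⁻¹, ENNReal.inv_mul_cancel hcE (by simp), one_mul]
          gcongr
  · have hX : ∫⁻ x, (oR c)⁻¹ * ∑' k, Y k (fl k x) ≤ (oR c)⁻¹ * I := by
      rw [lintegral_const_mul _ (Measurable.ennreal_tsum hYm), lintegral_tsum fun k => (hYm k).aemeasurable]
      gcongr
    have hBI : ∫⁻ x, B x ^ (p/(2-p)) ≤ (2:EN)^p * (C1 * kap 0) * I := by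
      have e : ∀ x, B x ^ (p/(2-p)) = 2^p * (Mx 0 (fun x => ‖f x‖ₑ) x) ^ p := by
        intro x; simp only [hB]; rw [← rpow_mul, show (2-p)*(p/(2-p)) = p by field_simp, mul_rpow_of_nonneg _ _ hp0.le]
      simp_rw [e]
      rw [lintegral_const_mul _ (by fun_prop), mul_assoc]
      gcongr
      exact H1 0 _ hfm
    calc _ ≤ ((oR c)⁻¹ * I) ^ (p/2) * ((2:EN)^p * (C1 * kap 0) * I) ^ (1-p/2) := by
          gcongr
          linarith
      _ = D * (I ^ (p/2) * I ^ (1-p/2)) := by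
          rw [mul_rpow_of_nonneg _ _ (by positivity), mul_rpow_of_nonneg _ I (by linarith), hD]; ring
      _ = D * I := by rw [← rpow_add_of_nonneg _ _ (by positivity) (by linarith)]; simp
      _ = (D ^ (1/p)) ^ p * I := by rw [← rpow_mul, one_div_mul_cancel hp0.ne', rpow_one]

lemma dd_ind {E : Type*} [NormedAddCommGroup E] [NormedSpace ℝ E] {k m : ℤ} {f : ℝ → E} {U : Set ℝ} (hU : MeasurableSet U) (h : Dy k m ⊆ U) :
    dd k m (U.indicator f) = dd k m f := by
  have h1 : ∀ m', Dy (k-1) m' ⊆ U → AA (k-1) m' (U.indicator f) = AA (k-1) m' f := by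
    intro m' h'
    unfold AA; congr 1
    exact setIntegral_congr_fun (meas_Dy _ _) fun x hx => Set.indicator_of_mem (h' hx) f
  rw [Dy_split] at h
  unfold dd
  rw [h1 _ (Set.subset_union_left.trans h), h1 _ (Set.subset_union_right.trans h)]

lemma VW : ∃ C : EN, C ≠ ⊤ ∧ ∀ (E : Type) [NormedAddCommGroup E] [InnerProductSpace ℝ E] (f : ℝ → E) (h : ℝ → EN),
    Integrable f → Measurable (fun x => ‖f x‖ₑ) → Measurable h →
    ∑' k, ∫⁻ x, ‖dd k (fl k x) f‖ₑ ^ (2:ℝ) * h x ≤ C * ∫⁻ x, ‖f x‖ₑ ^ (2:ℝ) * Mx 0 h x := by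
  refine ⟨2 * ∑' n : ℕ, ((2:EN)^(-1:ℝ)) ^ n, mul_ne_top (by simp) (geo_a one_pos), fun E _ _ f h hf hfm hh => ?_⟩
  set U : ℤ → Set ℝ := fun j => {x | 2^j < Mx 0 h x} with hU
  have hUm : ∀ j, MeasurableSet (U j) := fun j => measurableSet_lt measurable_const (meas_Mx _ _)
  have hsub : ∀ j k m, (2:EN)^j < av k m h → Dy k m ⊆ U j := by
    intro j k m hl x hx
    have := av_le_Mx k 0 h x
    rw [add_zero, show fl k x = m from hx] at this
    exact hl.trans_le this
  calc _ = ∑' k, ∑' m, 2^k * (‖dd k m f‖ₑ ^ (2:ℝ) * av k m h) := by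
        congr 1; ext k; exact lint_cell_av k (fun m => ‖dd k m f‖ₑ ^ (2:ℝ)) hh
    _ ≤ ∑' k, ∑' m, ∑' j : ℤ, 2^(j+1) * (2^k * ‖dd k m ((U j).indicator f)‖ₑ ^ (2:ℝ)) := by
        refine ENNReal.tsum_le_tsum fun k => ENNReal.tsum_le_tsum fun m => ?_
        have hl := le_layers one_pos (av k m h)
        rw [rpow_one] at hl
        rw [← mul_assoc]
        refine (mul_le_mul_right hl _).trans ?_
        rw [← ENNReal.tsum_mul_left]
        refine ENNReal.tsum_le_tsum fun j => ?_
        split_ifs with hj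
        · rw [dd_ind (hUm j) (hsub j k m hj), rpow_one, mul_comm]
        · simp
    _ = ∑' j : ℤ, 2^(j+1) * ∑' k, ∑' m, 2^k * ‖dd k m ((U j).indicator f)‖ₑ ^ (2:ℝ) := by
        simp_rw [← ENNReal.tsum_mul_left]
        rw [ENNReal.tsum_comm]
        rw [← ENNReal.tsum_comm]
        conv_lhs => enter [1, k]; rw [ENNReal.tsum_comm]
        rw [ENNReal.tsum_comm]
    _ ≤ ∑' j : ℤ, 2^(j+1) * ∫⁻ x, (U j).indicator (fun _ => 1) x * ‖f x‖ₑ ^ (2:ℝ) := by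
        refine ENNReal.tsum_le_tsum fun j => mul_le_mul_right ?_ _
        have hm' : (fun x => ‖(U j).indicator f x‖ₑ) = (U j).indicator (fun x => ‖f x‖ₑ) := by
          ext x; by_cases hx : x ∈ U j <;> simp [hx]
        have hb := bessel (hf.indicator (hUm j)) (by rw [hm']; exact hfm.indicator (hUm j))
        calc _ = ∑' k, ∫⁻ x, ‖dd k (fl k x) ((U j).indicator f)‖ₑ ^ (2:ℝ) := by
              congr 1; ext k; exact (lint_cell k (fun m => ‖dd k m ((U j).indicator f)‖ₑ ^ (2:ℝ))).symm
          _ ≤ _ := hb.trans (lintegral_mono fun x => by by_cases hx : x ∈ U j <;> simp [hx])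
    _ = ∫⁻ x, ∑' j : ℤ, 2^(j+1) * ((U j).indicator (fun _ => 1) x * ‖f x‖ₑ ^ (2:ℝ)) := by
        have hms : ∀ j, Measurable fun x => (U j).indicator (fun _ => (1:EN)) x * ‖f x‖ₑ ^ (2:ℝ) := fun j =>
          (measurable_const.indicator (hUm j)).mul (hfm.pow_const _)
        rw [lintegral_tsum fun j => ((hms j).const_mul _).aemeasurable]
        congr 1; ext j; rw [lintegral_const_mul _ (hms j)]
    _ ≤ ∫⁻ x, (2 * ∑' n : ℕ, ((2:EN)^(-1:ℝ)) ^ n) * (‖f x‖ₑ ^ (2:ℝ) * Mx 0 h x) := by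
        refine lintegral_mono fun x => ?_
        have hg := geo_lt one_pos (Mx 0 h x)
        simp only [rpow_one] at hg
        calc _ = 2 * (∑' j : ℤ, if (2:EN)^j < Mx 0 h x then (2:EN)^j else 0) * ‖f x‖ₑ ^ (2:ℝ) := by
              rw [← ENNReal.tsum_mul_left, ← ENNReal.tsum_mul_right]
              congr 1; ext j
              by_cases hx : (2:EN)^j < Mx 0 h x
              · rw [Set.indicator_of_mem (show x ∈ U j from hx), if_pos hx, one_mul, zp_add, zpow_one]; ring
              · rw [Set.indicator_of_notMem (show x ∉ U j from hx), if_neg hx]; simp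
          _ ≤ 2 * ((∑' n : ℕ, ((2:EN)^(-1:ℝ)) ^ n) * Mx 0 h x) * ‖f x‖ₑ ^ (2:ℝ) := by gcongr
          _ = _ := by ring
    _ = _ := lintegral_const_mul _ (by fun_prop)

lemma VE_gt {p : ℝ} (hp : 2 < p) : VEp p := by
  have hp0 : 0 < p := by linarith
  have hr : 1 < p/(p-2) := by rw [lt_div_iff₀ (by linarith)]; linarith
  obtain ⟨C1, hC1, H1⟩ := VW
  obtain ⟨C2, hC2, _, H2⟩ := NmM hr
  obtain ⟨C3, hC3, _, H3⟩ := NmM (q := p) (by linarith)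
  have hCk : C1 * (C2 * kap 0) ≠ ⊤ := mul_ne_top hC1 (mul_ne_top hC2 (kap_netop 0))
  refine ⟨(C1 * (C2 * kap 0))^(1/2:ℝ) + 1, ENNReal.add_ne_top.mpr ⟨rpow_ne_top_of_nonneg (by norm_num) hCk, by simp⟩, ?_⟩
  intro E _ _ f hf hfm
  have hdm : ∀ k, Measurable fun x => ‖dd k (fl k x) f‖ₑ := fun k => meas_cell k (fun m => ‖dd k m f‖ₑ)
  rw [XN_iSup hp0 hdm]
  refine iSup_le fun S => ?_
  by_cases htop : Nm p volume (fun x => ‖f x‖ₑ) = ⊤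
  · rw [htop, mul_top (by simp)]; exact le_top
  set F : ℝ → EN := fun x => l2 (fun k : S => ‖dd k (fl k x) f‖ₑ) with hF
  have hFm : Measurable F := meas_l2 fun i => hdm _
  have hfin : ∫⁻ x, F x ^ p ≠ ⊤ := by
    rw [← Nm_top_iff hp0]
    refine XN_fin_top (by linarith) (fun k : S => hdm k) fun k => ?_
    refine ne_top_of_le_ne_top ?_ (Nm_mono (G := Mx 0 fun x => ‖f x‖ₑ) hp0 fun x => ?_)
    · exact ne_top_of_le_ne_top (mul_ne_top (mul_ne_top hC3 (kap_netop 0)) htop) (H3 0 _ hfm)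
    · have h3 := av_le_Mx k 0 (fun x => ‖f x‖ₑ) x
      rw [add_zero] at h3
      exact (dd_le _ _ _).trans h3
  have hhm : Measurable (fun x => F x ^ (p-2)) := hFm.pow_const _
  have e1 : ∀ x, F x ^ p = F x ^ (2:ℝ) * F x ^ (p-2) := by
    intro x; rw [← rpow_add_of_nonneg _ _ (by norm_num) (by linarith)]; congr 1; ring
  refine (Nm_le_iff hp0).mpr ?_
  have key := duality_gt (A := C1 * (C2 * kap 0)) hp hfm.aemeasurable (T := fun x => C1 * Mx 0 (fun x => F x ^ (p-2)) x)
    ((meas_Mx _ _).const_mul _).aemeasurable hfin ?_ ?_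
  · refine key.trans ?_
    gcongr
    calc _ = ((C1 * (C2 * kap 0))^(1/2:ℝ)) ^ p := by
          rw [← rpow_mul]; congr 1; ring
      _ ≤ _ := by gcongr; exact le_self_add
  · simp_rw [e1]
    rw [lint_l2_sq (fun k : S => hdm k) hhm]
    have h2 : ∑' k : S, ∫⁻ x, ‖dd k (fl k x) f‖ₑ ^ (2:ℝ) * F x ^ (p-2) ≤ ∑' k : ℤ, ∫⁻ x, ‖dd k (fl k x) f‖ₑ ^ (2:ℝ) * F x ^ (p-2) :=
      tsum_comp_le_tsum_of_injective Subtype.val_injective (fun k : ℤ => ∫⁻ x, ‖dd k (fl k x) f‖ₑ ^ (2:ℝ) * F x ^ (p-2))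
    refine (h2.trans (H1 E f _ hf hfm hhm)).trans (le_of_eq ?_)
    rw [← lintegral_const_mul _ (by fun_prop)]
    congr 1; ext x; ring
  · have h3 := H2 0 _ hhm
    have h4 : Nm (p/(p-2)) volume (fun x => C1 * Mx 0 (fun x => F x ^ (p-2)) x) ≤ C1 * (C2 * kap 0) * Nm (p/(p-2)) volume (fun x => F x ^ (p-2)) := by
      rw [Nm_const_mul (by linarith) (meas_Mx _ _).aemeasurable, mul_assoc C1]
      gcongr
    rw [Nm_le_iff (by linarith)] at h4
    refine h4.trans (le_of_eq ?_)
    congr 2; ext x; rw [← rpow_mul]; congr 1; have : p - 2 ≠ 0 := by linarith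
    field_simp

lemma VE {p : ℝ} (hp : 1 < p) : VEp p := by
  rcases lt_trichotomy p 2 with h | rfl | h
  · exact VE_lt hp h
  · exact VE_two
  · exact VE_gt h

lemma enorm_toLp {ι : Type*} [Fintype ι] (v : PiLp 2 (fun _ : ι => ℂ)) : ‖v‖ₑ = l2 (fun i => ‖v i‖ₑ) := by
  unfold l2
  rw [tsum_fintype, ← ofReal_norm, PiLp.norm_eq_of_L2, Real.sqrt_eq_rpow, ← ofReal_rpow_of_nonneg (by positivity) (by norm_num),
    ofReal_sum_of_nonneg (fun i _ => by positivity)]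
  congr 2; ext i
  beta_reduce
  rw [← ofReal_norm, ofReal_rpow_of_nonneg (norm_nonneg _) (by norm_num)]; norm_num

theorem VV {p : ℝ} (hp : 1 < p) : ∃ C : EN, C ≠ ⊤ ∧ ∀ (ι : Type) (_ : Countable ι) (f : ι → ℝ → ℂ), (∀ i, Integrable (f i)) →
    (∀ i, Measurable (f i)) →
    XN p volume (fun (i : ι × ℤ) x => ‖dd i.2 (fl i.2 x) (f i.1)‖ₑ) ≤ C * XN p volume (fun i x => ‖f i x‖ₑ) := by
  classical
  obtain ⟨C, hC, H⟩ := VE hp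
  have hp0 : 0 < p := by linarith
  refine ⟨C, hC, fun ι _ f hf hfm => ?_⟩
  have hdm : ∀ i : ι × ℤ, Measurable fun x => ‖dd i.2 (fl i.2 x) (f i.1)‖ₑ := fun i => meas_cell i.2 (fun m => ‖dd i.2 m (f i.1)‖ₑ)
  rw [XN_iSup hp0 hdm]
  refine iSup_le fun T => ?_
  set S := T.image Prod.fst with hS
  have hTS : ∀ t : T, t.1.1 ∈ S := fun t => Finset.mem_image_of_mem _ t.2
  set G : ℝ → PiLp 2 (fun _ : S => ℂ) := fun x => WithLp.toLp 2 (fun i : S => f i x) with hG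
  have hGn : ∀ x, ‖G x‖ₑ = l2 (fun i : S => ‖f i x‖ₑ) := fun x => enorm_toLp _
  have hGi : Integrable G := by
    have h1 : Integrable (fun x => (fun i : S => f i x)) := Integrable.of_eval fun i => hf i
    exact (PiLp.continuousLinearEquiv 2 ℝ (fun _ : S => ℂ)).symm.toContinuousLinearMap.integrable_comp h1
  have hAA : ∀ k m (i : S), (AA k m G) i = AA k m (f i) := by
    intro k m i
    unfold AA
    have := (PiLp.proj (𝕜 := ℝ) 2 (fun _ : S => ℂ) i).integral_comp_comm (μ := volume.restrict (Dy k m)) hGi.integrableOn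
    rw [PiLp.smul_apply]; congr 1
    exact this.symm
  have hdd : ∀ k m, ‖dd k m G‖ₑ = l2 (fun i : S => ‖dd k m (f i)‖ₑ) := by
    intro k m
    rw [enorm_toLp]; congr 1; ext i
    congr 1
    show _ = (1/2:ℝ) • (AA (k-1) (2*m+1) (f i) - AA (k-1) (2*m) (f i))
    rw [← hAA, ← hAA]; rfl
  have hGm : Measurable fun x => ‖G x‖ₑ := by
    simp_rw [hGn]; exact meas_l2 fun i => (hfm _).enorm
  have key := H _ G hGi hGm
  calc XN p volume (fun (i : T) x => ‖dd i.1.2 (fl i.1.2 x) (f i.1.1)‖ₑ)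
      ≤ XN p volume (fun (i : S × ℤ) x => ‖dd i.2 (fl i.2 x) (f i.1)‖ₑ) := by
        refine XN_comp_inj hp0 (e := fun t : T => ((⟨t.1.1, hTS t⟩, t.1.2) : S × ℤ)) ?_ (fun (i : S × ℤ) x => ‖dd i.2 (fl i.2 x) (f i.1)‖ₑ)
        rintro ⟨⟨a, b⟩, _⟩ ⟨⟨a', b'⟩, _⟩ h; simpa using h
    _ = XN p volume (fun (k:ℤ) x => ‖dd k (fl k x) G‖ₑ) := by
        unfold XN; congr 1; ext x
        simp_rw [hdd]
        unfold l2
        congr 1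
        beta_reduce
        rw [ENNReal.tsum_prod (f := fun (i : S) (k : ℤ) => ‖dd k (fl k x) (f i)‖ₑ ^ (2:ℝ)), ENNReal.tsum_comm]
        congr 1; ext k
        rw [← rpow_mul]; norm_num
    _ ≤ _ := key
    _ ≤ _ := by
        gcongr
        simp_rw [hGn]
        exact XN_comp_inj hp0 (e := fun i : S => (i : ι)) Subtype.val_injective (fun i x => ‖f i x‖ₑ)

structure Ad (D : EN) (k q : ℤ) (φ : ℝ → ℂ) : Prop where
  meas : Measurable φ
  bd : ∀ x, ‖φ x‖ₑ ≤ D * wd 5 (fl k x - q)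
  lip : ∀ (j : ℕ) (x y : ℝ), fl (k-j) x = fl (k-j) y → ‖φ x - φ y‖ₑ ≤ D * wd 5 (fl k x - q) * (2⁻¹)^j

lemma shift_sum (q : ℤ) (F : ℤ → EN) : ∑' m, F m = ∑' s, F (q + s) := ((Equiv.addLeft q).tsum_eq F).symm

lemma lint_wd (a : ℕ) (k q : ℤ) {g : ℝ → EN} (hg : Measurable g) :
    ∫⁻ x, wd a (fl k x - q) * g x = 2^k * ∑' s, wd a s * av k (q+s) g := by
  rw [lint_cell_av k (fun m => wd a (m - q)) hg, ENNReal.tsum_mul_left, shift_sum q]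
  simp

lemma TAIL {D : EN} {k q : ℤ} {φ : ℝ → ℂ} (h : Ad D k q φ) {g : ℝ → EN} (hg : Measurable g) :
    ∫⁻ x, g x * ‖φ x‖ₑ ≤ D * 2^k * ∑' s, wd 3 s * av k (q+s) g := by
  rw [mul_assoc, ← lint_wd 3 k q hg, ← lintegral_const_mul (f := fun x => wd 3 (fl k x - q) * g x) _ ((meas_cell k (fun m => wd 3 (m - q))).mul hg)]
  refine lintegral_mono fun x => ?_
  calc g x * ‖φ x‖ₑ ≤ g x * (D * wd 3 (fl k x - q)) := by
        gcongr; exact (h.bd x).trans (mul_le_mul_right (wd_mono (by norm_num) _) _)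
    _ = _ := by ring

lemma Ad.lint {D : EN} {k q : ℤ} {φ : ℝ → ℂ} (h : Ad D k q φ) (hD : D ≠ ⊤) : ∫⁻ x, ‖φ x‖ₑ ≠ ⊤ := by
  have := TAIL h (measurable_const (a := (1:EN)))
  simp only [one_mul, av_const, mul_one] at this
  refine ne_top_of_le_ne_top (mul_ne_top (mul_ne_top hD (zp_netop k)) ?_) this
  exact ne_top_of_le_ne_top wd_sum (ENNReal.tsum_le_tsum fun s => wd_mono (by norm_num) s)

lemma Ad.integrable {D : EN} {k q : ℤ} {φ : ℝ → ℂ} (h : Ad D k q φ) (hD : D ≠ ⊤) : Integrable φ :=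
  ⟨h.meas.aestronglyMeasurable, (h.lint hD).lt_top⟩

lemma AA_sub_const {k m : ℤ} {f : ℝ → ℂ} (hf : Integrable f) (c : ℂ) : AA k m (fun x => f x - c) = AA k m f - c := by
  unfold AA
  have hv : volume (Dy k m) ≠ ⊤ := by rw [vol_Dy]; exact zp_netop k
  rw [integral_sub hf.integrableOn (integrableOn_const hv), smul_sub]
  congr 1
  rw [setIntegral_const, Measure.real, vol_Dy, smul_smul, ← ofReal_two_zpow, toReal_ofReal (by positivity), ← zpow_add₀ (by norm_num)]
  simp

lemma dd_small {D : EN} {k q : ℤ} {φ : ℝ → ℂ} (h : Ad D k q φ) (hD : D ≠ ⊤) (j : ℕ) (x : ℝ) :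
    ‖dd (k-j) (fl (k-j) x) φ‖ₑ ≤ D * wd 5 (fl k x - q) * (2⁻¹)^j := by
  have h1 : dd (k-j) (fl (k-j) x) φ = dd (k-j) (fl (k-j) x) (fun y => φ y - φ x) := by
    unfold dd; rw [AA_sub_const (h.integrable hD), AA_sub_const (h.integrable hD)]; simp
  rw [h1]
  refine (dd_le _ _ _).trans ?_
  rw [← av_const (k-j) (fl (k-j) x) (D * wd 5 (fl k x - q) * (2⁻¹)^j)]
  unfold av
  refine mul_le_mul_right (setLIntegral_mono measurable_const fun y hy => ?_) _
  rw [← enorm_neg, neg_sub]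
  exact h.lip j x y (Eq.symm hy)

lemma half_bound {D : EN} {k q : ℤ} {φ : ℝ → ℂ} (h : Ad D k q φ) (hD : D ≠ ⊤) (h0 : ∫ x, φ x = 0) (j : ℕ) (u : ℤ) :
    ‖∫ x in Dy (k+j) u, φ x‖ₑ ≤ 2 * (∑' s, wd 2 s) * D * ∫⁻ y in Dy (k+j) u, (NN j k).indicator (fun _ => 1) y * wd 3 (fl k y - q) := by
  set e1 : ℤ := 2^j * u with he1
  set e2 : ℤ := 2^j * u + (2^j - 1) with he2
  have hp : (1:ℤ) ≤ 2^j := one_le_pow₀ (by norm_num)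
  have hmem : ∀ y, y ∈ Dy (k+j) u ↔ e1 ≤ fl k y ∧ fl k y ≤ e2 := by
    intro y
    simp only [Dy, Set.mem_setOf_eq, fl_add, he1, he2]
    rw [Int.ediv_eq_iff_of_pos (by omega)]
    constructor
    · rintro ⟨h1, h2⟩; constructor <;> linarith
    · rintro ⟨h1, h2⟩; constructor <;> linarith
  have hedge : ∀ e, (e = e1 ∨ e = e2) → 2^k * wd 3 (e - q) ≤ ∫⁻ y in Dy (k+j) u, (NN j k).indicator (fun _ => 1) y * wd 3 (fl k y - q) := by
    intro e he
    have hsub : Dy k e ⊆ Dy (k+j) u := by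
      intro y hy; rw [hmem, show fl k y = e from hy]
      rcases he with rfl | rfl <;> constructor <;> linarith
    refine le_trans (le_of_eq ?_) (lintegral_mono_set hsub)
    rw [← vol_Dy k e, mul_comm, ← setLIntegral_const]
    refine setLIntegral_congr_fun (meas_Dy _ _) fun y hy => ?_
    have hy' : fl k y = e := hy
    have : y ∈ NN j k := by
      simp only [NN, Set.mem_setOf_eq, hy']
      rcases he with rfl | rfl
      · left; simp [he1]
      · right; rw [he2, add_comm, Int.add_mul_emod_self_left, Int.emod_eq_of_lt (by omega) (by omega)]
    simp [this, hy']
  have hint := h.integrable hD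
  have hbd : ∀ S : Set ℝ, MeasurableSet S → (∀ y ∈ S, (e1-q).natAbs ≤ (fl k y - q).natAbs ∨ (e2-q).natAbs ≤ (fl k y - q).natAbs) →
      ‖∫ x in S, φ x‖ₑ ≤ D * ((wd 3 (e1-q) + wd 3 (e2-q)) * (2^k * ∑' s, wd 2 s)) := by
    intro S hS hy
    refine (enorm_integral_le_lintegral_enorm _).trans ?_
    have e : (2:EN)^k * ∑' s, wd 2 s = ∫⁻ x, wd 2 (fl k x - q) := by
      have := lint_wd 2 k q (measurable_const (a := (1:EN)))
      simpa [av_const] using this.symm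
    have hm : Measurable fun x => wd 2 (fl k x - q) := meas_cell k (fun m => wd 2 (m - q))
    rw [e, ← mul_assoc, ← lintegral_const_mul _ hm]
    refine le_trans ?_ (setLIntegral_le_lintegral S _)
    refine setLIntegral_mono (hm.const_mul _) fun y hyS => (h.bd y).trans ?_
    rw [mul_assoc]
    refine mul_le_mul_right ?_ _
    rw [show (5:ℕ) = 3 + 2 by norm_num, wd_add]
    refine mul_le_mul_left ?_ _
    rcases hy y hyS with hh | hh
    · exact (wd_anti 3 hh).trans le_self_add
    · exact (wd_anti 3 hh).trans le_add_self
  have key : ‖∫ x in Dy (k+j) u, φ x‖ₑ ≤ D * ((wd 3 (e1-q) + wd 3 (e2-q)) * (2^k * ∑' s, wd 2 s)) := by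
    by_cases hq : e1 ≤ q ∧ q ≤ e2
    · have h1 : ∫ x in Dy (k+j) u, φ x = -∫ x in (Dy (k+j) u)ᶜ, φ x := by
        have := integral_add_compl (meas_Dy (k+j) u) hint
        rw [h0] at this
        exact eq_neg_of_add_eq_zero_left this
      rw [h1, enorm_neg]
      refine hbd _ (meas_Dy _ _).compl fun y hy => ?_
      rw [Set.mem_compl_iff, hmem] at hy
      omega
    · refine hbd _ (meas_Dy _ _) fun y hy => ?_
      rw [hmem] at hy
      omega
  refine key.trans ?_
  calc _ = (∑' s, wd 2 s) * D * (2^k * wd 3 (e1-q) + 2^k * wd 3 (e2-q)) := by ring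
    _ ≤ (∑' s, wd 2 s) * D * (_ + _) := mul_le_mul_right (add_le_add (hedge e1 (Or.inl rfl)) (hedge e2 (Or.inr rfl))) _
    _ = _ := by ring

lemma dd_big {D : EN} {k q : ℤ} {φ : ℝ → ℂ} (h : Ad D k q φ) (hD : D ≠ ⊤) (h0 : ∫ x, φ x = 0) (j : ℕ) (m : ℤ) :
    ‖dd (k+j+1) m φ‖ₑ ≤ 2 * (∑' s, wd 2 s) * D * av (k+j+1) m (fun y => (NN j k).indicator (fun _ => 1) y * wd 3 (fl k y - q)) := by
  rw [av_split, dd, enorm_smul, add_sub_cancel_right]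
  have : ‖(1/2:ℝ)‖ₑ = 2⁻¹ := by
    rw [Real.enorm_eq_ofReal (by norm_num), one_div, ofReal_inv_of_pos (by norm_num)]; simp
  rw [this, mul_left_comm]
  refine mul_le_mul_right (enorm_sub_le.trans ?_) _
  have hA : ∀ u, ‖AA (k+j) u φ‖ₑ ≤ 2 * (∑' s, wd 2 s) * D * av (k+j) u (fun y => (NN j k).indicator (fun _ => 1) y * wd 3 (fl k y - q)) := by
    intro u
    unfold AA av
    rw [enorm_smul, Real.enorm_eq_ofReal (by positivity), ofReal_two_zpow, mul_left_comm]
    exact mul_le_mul_right (half_bound h hD h0 j u) _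
  rw [add_comm, mul_add]
  exact add_le_add (hA _) (hA _)

lemma enorm_integral_cells (k : ℤ) {g : ℝ → ℂ} (hg : Integrable g) : ‖∫ x, g x‖ₑ ≤ ∑' m, ‖∫ x in Dy k m, g x‖ₑ := by
  have hU : (⋃ m, Dy k m) = Set.univ := by ext x; simp [Dy]
  have := integral_iUnion (μ := volume) (f := g) (fun m => meas_Dy k m) (fun a b hab => Dy_disj k hab) hg.integrableOn
  rw [hU, setIntegral_univ] at this
  rw [this]
  exact enorm_tsum_le_tsum_enorm

noncomputable def PA (K : ℤ) (f φ : ℝ → ℂ) : ℂ := ∫ x, f x * AA K (fl K x) φ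

lemma meas_cellC (k : ℤ) (c : ℤ → ℂ) : Measurable (fun x => c (fl k x)) := (measurable_from_top (f := c)).comp (measurable_fl k)

lemma PA_int {D : EN} {k q : ℤ} {f φ : ℝ → ℂ} (hf : Integrable f) (h : Ad D k q φ) (hD : D ≠ ⊤) (K : ℤ) :
    Integrable (fun x => f x * AA K (fl K x) φ) := by
  have hDr : ∀ x, ‖AA K (fl K x) φ‖ₑ ≤ D := by
    intro x
    refine (AA_le _ _ _).trans ((av_mono (h := fun _ => D) fun y => ?_).trans (le_of_eq (av_const _ _ _)))
    exact (h.bd y).trans (mul_le_of_le_one_right' (wd_le_one _ _))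
  refine hf.mul_bdd (c := D.toReal) (meas_cellC K (fun m => AA K m φ)).aestronglyMeasurable (ae_of_all _ fun x => ?_)
  have := toReal_mono hD (hDr x)
  simpa using this

noncomputable def TT (K : ℤ) (f φ : ℝ → ℂ) : EN := ∫⁻ x, ‖dd K (fl K x) f‖ₑ * ‖dd K (fl K x) φ‖ₑ

lemma PA_step {D : EN} {k q : ℤ} {f φ : ℝ → ℂ} (hf : Integrable f) (h : Ad D k q φ) (hD : D ≠ ⊤) (K : ℤ) :
    ‖PA (K-1) f φ‖ₑ ≤ ‖PA K f φ‖ₑ + TT K f φ := by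
  have hi1 := PA_int hf h hD (K-1)
  have hi2 := PA_int hf h hD K
  have hφ := h.integrable hD
  have e : PA (K-1) f φ = PA K f φ + ∫ x, (f x * AA (K-1) (fl (K-1) x) φ - f x * AA K (fl K x) φ) := by
    rw [integral_sub hi1 hi2]; unfold PA; ring
  rw [e]
  refine (enorm_add_le _ _).trans (add_le_add_right ?_ _)
  refine (enorm_integral_cells K (hi1.sub hi2)).trans ?_
  unfold TT
  rw [lint_cell K (fun m => ‖dd K m f‖ₑ * ‖dd K m φ‖ₑ)]
  refine ENNReal.tsum_le_tsum fun m => le_of_eq ?_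
  obtain ⟨h1, h2⟩ := AA_split (k := K) (m := m) hφ
  have e1 : ∫ x in Dy (K-1) (2*m), (f x * AA (K-1) (fl (K-1) x) φ - f x * AA K (fl K x) φ) = (∫ x in Dy (K-1) (2*m), f x) * (- dd K m φ) := by
    rw [← integral_mul_const]
    refine setIntegral_congr_fun (meas_Dy _ _) fun x hx => ?_
    have hx' : fl (K-1) x = 2*m := hx
    have hx2 : fl K x = m := by rw [fl_half, hx']; omega
    simp only [hx', hx2, h2]; ring
  have e2 : ∫ x in Dy (K-1) (2*m+1), (f x * AA (K-1) (fl (K-1) x) φ - f x * AA K (fl K x) φ) = (∫ x in Dy (K-1) (2*m+1), f x) * dd K m φ := by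
    rw [← integral_mul_const]
    refine setIntegral_congr_fun (meas_Dy _ _) fun x hx => ?_
    have hx' : fl (K-1) x = 2*m+1 := hx
    have hx2 : fl K x = m := by rw [fl_half, hx']; omega
    simp only [hx', hx2, h1]; ring
  have e3 : ∫ x in Dy K m, (f x * AA (K-1) (fl (K-1) x) φ - f x * AA K (fl K x) φ) = ((2:ℝ)^K : ℝ) • (dd K m f * dd K m φ) := by
    rw [Dy_split, setIntegral_union (f := fun x => f x * AA (K-1) (fl (K-1) x) φ - f x * AA K (fl K x) φ) (Dy_disj (K-1) (by omega : 2*m ≠ 2*m+1)) (meas_Dy _ _) (hi1.sub hi2).integrableOn (hi1.sub hi2).integrableOn, e1, e2]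
    have : dd K m f = ((2:ℝ)^(-K) : ℝ) • (∫ x in Dy (K-1) (2*m+1), f x) - ((2:ℝ)^(-K) : ℝ) • (∫ x in Dy (K-1) (2*m), f x) := by
      unfold dd AA
      rw [← smul_sub, smul_smul, ← smul_sub]; congr 1
      rw [show -(K-1) = -K + 1 by ring, zpow_add₀ (by norm_num)]; norm_num; ring
    rw [this, ← smul_sub, smul_mul_assoc, smul_smul, ← zpow_add₀ (by norm_num)]
    simp; ring
  refine (congrArg _ e3).trans ?_
  rw [enorm_smul, Real.enorm_eq_ofReal (by positivity), ofReal_two_zpow, enorm_mul]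

theorem EXPD : ∃ C : EN, C ≠ ⊤ ∧ ∀ (D : EN) (k q : ℤ) (f φ : ℝ → ℂ), Integrable f → Ad D k q φ → D ≠ ⊤ → ∫ x, φ x = 0 →
    ‖∫ x, f x * φ x‖ₑ ≤ C * D * 2^k * KK (fun k m => ‖dd k m f‖ₑ) k q := by
  refine ⟨2 * (∑' s, wd 2 s) + 1, ENNReal.add_ne_top.mpr ⟨mul_ne_top (by simp) wd_sum, by simp⟩, fun D k q f φ hf h hD h0 => ?_⟩
  set C := 2 * (∑' s, wd 2 s) + 1 with hC
  set c : ℤ → ℤ → EN := fun k m => ‖dd k m f‖ₑ with hc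
  have hφ := h.integrable hD
  have hT : ∀ j : ℕ, TT (k-j) f φ + TT (k+j+1) f φ ≤ C * D * 2^k * ∑' s, wd 3 s * av k (q+s) (gK c j k) := by
    intro j
    rw [mul_assoc, ← lint_wd 3 k q (meas_gK c j k), ← lintegral_const_mul (f := fun x => wd 3 (fl k x - q) * gK c j k x) _ ((meas_cell k (fun m => wd 3 (m-q))).mul (meas_gK c j k))]
    have hm1 : ∀ k', Measurable fun x => c k' (fl k' x) := fun k' => meas_cell k' _
    have hm3 : Measurable fun x => wd 3 (fl k x - q) := meas_cell k (fun m => wd 3 (m-q))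
    have hmN : Measurable ((NN j k).indicator (fun _ => (1:EN))) := measurable_const.indicator (meas_NN j k)
    have t1 : TT (k-j) f φ ≤ ∫⁻ x, C * D * (wd 3 (fl k x - q) * ((2⁻¹)^j * c (k-j) (fl (k-j) x))) := by
      refine lintegral_mono fun x => ?_
      calc _ ≤ c (k-j) (fl (k-j) x) * (1 * D * wd 3 (fl k x - q) * (2⁻¹)^j) := by
            rw [one_mul]
            gcongr
            refine (dd_small h hD j x).trans ?_
            gcongr; exact wd_mono (by norm_num) _
        _ ≤ c (k-j) (fl (k-j) x) * (C * D * wd 3 (fl k x - q) * (2⁻¹)^j) := by gcongr; exact le_add_self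
        _ = _ := by ring
    have t2 : TT (k+j+1) f φ ≤ ∫⁻ x, C * D * (wd 3 (fl k x - q) * (c (k+j+1) (fl (k+j+1) x) * (NN j k).indicator (fun _ => 1) x)) := by
      calc TT (k+j+1) f φ ≤ ∑' m, 2^(k+j+1) * (c (k+j+1) m * (C * D * av (k+j+1) m (fun y => (NN j k).indicator (fun _ => 1) y * wd 3 (fl k y - q)))) := by
            unfold TT
            rw [lint_cell (k+j+1) (fun m => ‖dd (k+j+1) m f‖ₑ * ‖dd (k+j+1) m φ‖ₑ)]
            refine ENNReal.tsum_le_tsum fun m => ?_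
            gcongr
            refine (dd_big h hD h0 j m).trans ?_
            gcongr; exact le_self_add
        _ = C * D * ∑' m, 2^(k+j+1) * (c (k+j+1) m * av (k+j+1) m (fun y => (NN j k).indicator (fun _ => 1) y * wd 3 (fl k y - q))) := by
            rw [← ENNReal.tsum_mul_left]; congr 1; ext m; ring
        _ = C * D * ∫⁻ x, c (k+j+1) (fl (k+j+1) x) * ((NN j k).indicator (fun _ => 1) x * wd 3 (fl k x - q)) := by
            exact congrArg (fun t => C * D * t) (lint_cell_av (k+j+1) (c (k+j+1)) (hmN.mul hm3)).symm
        _ = _ := by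
            rw [← lintegral_const_mul (f := fun x => c (k+j+1) (fl (k+j+1) x) * ((NN j k).indicator (fun _ => 1) x * wd 3 (fl k x - q))) _ ((hm1 _).mul (hmN.mul hm3))]
            congr 1; ext x; ring
    refine (add_le_add t1 t2).trans (le_of_eq ?_)
    rw [← lintegral_add_left (f := fun x => C * D * (wd 3 (fl k x - q) * ((2⁻¹)^j * c (k-j) (fl (k-j) x)))) ((hm3.mul ((hm1 _).const_mul _)).const_mul _)]
    congr 1; ext x; simp only [gK, Pi.mul_apply]; ring
  have hind : ∀ n : ℕ, ‖PA (k-n) f φ‖ₑ ≤ ‖PA (k+n) f φ‖ₑ + ∑ j ∈ Finset.range n, (TT (k-j) f φ + TT (k+j+1) f φ) := by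
    intro n
    induction n with
    | zero => simp
    | succ n ih =>
      have s1 := PA_step hf h hD (k-n)
      have s2 := PA_step hf h hD (k+n+1)
      rw [add_sub_cancel_right] at s2
      rw [Finset.sum_range_succ]
      push_cast
      rw [← sub_sub, ← add_assoc]
      refine s1.trans ((add_le_add_left ih _).trans ((add_le_add_left (add_le_add_left s2 _) _).trans (le_of_eq ?_)))
      ring
  set I1 := ∫⁻ x, ‖f x‖ₑ with hI1
  set I2 := ∫⁻ x, ‖φ x‖ₑ with hI2
  have hI1t : I1 ≠ ⊤ := hf.2.ne
  have hI2t : I2 ≠ ⊤ := h.lint hD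
  have hbig : ∀ n : ℕ, ‖PA (k+n) f φ‖ₑ ≤ I1 * (2^(-k) * I2) * (2⁻¹)^n := by
    intro n
    unfold PA
    refine (enorm_integral_le_lintegral_enorm _).trans ?_
    rw [mul_assoc I1, hI1, ← lintegral_mul_const' _ _ (by
      refine mul_ne_top (mul_ne_top (zp_netop _) hI2t) (by simp))]
    refine lintegral_mono fun x => ?_
    rw [enorm_mul]
    refine mul_le_mul_right ((AA_le _ _ _).trans ?_) _
    unfold av
    calc _ ≤ (2:EN)^(-(k+n)) * I2 := mul_le_mul_right (setLIntegral_le_lintegral _ _) _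
      _ = _ := by
        rw [neg_add, zp_add]
        have : (2:EN)^(-(n:ℤ)) = (2⁻¹)^n := by rw [ENNReal.zpow_neg, zpow_natCast, ENNReal.inv_pow]
        rw [this]; ring
  have hsm : ∀ n : ℕ, ‖∫ x, f x * φ x‖ₑ ≤ ‖PA (k-n) f φ‖ₑ + I1 * D * (2⁻¹)^n := by
    intro n
    have hDr : ∀ x, ‖φ x‖ₑ ≤ D := fun x => (h.bd x).trans (mul_le_of_le_one_right' (wd_le_one _ _))
    have hi : Integrable (fun x => f x * φ x) := hf.mul_bdd (c := D.toReal) h.meas.aestronglyMeasurable (ae_of_all _ fun x => by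
      have := toReal_mono hD (hDr x); simpa using this)
    have e : ∫ x, f x * φ x = PA (k-n) f φ + ∫ x, (f x * φ x - f x * AA (k-n) (fl (k-n) x) φ) := by
      rw [integral_sub hi (PA_int hf h hD (k-n))]; unfold PA; ring
    rw [e]
    refine (enorm_add_le _ _).trans (add_le_add_right ?_ _)
    refine (enorm_integral_le_lintegral_enorm _).trans ?_
    rw [mul_assoc, hI1, ← lintegral_mul_const' _ _ (mul_ne_top hD (by simp))]
    refine lintegral_mono fun x => ?_
    rw [← mul_sub, enorm_mul]
    refine mul_le_mul_right ?_ _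
    rw [← enorm_neg, neg_sub, ← AA_sub_const hφ]
    refine (AA_le _ _ _).trans ?_
    rw [← av_const (k-n) (fl (k-n) x) (D * (2⁻¹)^n)]
    unfold av
    refine mul_le_mul_right (setLIntegral_mono measurable_const fun y hy => ?_) _
    refine (h.lip n y x hy).trans ?_
    gcongr
    exact mul_le_of_le_one_right' (wd_le_one _ _)
  have hfinal : ∀ n : ℕ, ‖∫ x, f x * φ x‖ₑ ≤ C * D * 2^k * KK c k q + (I1 * (2^(-k) * I2) + I1 * D) * (2⁻¹)^n := by
    intro n
    calc _ ≤ _ := hsm n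
      _ ≤ (I1 * (2^(-k) * I2) * (2⁻¹)^n + C * D * 2^k * KK c k q) + I1 * D * (2⁻¹)^n := by
        refine add_le_add_left ((hind n).trans (add_le_add (hbig n) ?_)) _
        calc _ ≤ ∑ j ∈ Finset.range n, C * D * 2^k * ∑' s, wd 3 s * av k (q+s) (gK c j k) := Finset.sum_le_sum fun j _ => hT j
          _ ≤ _ := by rw [← Finset.mul_sum]; unfold KK; gcongr; exact ENNReal.sum_le_tsum _
      _ = _ := by ring
  refine ge_of_tendsto' (x := atTop) ?_ hfinal
  have hlim : Tendsto (fun n : ℕ => (I1 * (2^(-k) * I2) + I1 * D) * (2⁻¹:EN)^n) atTop (𝓝 ((I1 * (2^(-k) * I2) + I1 * D) * 0)) :=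
    ENNReal.Tendsto.const_mul (ENNReal.tendsto_pow_atTop_nhds_zero_of_lt_one (by simp)) (Or.inr (ENNReal.add_ne_top.mpr
      ⟨mul_ne_top hI1t (mul_ne_top (zp_netop _) hI2t), mul_ne_top hI1t hD⟩))
  have := hlim.const_add (C * D * 2^k * KK c k q)
  simpa using this

lemma Nm_sliceX {p : ℝ} (hp : 0 < p) {F G : RR → EN} (hF : Measurable F) (hG : Measurable G) {C : EN} (hC : C ≠ ⊤)
    (h : ∀ y, Nm p volume (fun x => F (x,y)) ≤ C * Nm p volume (fun x => G (x,y))) : Nm p volume F ≤ C * Nm p volume G := by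
  rw [Nm_le_iff hp, Measure.volume_eq_prod, lintegral_prod_symm _ (hF.pow_const p).aemeasurable,
    lintegral_prod_symm _ (hG.pow_const p).aemeasurable, ← lintegral_const_mul' _ _ (by simp [hC, hp.le])]
  exact lintegral_mono fun y => (Nm_le_iff hp).1 (h y)

lemma Nm_sliceY {p : ℝ} (hp : 0 < p) {F G : RR → EN} (hF : Measurable F) (hG : Measurable G) {C : EN} (hC : C ≠ ⊤)
    (h : ∀ x, Nm p volume (fun y => F (x,y)) ≤ C * Nm p volume (fun y => G (x,y))) : Nm p volume F ≤ C * Nm p volume G := by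
  rw [Nm_le_iff hp, Measure.volume_eq_prod, lintegral_prod _ (hF.pow_const p).aemeasurable,
    lintegral_prod _ (hG.pow_const p).aemeasurable, ← lintegral_const_mul' _ _ (by simp [hC, hp.le])]
  exact lintegral_mono fun y => (Nm_le_iff hp).1 (h y)

lemma XN_sliceX {ι κ : Type} [Countable ι] [Countable κ] {p : ℝ} (hp : 0 < p) {F : ι → RR → EN} {G : κ → RR → EN}
    (hF : ∀ i, Measurable (F i)) (hG : ∀ i, Measurable (G i)) {C : EN} (hC : C ≠ ⊤)
    (h : ∀ y, XN p volume (fun i x => F i (x,y)) ≤ C * XN p volume (fun i x => G i (x,y))) : XN p volume F ≤ C * XN p volume G :=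
  Nm_sliceX hp (meas_l2 hF) (meas_l2 hG) hC h

lemma XN_sliceY {ι κ : Type} [Countable ι] [Countable κ] {p : ℝ} (hp : 0 < p) {F : ι → RR → EN} {G : κ → RR → EN}
    (hF : ∀ i, Measurable (F i)) (hG : ∀ i, Measurable (G i)) {C : EN} (hC : C ≠ ⊤)
    (h : ∀ x, XN p volume (fun i y => F i (x,y)) ≤ C * XN p volume (fun i y => G i (x,y))) : XN p volume F ≤ C * XN p volume G :=
  Nm_sliceY hp (meas_l2 hF) (meas_l2 hG) hC h

lemma XN_single {α : Type*} [MeasurableSpace α] (p : ℝ) (μ : Measure α) (F : α → EN) : XN p μ (fun (_:Unit) x => F x) = Nm p μ F := by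
  unfold XN l2
  simp only [tsum_fintype, Finset.univ_unique, Finset.sum_const, Finset.card_singleton, one_smul, ← rpow_mul]
  norm_num

lemma l2_l2 {ι κ : Type*} (F : ι → κ → EN) : l2 (fun i => l2 (fun j => F i j)) = l2 (fun i : ι × κ => F i.1 i.2) := by
  conv_lhs => unfold l2
  conv_rhs => unfold l2
  rw [ENNReal.tsum_prod']
  congr 1; refine tsum_congr fun i => ?_
  rw [← rpow_mul]; norm_num

lemma l2_equiv {ι κ : Type*} (e : κ ≃ ι) (F : ι → EN) : l2 (fun i => F (e i)) = l2 F := by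
  unfold l2; rw [e.tsum_eq (fun i => F i ^ (2:ℝ))]

/-- vector-valued tail-maximal -/
theorem MT {p : ℝ} (hp : 1 < p) : ∃ C : EN, C ≠ ⊤ ∧ ∀ (ι : Type) (_ : Countable ι) (n : ℤ) (g : ι → ℝ → EN), (∀ i, Measurable (g i)) →
    XN p volume (fun i x => ∑' s, wd 3 s * Mx (n+s) (g i) x) ≤ C * kap n * XN p volume g := by
  obtain ⟨C, hC, H⟩ := FSp hp
  obtain ⟨C', hC', H'⟩ := wd_kap_sum
  refine ⟨C * C', mul_ne_top hC hC', fun ι _ n g hg => ?_⟩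
  refine (XN_tsum_le hp.le (F := fun s i x => wd 3 s * Mx (n+s) (g i) x) fun s i => (meas_Mx _ _).const_mul _).trans ?_
  calc _ ≤ ∑' s, C * XN p volume g * (wd 3 s * kap (n+s)) := by
        refine ENNReal.tsum_le_tsum fun s => ?_
        rw [XN_const_mul (by linarith) (fun i => meas_Mx _ _)]
        calc _ ≤ wd 3 s * _ := mul_le_mul_right (H ι inferInstance (n+s) g hg) _
          _ = _ := by ring
    _ ≤ C * XN p volume g * (C' * kap n) := by rw [ENNReal.tsum_mul_left]; exact mul_le_mul_right (H' n) _
    _ = _ := by ring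

structure Nice (f : RR → ℂ) : Prop where
  meas : Measurable f
  bd : ∃ B : ℝ, 0 ≤ B ∧ (∀ z, ‖f z‖ ≤ B) ∧ ∀ z, f z ≠ 0 → |z.1| ≤ B ∧ |z.2| ≤ B

lemma int_of_bdd {f : ℝ → ℂ} (hf : Measurable f) (B : ℝ) (h1 : ∀ x, ‖f x‖ ≤ B) (h2 : ∀ x, f x ≠ 0 → |x| ≤ B) : Integrable f := by
  have : f = (Set.Icc (-B) B).indicator f := by
    ext x; by_cases hx : x ∈ Set.Icc (-B) B
    · simp [hx]
    · rw [Set.indicator_of_notMem hx]; by_contra hne; exact hx (abs_le.mp (h2 x hne))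
  rw [this, integrable_indicator_iff measurableSet_Icc]
  exact Measure.integrableOn_of_bounded (M := B) (by simp) hf.aestronglyMeasurable (ae_of_all _ h1)

lemma Nice.int {f : RR → ℂ} (h : Nice f) : Integrable f := by
  obtain ⟨B, hB, h1, h2⟩ := h.bd
  have : f = (Set.Icc (-B) B ×ˢ Set.Icc (-B) B).indicator f := by
    ext x; by_cases hx : x ∈ Set.Icc (-B) B ×ˢ Set.Icc (-B) B
    · rw [Set.indicator_of_mem hx]
    · rw [Set.indicator_of_notMem hx]; by_contra hne; exact hx ⟨abs_le.mp (h2 x hne).1, abs_le.mp (h2 x hne).2⟩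
  rw [this, integrable_indicator_iff (measurableSet_Icc.prod measurableSet_Icc)]
  refine Measure.integrableOn_of_bounded (M := B) ?_ h.meas.aestronglyMeasurable (ae_of_all _ h1)
  rw [Measure.volume_eq_prod, Measure.prod_prod]
  exact mul_ne_top (by simp) (by simp)

lemma Nice.swap {f : RR → ℂ} (h : Nice f) : Nice (fun z => f z.swap) := by
  obtain ⟨B, hB, h1, h2⟩ := h.bd
  exact ⟨h.meas.comp measurable_swap, B, hB, fun z => h1 _, fun z hz => (h2 _ hz).symm⟩

lemma Nice.slice {f : RR → ℂ} (h : Nice f) (y : ℝ) : Integrable (fun x => f (x,y)) := by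
  obtain ⟨B, hB, h1, h2⟩ := h.bd
  exact int_of_bdd (h.meas.comp (measurable_id.prodMk measurable_const)) B (fun x => h1 _) (fun x hx => (h2 _ hx).1)

noncomputable def DX (f : RR → ℂ) (k m : ℤ) (y : ℝ) : ℂ := dd k m (fun x => f (x,y))

lemma AA_meas {f : RR → ℂ} (h : Nice f) (k m : ℤ) : Measurable (fun y => AA k m (fun x => f (x,y))) := by
  unfold AA
  refine Measurable.const_smul ?_ _
  exact (h.swap.meas.stronglyMeasurable.integral_prod_right' (ν := volume.restrict (Dy k m))).measurable

lemma DX_meas {f : RR → ℂ} (h : Nice f) (k m : ℤ) : Measurable (DX f k m) := by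
  unfold DX dd
  exact ((AA_meas h _ _).sub (AA_meas h _ _)).const_smul _

lemma AA_int {f : RR → ℂ} (h : Nice f) (k m : ℤ) : Integrable (fun y => AA k m (fun x => f (x,y))) := by
  obtain ⟨B, hB, h1, h2⟩ := h.bd
  refine int_of_bdd (AA_meas h k m) B (fun y => ?_) (fun y hy => ?_)
  · have := (AA_le k m (fun x => f (x,y))).trans ((av_mono (h := fun _ => oR B) fun x => ?_).trans (le_of_eq (av_const _ _ _)))
    · rw [← ofReal_norm] at this; exact (ofReal_le_ofReal_iff hB).1 this
    · rw [← ofReal_norm]; exact ofReal_le_ofReal (h1 _)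
  · by_contra hc
    apply hy
    have : (fun x => f (x,y)) = fun _ => 0 := by
      ext x; by_contra hne; exact hc (h2 _ hne).2
    rw [this]; simp [AA]

lemma DX_int {f : RR → ℂ} (h : Nice f) (k m : ℤ) : Integrable (DX f k m) := by
  unfold DX dd
  exact ((AA_int h _ _).sub (AA_int h _ _)).smul _

lemma Ad.norm_le {D : EN} {k q : ℤ} {φ : ℝ → ℂ} (h : Ad D k q φ) (hD : D ≠ ⊤) (x : ℝ) : ‖φ x‖ ≤ D.toReal := by
  have hDr : ‖φ x‖ₑ ≤ D := (h.bd x).trans (mul_le_of_le_one_right' (wd_le_one _ _))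
  have := toReal_mono hD hDr; simpa using this

lemma AA_comm {f : RR → ℂ} (h : Nice f) {D : EN} {k q : ℤ} {ψ : ℝ → ℂ} (hψ : Ad D k q ψ) (hD : D ≠ ⊤) (K m : ℤ) :
    AA K m (fun x => ∫ y, f (x,y) * ψ y) = ∫ y, AA K m (fun x => f (x,y)) * ψ y := by
  have hi : Integrable (fun z : RR => f z * ψ z.2) := h.int.mul_bdd (c := D.toReal) (hψ.meas.comp measurable_snd).aestronglyMeasurable
    (ae_of_all _ fun z => hψ.norm_le hD _)
  unfold AA
  rw [integral_integral_swap (f := fun x y => f (x,y) * ψ y)]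
  · rw [← integral_smul]
    congr 1; ext y
    rw [smul_mul_assoc, integral_mul_const]
  · exact hi.mono_measure (Measure.prod_mono Measure.restrict_le_self le_rfl)

lemma dd_comm {f : RR → ℂ} (h : Nice f) {D : EN} {k q : ℤ} {ψ : ℝ → ℂ} (hψ : Ad D k q ψ) (hD : D ≠ ⊤) (K m : ℤ) :
    dd K m (fun x => ∫ y, f (x,y) * ψ y) = ∫ y, DX f K m y * ψ y := by
  have hi : ∀ K m, Integrable (fun y => AA K m (fun x => f (x,y)) * ψ y) := fun K m => (AA_int h K m).mul_bdd (c := D.toReal) hψ.meas.aestronglyMeasurable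
    (ae_of_all _ fun z => hψ.norm_le hD _)
  unfold DX dd
  rw [AA_comm h hψ hD, AA_comm h hψ hD, ← integral_sub (hi _ _) (hi _ _), ← integral_smul]
  congr 1; ext y
  rw [smul_mul_assoc, sub_mul]

lemma fub1 {f : RR → ℂ} (h : Nice f) {D D' : EN} {k q k' q' : ℤ} {φ ψ : ℝ → ℂ} (hφ : Ad D k q φ) (hD : D ≠ ⊤) (hψ : Ad D' k' q' ψ) (hD' : D' ≠ ⊤) :
    Integrable (fun x => ∫ y, f (x,y) * ψ y) ∧ ∫ z, f z * (φ z.1 * ψ z.2) = ∫ x, (∫ y, f (x,y) * ψ y) * φ x := by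
  have hi : Integrable (fun z : RR => f z * ψ z.2) := h.int.mul_bdd (c := D'.toReal) (hψ.meas.comp measurable_snd).aestronglyMeasurable
    (ae_of_all _ fun z => hψ.norm_le hD' _)
  have hi2 : Integrable (fun z : RR => f z * ψ z.2 * φ z.1) := hi.mul_bdd (c := D.toReal) (hφ.meas.comp measurable_fst).aestronglyMeasurable
    (ae_of_all _ fun z => hφ.norm_le hD _)
  refine ⟨hi.integral_prod_left, ?_⟩
  have e : ∀ z : RR, f z * (φ z.1 * ψ z.2) = f z * ψ z.2 * φ z.1 := fun z => by ring
  simp_rw [e]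
  rw [Measure.volume_eq_prod, integral_prod _ hi2]
  congr 1; ext x
  exact integral_mul_const (φ x) (fun y => f (x,y) * ψ y)

lemma fub2 {f : RR → ℂ} (h : Nice f) {D D' : EN} {k q k' q' : ℤ} {φ ψ : ℝ → ℂ} (hφ : Ad D k q φ) (hD : D ≠ ⊤) (hψ : Ad D' k' q' ψ) (hD' : D' ≠ ⊤) :
    ∫ z, f z * (φ z.1 * ψ z.2) = ∫ y, (∫ x, f (x,y) * φ x) * ψ y := by
  refine Eq.trans ?_ (fub1 h.swap hψ hD' hφ hD).2
  rw [Measure.volume_eq_prod, ← integral_prod_swap]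
  congr 1; ext z; simp only [Prod.fst_swap, Prod.snd_swap]; ring

lemma KK_mono {c c' : ℤ → ℤ → EN} (h : ∀ k m, c k m ≤ c' k m) (k q : ℤ) : KK c k q ≤ KK c' k q := by
  unfold KK
  refine ENNReal.tsum_le_tsum fun j => ENNReal.tsum_le_tsum fun s => mul_le_mul_right (av_mono fun y => ?_) _
  unfold gK; gcongr <;> exact h _ _

lemma KK_const_mul (a : EN) (ha : a ≠ ⊤) (c : ℤ → ℤ → EN) (k q : ℤ) : KK (fun k m => a * c k m) k q = a * KK c k q := by
  unfold KK
  rw [← ENNReal.tsum_mul_left]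
  refine tsum_congr fun j => ?_
  rw [← ENNReal.tsum_mul_left]
  refine tsum_congr fun s => ?_
  have : av k (q+s) (gK (fun k m => a * c k m) j k) = a * av k (q+s) (gK c j k) := by
    unfold av
    rw [mul_left_comm, ← lintegral_const_mul' _ _ ha]
    congr 2; ext x; unfold gK; ring
  rw [this]; ring

lemma KK_meas {α : Type*} [MeasurableSpace α] {c : ℤ → ℤ → α → EN} (hc : ∀ k m, Measurable (c k m)) (k q : ℤ) :
    Measurable (fun y => KK (fun k m => c k m y) k q) := by
  unfold KK
  refine Measurable.ennreal_tsum fun j => Measurable.ennreal_tsum fun s => Measurable.const_mul ?_ _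
  unfold av
  refine Measurable.const_mul ?_ _
  have hm : ∀ k, Measurable (fun z : α × ℝ => c k (fl k z.2) z.1) := fun k => by
    have : Measurable (fun z : ℤ × α => c k z.1 z.2) := measurable_from_prod_countable_right fun m => hc k m
    exact this.comp (((measurable_fl k).comp measurable_snd).prodMk measurable_fst)
  have : Measurable (fun z : α × ℝ => gK (fun k m => c k m z.1) j k z.2) := by
    unfold gK
    exact ((hm _).const_mul _).add ((hm _).mul ((measurable_const.indicator (meas_NN j k)).comp measurable_snd))
  exact this.lintegral_prod_right' (ν := volume.restrict (Dy k (q+s)))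

abbrev Rc := (ℤ × ℤ) × (ℤ × ℤ)

def HypF (D : EN) (n1 n2 : ℤ) (sx sy : Bool) (f : RR → ℂ) (a : Rc → EN) : Prop :=
  ∀ r : Rc, ∃ φ ψ : ℝ → ℂ, Ad D r.1.1 (r.1.2+n1) φ ∧ Ad D r.2.1 (r.2.2+n2) ψ ∧ (sx = true → ∫ x, φ x = 0) ∧ (sy = true → ∫ x, ψ x = 0) ∧
    a r ≤ 2 * (2^(-r.1.1) * 2^(-r.2.1) * ‖∫ z, f z * (φ z.1 * ψ z.2)‖ₑ)

noncomputable def AC (a : Rc → EN) (k1 k2 : ℤ) (z : RR) : EN := a ((k1, fl k1 z.1), (k2, fl k2 z.2))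

lemma cell2 (k k' : ℤ) (c : ℤ → ℤ → EN) : Measurable (fun z : RR => c (fl k z.1) (fl k' z.2)) :=
  (Measurable.of_discrete (f := fun m : ℤ × ℤ => c m.1 m.2)).comp
    (((measurable_fl k).comp measurable_fst).prodMk ((measurable_fl k').comp measurable_snd))

lemma AC_meas (a : Rc → EN) (k1 k2 : ℤ) : Measurable (AC a k1 k2) := cell2 k1 k2 (fun m m' => a ((k1,m),(k2,m')))

lemma cellX (k : ℤ) {c : ℤ → ℝ → EN} (hc : ∀ m, Measurable (c m)) : Measurable (fun z : RR => c (fl k z.1) z.2) := by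
  have : Measurable (fun z : ℤ × ℝ => c z.1 z.2) := measurable_from_prod_countable_right fun m => hc m
  exact this.comp (((measurable_fl k).comp measurable_fst).prodMk measurable_snd)

lemma DXN {p : ℝ} (hp : 1 < p) : ∃ C : EN, C ≠ ⊤ ∧ ∀ f, Nice f →
    XN p volume (fun (k : ℤ) (z : RR) => ‖DX f k (fl k z.1) z.2‖ₑ) ≤ C * Nm p volume (fun z => ‖f z‖ₑ) := by
  obtain ⟨C, hC, H⟩ := VV hp
  refine ⟨C, hC, fun f hf => ?_⟩
  rw [← XN_single]
  refine XN_sliceX (by linarith) (fun k => cellX k fun m => (DX_meas hf k m).enorm) (fun _ => hf.meas.enorm) hC fun y => ?_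
  refine le_trans (le_of_eq ?_) (H Unit inferInstance (fun _ x => f (x,y)) (fun _ => hf.slice y) (fun _ => hf.meas.comp (measurable_id.prodMk measurable_const)))
  unfold XN
  congr 1; ext x
  exact (l2_equiv (Equiv.punitProd ℤ) (fun k => ‖DX f k (fl k x) y‖ₑ)).symm

lemma canc (k1 k2 : ℤ) (a b Q : EN) : 2 * (2^(-k1) * 2^(-k2) * (a * 2^k1 * (b * 2^k2 * Q))) = 2 * (a * b) * Q := by
  calc _ = 2 * (a * b) * Q * (2^k1 * 2^(-k1)) * (2^k2 * 2^(-k2)) := by ring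
    _ = _ := by rw [zp_mul', zp_mul', mul_one, mul_one]

lemma ptSS : ∃ C : EN, C ≠ ⊤ ∧ ∀ (D : EN) (n1 n2 : ℤ) (f : RR → ℂ) (a : Rc → EN), D ≠ ⊤ → Nice f → HypF D n1 n2 true true f a →
    ∀ r, a r ≤ C * D^2 * KK (fun k m => KK (fun k' m' => ‖dd k' m' (DX f k m)‖ₑ) r.2.1 (r.2.2+n2)) r.1.1 (r.1.2+n1) := by
  obtain ⟨C, hC, H⟩ := EXPD
  refine ⟨2 * C^2, mul_ne_top (by simp) (pow_ne_top hC), fun D n1 n2 f a hD hf ha r => ?_⟩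
  obtain ⟨φ, ψ, hφ, hψ, h1, h2, h⟩ := ha r
  refine h.trans ?_
  obtain ⟨hi, e⟩ := fub1 hf hφ hD hψ hD
  rw [e]
  have hc : ∀ k m, ‖dd k m (fun x => ∫ y, f (x,y) * ψ y)‖ₑ ≤ C * D * 2^r.2.1 * KK (fun k' m' => ‖dd k' m' (DX f k m)‖ₑ) r.2.1 (r.2.2+n2) := by
    intro k m
    rw [dd_comm hf hψ hD]
    exact H D _ _ _ _ (DX_int hf k m) hψ hD (h2 rfl)
  have h3 := (H D _ _ _ _ hi hφ hD (h1 rfl)).trans (mul_le_mul_right (KK_mono hc _ _) _)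
  rw [KK_const_mul _ (mul_ne_top (mul_ne_top hC hD) (zp_netop _))] at h3
  calc _ ≤ _ := mul_le_mul_right (mul_le_mul_right h3 _) _
    _ = _ := by rw [canc]; ring

lemma ptSM : ∃ C : EN, C ≠ ⊤ ∧ ∀ (D : EN) (n1 n2 : ℤ) (f : RR → ℂ) (a : Rc → EN), D ≠ ⊤ → Nice f → HypF D n1 n2 true false f a →
    ∀ r, a r ≤ C * D^2 * ∑' s, wd 3 s * av r.2.1 (r.2.2+n2+s) (fun y => KK (fun k m => ‖DX f k m y‖ₑ) r.1.1 (r.1.2+n1)) := by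
  obtain ⟨C, hC, H⟩ := EXPD
  refine ⟨2 * C, mul_ne_top (by simp) hC, fun D n1 n2 f a hD hf ha r => ?_⟩
  obtain ⟨φ, ψ, hφ, hψ, h1, h2, h⟩ := ha r
  refine h.trans ?_
  rw [fub2 hf hφ hD hψ hD]
  have hm : Measurable (fun y => KK (fun k m => ‖DX f k m y‖ₑ) r.1.1 (r.1.2+n1)) := KK_meas (fun k m => (DX_meas hf k m).enorm) _ _
  have h3 : ‖∫ y, (∫ x, f (x,y) * φ x) * ψ y‖ₑ ≤ C * D * 2^r.1.1 * (D * 2^r.2.1 * ∑' s, wd 3 s * av r.2.1 (r.2.2+n2+s) (fun y => KK (fun k m => ‖DX f k m y‖ₑ) r.1.1 (r.1.2+n1))) := by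
    refine le_trans ?_ (mul_le_mul_right (TAIL hψ hm) _)
    rw [← lintegral_const_mul' _ _ (mul_ne_top (mul_ne_top hC hD) (zp_netop _))]
    refine (enorm_integral_le_lintegral_enorm _).trans (lintegral_mono fun y => ?_)
    rw [enorm_mul, ← mul_assoc]
    exact mul_le_mul_left (H D _ _ _ _ (hf.slice y) hφ hD (h1 rfl)) _
  calc _ ≤ _ := mul_le_mul_right (mul_le_mul_right h3 _) _
    _ = _ := by rw [canc]; ring

lemma av_meas {g : RR → EN} (hg : Measurable g) (k m : ℤ) : Measurable (fun y => av k m (fun x => g (x,y))) := by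
  unfold av
  exact ((hg.comp measurable_swap).lintegral_prod_right' (ν := volume.restrict (Dy k m))).const_mul _

lemma ptMM (D : EN) (n1 n2 : ℤ) (f : RR → ℂ) (a : Rc → EN) (hD : D ≠ ⊤) (hf : Nice f) {sx sy : Bool} (ha : HypF D n1 n2 sx sy f a) (r) :
    a r ≤ 2 * D^2 * ∑' s, wd 3 s * av r.2.1 (r.2.2+n2+s) (fun y => ∑' t, wd 3 t * av r.1.1 (r.1.2+n1+t) (fun x => ‖f (x,y)‖ₑ)) := by
  obtain ⟨φ, ψ, hφ, hψ, h1, h2, h⟩ := ha r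
  refine h.trans ?_
  rw [fub2 hf hφ hD hψ hD]
  have hm : Measurable (fun y => ∑' t, wd 3 t * av r.1.1 (r.1.2+n1+t) (fun x => ‖f (x,y)‖ₑ)) :=
    Measurable.ennreal_tsum fun t => (av_meas hf.meas.enorm _ _).const_mul _
  have h3 : ‖∫ y, (∫ x, f (x,y) * φ x) * ψ y‖ₑ ≤ D * 2^r.1.1 * (D * 2^r.2.1 * ∑' s, wd 3 s * av r.2.1 (r.2.2+n2+s) (fun y => ∑' t, wd 3 t * av r.1.1 (r.1.2+n1+t) (fun x => ‖f (x,y)‖ₑ))) := by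
    refine le_trans ?_ (mul_le_mul_right (TAIL hψ hm) _)
    rw [← lintegral_const_mul' _ _ (mul_ne_top hD (zp_netop _))]
    refine (enorm_integral_le_lintegral_enorm _).trans (lintegral_mono fun y => ?_)
    rw [enorm_mul, ← mul_assoc]
    refine mul_le_mul_left ((enorm_integral_le_lintegral_enorm _).trans ?_) _
    simp_rw [enorm_mul]
    exact TAIL hφ (hf.meas.comp (measurable_id.prodMk measurable_const)).enorm
  calc _ ≤ _ := mul_le_mul_right (mul_le_mul_right h3 _) _
    _ = _ := by rw [canc]; ring

theorem thSS {p : ℝ} (hp : 1 < p) : ∃ C : EN, C ≠ ⊤ ∧ ∀ (D : EN) (n1 n2 : ℤ) (f : RR → ℂ) (a : Rc → EN), D ≠ ⊤ → Nice f → HypF D n1 n2 true true f a →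
    XN p volume (fun (i : ℤ × ℤ) => AC a i.1 i.2) ≤ C * D^2 * kap n1 * kap n2 * Nm p volume (fun z => ‖f z‖ₑ) := by
  obtain ⟨C0, hC0, H0⟩ := ptSS
  obtain ⟨C1, hC1, H1⟩ := MAT hp
  obtain ⟨C2, hC2, H2⟩ := VV hp
  obtain ⟨C3, hC3, H3⟩ := DXN hp
  refine ⟨C0 * C1 * C1 * C2 * C3, by finiteness, fun D n1 n2 f a hD hf ha => ?_⟩
  have hp0 : 0 < p := by linarith
  set e : ℤ → ℤ → ℤ → ℤ → EN := fun k m k' m' => ‖dd k' m' (DX f k m)‖ₑ with he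
  set u : ℤ → ℤ → ℤ → ℤ → EN := fun k2 m2 k m => KK (e k m) k2 (m2 + n2) with hu
  have m1 : ∀ i : ℤ × ℤ, Measurable (fun z : RR => KK (u i.1 (fl i.1 z.2)) i.2 (fl i.2 z.1 + n1)) := fun i => cell2 i.2 i.1 (fun m m' => KK (u i.1 m') i.2 (m + n1))
  have m2 : ∀ i : ℤ × ℤ, Measurable (fun z : RR => u i.1 (fl i.1 z.2) i.2 (fl i.2 z.1)) := fun i => cell2 i.2 i.1 (fun m m' => u i.1 m' i.2 m)
  have m3 : ∀ i : ℤ × ℤ, Measurable (fun z : RR => u i.2 (fl i.2 z.2) i.1 (fl i.1 z.1)) := fun i => cell2 i.1 i.2 (fun m m' => u i.2 m' i.1 m)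
  have m4 : ∀ i : ℤ × ℤ, Measurable (fun z : RR => e i.1 (fl i.1 z.1) i.2 (fl i.2 z.2)) := fun i => cell2 i.1 i.2 (fun m m' => e i.1 m i.2 m')
  have m5 : ∀ k : ℤ, Measurable (fun z : RR => ‖DX f k (fl k z.1) z.2‖ₑ) := fun k => cellX k fun m => (DX_meas hf k m).enorm
  have s1 : XN p volume (fun (i : ℤ × ℤ) => AC a i.1 i.2) ≤ C0 * D^2 * XN p volume (fun (i : ℤ × ℤ) (z : RR) => KK (u i.1 (fl i.1 z.2)) i.2 (fl i.2 z.1 + n1)) := by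
    rw [← XN_const_mul hp0]
    · have : XN p volume (fun (i : ℤ × ℤ) => AC a i.1 i.2) = XN p volume (fun (i : ℤ × ℤ) => AC a i.2 i.1) := by
        unfold XN; congr 1; ext z
        exact (l2_equiv (Equiv.prodComm ℤ ℤ) (fun i => AC a i.1 i.2 z)).symm
      rw [this]
      refine XN_mono hp0 fun i z => ?_
      exact H0 D n1 n2 f a hD hf ha ((i.2, fl i.2 z.1), (i.1, fl i.1 z.2))
    · exact m1
  have s2 : XN p volume (fun (i : ℤ × ℤ) (z : RR) => KK (u i.1 (fl i.1 z.2)) i.2 (fl i.2 z.1 + n1)) ≤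
      C1 * kap n1 * XN p volume (fun (i : ℤ × ℤ) (z : RR) => u i.1 (fl i.1 z.2) i.2 (fl i.2 z.1)) := by
    refine XN_sliceX hp0 m1 m2
      (mul_ne_top hC1 (kap_netop _)) fun y => ?_
    exact H1 ℤ inferInstance n1 (fun k2 => u k2 (fl k2 y))
  have s3 : XN p volume (fun (i : ℤ × ℤ) (z : RR) => u i.1 (fl i.1 z.2) i.2 (fl i.2 z.1)) ≤
      C1 * kap n2 * XN p volume (fun (i : ℤ × ℤ) (z : RR) => e i.1 (fl i.1 z.1) i.2 (fl i.2 z.2)) := by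
    have : XN p volume (fun (i : ℤ × ℤ) (z : RR) => u i.1 (fl i.1 z.2) i.2 (fl i.2 z.1)) = XN p volume (fun (i : ℤ × ℤ) (z : RR) => u i.2 (fl i.2 z.2) i.1 (fl i.1 z.1)) := by
      unfold XN; congr 1; ext z
      exact (l2_equiv (Equiv.prodComm ℤ ℤ) (fun i => u i.1 (fl i.1 z.2) i.2 (fl i.2 z.1))).symm
    rw [this]
    refine XN_sliceY hp0 m3 m4
      (mul_ne_top hC1 (kap_netop _)) fun x => ?_
    exact H1 ℤ inferInstance n2 (fun k1 => e k1 (fl k1 x))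
  have s4 : XN p volume (fun (i : ℤ × ℤ) (z : RR) => e i.1 (fl i.1 z.1) i.2 (fl i.2 z.2)) ≤ C2 * XN p volume (fun (k : ℤ) (z : RR) => ‖DX f k (fl k z.1) z.2‖ₑ) := by
    refine XN_sliceY hp0 m4 m5 hC2 fun x => ?_
    exact H2 ℤ inferInstance (fun k y => DX f k (fl k x) y) (fun k => DX_int hf _ _) (fun k => DX_meas hf _ _)
  calc _ ≤ C0 * D^2 * (C1 * kap n1 * (C1 * kap n2 * (C2 * (C3 * Nm p volume (fun z => ‖f z‖ₑ))))) := by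
        refine s1.trans ?_; gcongr; refine s2.trans ?_; gcongr; refine s3.trans ?_; gcongr; refine s4.trans ?_; gcongr; exact H3 f hf
    _ = _ := by ring

lemma Mx_joint {g : RR → EN} (hg : Measurable g) (s : ℤ) : Measurable (fun z : RR => Mx s (fun x => g (x, z.2)) z.1) := by
  unfold Mx
  exact Measurable.iSup fun k => cellX k (c := fun m y => av k (m+s) (fun x => g (x,y))) fun m => av_meas hg _ _

lemma Mx_joint' {g : RR → EN} (hg : Measurable g) (s : ℤ) : Measurable (fun z : RR => Mx s (fun y => g (z.1, y)) z.2) := by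
  have hs : Measurable (fun z : RR => (z.2, z.1)) := measurable_snd.prodMk measurable_fst
  have h1 : Measurable (fun z : RR => g (z.2, z.1)) := hg.comp hs
  have h := Mx_joint h1 s
  have h2 := h.comp hs
  simpa only [Function.comp_def] using h2

theorem thSM {p : ℝ} (hp : 1 < p) : ∃ C : EN, C ≠ ⊤ ∧ ∀ (D : EN) (n1 n2 : ℤ) (f : RR → ℂ) (a : Rc → EN), D ≠ ⊤ → Nice f → HypF D n1 n2 true false f a →
    XN p volume (fun (k1 : ℤ) z => ⨆ k2, AC a k1 k2 z) ≤ C * D^2 * kap n1 * kap n2 * Nm p volume (fun z => ‖f z‖ₑ) := by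
  obtain ⟨C0, hC0, H0⟩ := ptSM
  obtain ⟨C1, hC1, H1⟩ := MAT hp
  obtain ⟨C2, hC2, H2⟩ := MT hp
  obtain ⟨C3, hC3, H3⟩ := DXN hp
  refine ⟨C0 * C1 * C2 * C3, by finiteness, fun D n1 n2 f a hD hf ha => ?_⟩
  have hp0 : 0 < p := by linarith
  set Y : ℤ → ℤ → ℝ → EN := fun k m y => KK (fun k m => ‖DX f k m y‖ₑ) k (m + n1) with hY
  have hYm : ∀ k m, Measurable (Y k m) := fun k m => KK_meas (fun k m => (DX_meas hf k m).enorm) _ _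
  have hYm2 : ∀ k, Measurable (fun z : RR => Y k (fl k z.1) z.2) := fun k => cellX k (hYm k)
  have hm : ∀ k, Measurable (fun z : RR => ∑' s, wd 3 s * Mx (n2+s) (Y k (fl k z.1)) z.2) := fun k =>
    Measurable.ennreal_tsum fun s => (Mx_joint' (hYm2 k) _).const_mul _
  have s1 : XN p volume (fun (k1 : ℤ) z => ⨆ k2, AC a k1 k2 z) ≤ C0 * D^2 * XN p volume (fun (k : ℤ) (z : RR) => ∑' s, wd 3 s * Mx (n2+s) (Y k (fl k z.1)) z.2) := by
    rw [← XN_const_mul hp0 hm]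
    refine XN_mono hp0 fun k z => iSup_le fun k2 => ?_
    refine (H0 D n1 n2 f a hD hf ha ((k, fl k z.1), (k2, fl k2 z.2))).trans ?_
    refine mul_le_mul_right (ENNReal.tsum_le_tsum fun s => mul_le_mul_right ?_ _) _
    rw [add_assoc]; exact av_le_Mx _ _ _ _
  have s2 : XN p volume (fun (k : ℤ) (z : RR) => ∑' s, wd 3 s * Mx (n2+s) (Y k (fl k z.1)) z.2) ≤ C2 * kap n2 * XN p volume (fun (k : ℤ) (z : RR) => Y k (fl k z.1) z.2) := by
    refine XN_sliceY hp0 hm hYm2 (mul_ne_top hC2 (kap_netop _)) fun x => ?_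
    exact H2 ℤ inferInstance n2 (fun k => Y k (fl k x)) (fun k => hYm _ _)
  have s3 : XN p volume (fun (k : ℤ) (z : RR) => Y k (fl k z.1) z.2) ≤ C1 * kap n1 * XN p volume (fun (k : ℤ) (z : RR) => ‖DX f k (fl k z.1) z.2‖ₑ) := by
    refine XN_sliceX hp0 hYm2 (fun k => cellX k fun m => (DX_meas hf k m).enorm) (mul_ne_top hC1 (kap_netop _)) fun y => ?_
    have := H1 Unit inferInstance n1 (fun _ k m => ‖DX f k m y‖ₑ)
    unfold XN at this ⊢
    refine le_trans (le_of_eq ?_) (this.trans (le_of_eq ?_))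
    · congr 1; ext x
      exact (l2_equiv (Equiv.punitProd ℤ) (fun k => Y k (fl k x) y)).symm
    · congr 2; ext x
      exact (l2_equiv (Equiv.punitProd ℤ) (fun k => ‖DX f k (fl k x) y‖ₑ))
  calc _ ≤ C0 * D^2 * (C2 * kap n2 * (C1 * kap n1 * (C3 * Nm p volume (fun z => ‖f z‖ₑ)))) := by
        refine s1.trans ?_; gcongr; refine s2.trans ?_; gcongr; refine s3.trans ?_; gcongr; exact H3 f hf
    _ = _ := by ring

theorem thMM {p : ℝ} (hp : 1 < p) : ∃ C : EN, C ≠ ⊤ ∧ ∀ (D : EN) (n1 n2 : ℤ) (f : RR → ℂ) (a : Rc → EN), D ≠ ⊤ → Nice f → HypF D n1 n2 false false f a →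
    Nm p volume (fun z => ⨆ k1, ⨆ k2, AC a k1 k2 z) ≤ C * D^2 * kap n1 * kap n2 * Nm p volume (fun z => ‖f z‖ₑ) := by
  obtain ⟨C2, hC2, H2⟩ := MT hp
  refine ⟨2 * C2 * C2, by finiteness, fun D n1 n2 f a hD hf ha => ?_⟩
  have hp0 : 0 < p := by linarith
  set Y : RR → EN := fun z => ∑' t, wd 3 t * Mx (n1+t) (fun x => ‖f (x,z.2)‖ₑ) z.1 with hY
  have hYm : Measurable Y := Measurable.ennreal_tsum fun s => (Mx_joint hf.meas.enorm _).const_mul _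
  have hm : Measurable (fun z : RR => ∑' s, wd 3 s * Mx (n2+s) (fun y => Y (z.1,y)) z.2) := Measurable.ennreal_tsum fun s => (Mx_joint' hYm _).const_mul _
  have s1 : Nm p volume (fun z => ⨆ k1, ⨆ k2, AC a k1 k2 z) ≤ 2 * D^2 * Nm p volume (fun z : RR => ∑' s, wd 3 s * Mx (n2+s) (fun y => Y (z.1,y)) z.2) := by
    rw [← Nm_const_mul hp0 hm.aemeasurable]
    refine Nm_mono hp0 fun z => iSup_le fun k1 => iSup_le fun k2 => ?_
    refine (ptMM D n1 n2 f a hD hf ha ((k1, fl k1 z.1), (k2, fl k2 z.2))).trans ?_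
    refine mul_le_mul_right (ENNReal.tsum_le_tsum fun s => mul_le_mul_right ?_ _) _
    rw [add_assoc]
    refine le_trans (av_mono fun y => ?_) (av_le_Mx _ _ _ _)
    refine ENNReal.tsum_le_tsum fun s => mul_le_mul_right ?_ _
    simp only [add_assoc]
    exact av_le_Mx _ _ _ _
  have s2 : Nm p volume (fun z : RR => ∑' s, wd 3 s * Mx (n2+s) (fun y => Y (z.1,y)) z.2) ≤ C2 * kap n2 * Nm p volume Y := by
    refine Nm_sliceY hp0 hm hYm (mul_ne_top hC2 (kap_netop _)) fun x => ?_
    have := H2 Unit inferInstance n2 (fun _ y => Y (x,y)) (fun _ => hYm.comp (measurable_const.prodMk measurable_id))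
    rwa [XN_single, XN_single] at this
  have s3 : Nm p volume Y ≤ C2 * kap n1 * Nm p volume (fun z => ‖f z‖ₑ) := by
    refine Nm_sliceX hp0 hYm hf.meas.enorm (mul_ne_top hC2 (kap_netop _)) fun y => ?_
    have := H2 Unit inferInstance n1 (fun _ x => ‖f (x,y)‖ₑ) (fun _ => (hf.meas.comp (measurable_id.prodMk measurable_const)).enorm)
    rwa [XN_single, XN_single] at this
  calc _ ≤ 2 * D^2 * (C2 * kap n2 * (C2 * kap n1 * Nm p volume (fun z => ‖f z‖ₑ))) := by
        refine s1.trans ?_; gcongr; refine s2.trans ?_; gcongr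
    _ = _ := by ring

noncomputable def XX (b : Bool) (B : ℤ → EN) : EN := if b = true then l2 B else ⨆ k, B k
noncomputable def FF (sx sy : Bool) (A : ℤ → ℤ → EN) : EN := XX sx (fun k1 => XX sy (fun k2 => A k1 k2))

lemma Nm_swap {p : ℝ} {F : RR → EN} : Nm p volume (fun z : RR => F z.swap) = Nm p volume F := by
  unfold Nm
  rw [Measure.volume_eq_prod, lintegral_prod_swap (fun z => F z ^ p)]

lemma HypF.swap {D : EN} {n1 n2 : ℤ} {sx sy : Bool} {f : RR → ℂ} {a : Rc → EN} (h : HypF D n1 n2 sx sy f a) :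
    HypF D n2 n1 sy sx (fun z => f z.swap) (fun r => a (r.2, r.1)) := by
  intro r
  obtain ⟨φ, ψ, h1, h2, h3, h4, h5⟩ := h (r.2, r.1)
  refine ⟨ψ, φ, h2, h1, h4, h3, h5.trans (le_of_eq ?_)⟩
  have : ∫ z : RR, f z * (φ z.1 * ψ z.2) = ∫ z : RR, f z.swap * (ψ z.1 * φ z.2) := by
    rw [Measure.volume_eq_prod, ← integral_prod_swap]
    congr 1; ext z; simp only [Prod.fst_swap, Prod.snd_swap]; ring
  rw [this]; ring

theorem thNice {p : ℝ} (hp : 1 < p) : ∃ C : EN, C ≠ ⊤ ∧ ∀ (sx sy : Bool) (D : EN) (n1 n2 : ℤ) (f : RR → ℂ) (a : Rc → EN), D ≠ ⊤ → Nice f → HypF D n1 n2 sx sy f a →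
    Nm p volume (fun z => FF sx sy (fun k1 k2 => AC a k1 k2 z)) ≤ C * D^2 * kap n1 * kap n2 * Nm p volume (fun z => ‖f z‖ₑ) := by
  obtain ⟨C1, hC1, H1⟩ := thSS hp
  obtain ⟨C2, hC2, H2⟩ := thSM hp
  obtain ⟨C3, hC3, H3⟩ := thMM hp
  have hp0 : 0 < p := by linarith
  refine ⟨C1 + C2 + C3, by finiteness, fun sx sy D n1 n2 f a hD hf ha => ?_⟩
  have b1 : C1 ≤ C1 + C2 + C3 := by rw [add_assoc]; exact le_self_add
  have b2 : C2 ≤ C1 + C2 + C3 := by rw [add_comm C1, add_assoc]; exact le_self_add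
  have b3 : C3 ≤ C1 + C2 + C3 := le_add_self
  cases sx <;> cases sy <;> simp only [FF, XX, if_true, Bool.false_eq_true, if_false]
  · refine (H3 D n1 n2 f a hD hf ha).trans ?_; gcongr
  · have h := H2 D n2 n1 _ _ hD hf.swap ha.swap
    have e : Nm p volume (fun z : RR => ‖f z.swap‖ₑ) = Nm p volume (fun z => ‖f z‖ₑ) := Nm_swap (F := fun z => ‖f z‖ₑ)
    rw [e] at h
    rw [← Nm_swap]
    calc _ ≤ C2 * D^2 * kap n2 * kap n1 * Nm p volume (fun z => ‖f z‖ₑ) := by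
          refine le_trans (Nm_mono hp0 fun z => ?_) h
          refine iSup_le fun k1 => l2_mono fun k2 => ?_
          exact le_iSup (fun k1 => AC (fun r => a (r.2, r.1)) k2 k1 z) k1
      _ = C2 * D^2 * kap n1 * kap n2 * Nm p volume (fun z => ‖f z‖ₑ) := by ring
      _ ≤ _ := by gcongr
  · refine (H2 D n1 n2 f a hD hf ha).trans ?_; gcongr
  · refine le_trans (le_of_eq ?_) ((H1 D n1 n2 f a hD hf ha).trans ?_)
    · unfold XN; congr 1; ext z; exact l2_l2 _
    · gcongr

lemma Ad_zero (D : EN) (k q : ℤ) : Ad D k q (fun _ => 0) := ⟨measurable_const, fun x => by simp, fun j x y h => by simp⟩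

def SN (f : RR → ℂ) (N : ℕ) : Set (RR) := {z | ‖f z‖ ≤ N ∧ |z.1| ≤ N ∧ |z.2| ≤ N}

lemma SN_meas {f : RR → ℂ} (hf : Measurable f) (N : ℕ) : MeasurableSet (SN f N) :=
  (measurableSet_le hf.norm measurable_const).inter ((measurableSet_le (measurable_fst.norm) measurable_const).inter
    (measurableSet_le (measurable_snd.norm) measurable_const))

lemma SN_nice {f : RR → ℂ} (hf : Measurable f) (N : ℕ) : Nice ((SN f N).indicator f) := by
  refine ⟨hf.indicator (SN_meas hf N), N, by positivity, fun z => ?_, fun z hz => ?_⟩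
  · by_cases h : z ∈ SN f N
    · rw [Set.indicator_of_mem h]; exact h.1
    · rw [Set.indicator_of_notMem h]; simp
  · have : z ∈ SN f N := by by_contra h; exact hz (Set.indicator_of_notMem h _)
    exact this.2

lemma SN_ev {f : RR → ℂ} (hf : Measurable f) (g : RR → ℂ) : ∀ᶠ N : ℕ in atTop, ‖∫ z, f z * g z‖ₑ ≤ 2 * ‖∫ z, (SN f N).indicator f z * g z‖ₑ := by
  by_cases h0 : ∫ z, f z * g z = 0
  · simp [h0]
  have hi : Integrable (fun z => f z * g z) := by by_contra h; exact h0 (integral_undef h)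
  have e : ∀ N z, (SN f N).indicator f z * g z = (SN f N).indicator (fun z => f z * g z) z := fun N z => by
    by_cases h : z ∈ SN f N <;> simp [h]
  simp_rw [e]
  have hlim : Tendsto (fun N : ℕ => ∫ z, (SN f N).indicator (fun z => f z * g z) z) atTop (𝓝 (∫ z, f z * g z)) := by
    refine tendsto_integral_of_dominated_convergence (fun z => ‖f z * g z‖) (fun N => (hi.indicator (SN_meas hf N)).aestronglyMeasurable) hi.norm
      (fun N => ae_of_all _ fun z => norm_indicator_le_norm_self _ _) (ae_of_all _ fun z => ?_)
    refine tendsto_const_nhds.congr' ?_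
    obtain ⟨N0, hN0⟩ := exists_nat_ge (max ‖f z‖ (max |z.1| |z.2|))
    filter_upwards [eventually_ge_atTop N0] with N hN
    have hN' : (N0:ℝ) ≤ N := by exact_mod_cast hN
    have : z ∈ SN f N := ⟨(le_max_left _ _).trans (hN0.trans hN'), ((le_max_left _ _).trans (le_max_right _ _)).trans (hN0.trans hN'),
      ((le_max_right _ _).trans (le_max_right _ _)).trans (hN0.trans hN')⟩
    simp [this]
  have h2 := hlim.norm
  have : ‖∫ z, f z * g z‖ / 2 < ‖∫ z, f z * g z‖ := half_lt_self (norm_pos_iff.mpr h0)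
  filter_upwards [h2.eventually (lt_mem_nhds this)] with N hN
  rw [← ofReal_norm, ← ofReal_norm, show (2:EN) = oR 2 by simp, ← ofReal_mul (by norm_num)]
  apply ofReal_le_ofReal
  linarith

def HypG (𝓡 : Finset Rc) (D : EN) (n1 n2 : ℤ) (sx sy : Bool) (f : RR → ℂ) (a : Rc → EN) : Prop :=
  (∀ r ∈ 𝓡, ∃ φ ψ : ℝ → ℂ, Ad D r.1.1 (r.1.2+n1) φ ∧ Ad D r.2.1 (r.2.2+n2) ψ ∧ (sx = true → ∫ x, φ x = 0) ∧ (sy = true → ∫ x, ψ x = 0) ∧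
    a r ≤ 2^(-r.1.1) * 2^(-r.2.1) * ‖∫ z, f z * (φ z.1 * ψ z.2)‖ₑ) ∧ ∀ r, r ∉ 𝓡 → a r = 0

theorem THF {p : ℝ} (hp : 1 < p) : ∃ C : EN, C ≠ ⊤ ∧ ∀ (𝓡 : Finset Rc) (sx sy : Bool) (D : EN) (n1 n2 : ℤ) (f : RR → ℂ) (a : Rc → EN),
    D ≠ ⊤ → AEStronglyMeasurable f volume → HypG 𝓡 D n1 n2 sx sy f a →
    Nm p volume (fun z => FF sx sy (fun k1 k2 => AC a k1 k2 z)) ≤ C * D^2 * kap n1 * kap n2 * Nm p volume (fun z => ‖f z‖ₑ) := by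
  obtain ⟨C, hC, H⟩ := thNice hp
  refine ⟨C, hC, fun 𝓡 sx sy D n1 n2 f a hD hfa ha => ?_⟩
  obtain ⟨ha1, ha2⟩ := ha
  choose! φ ψ h1 h2 h3 h4 h5 using ha1
  set f0 := hfa.mk f with hf0
  have hm : Measurable f0 := hfa.stronglyMeasurable_mk.measurable
  have hae : f =ᵐ[volume] f0 := hfa.ae_eq_mk
  have hev : ∀ᶠ N : ℕ in atTop, ∀ r ∈ 𝓡, ‖∫ z, f0 z * (φ r z.1 * ψ r z.2)‖ₑ ≤ 2 * ‖∫ z, (SN f0 N).indicator f0 z * (φ r z.1 * ψ r z.2)‖ₑ :=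
    (eventually_all_finset 𝓡).2 fun r _ => SN_ev hm _
  obtain ⟨N, hN⟩ := hev.exists
  have hF : HypF D n1 n2 sx sy ((SN f0 N).indicator f0) a := by
    intro r
    by_cases hr : r ∈ 𝓡
    · refine ⟨φ r, ψ r, h1 r hr, h2 r hr, h3 r hr, h4 r hr, (h5 r hr).trans ?_⟩
      have : ∫ z, f z * (φ r z.1 * ψ r z.2) = ∫ z, f0 z * (φ r z.1 * ψ r z.2) := integral_congr_ae (by filter_upwards [hae] with z hz; rw [hz])
      rw [this]
      calc _ ≤ _ := mul_le_mul_right (hN r hr) _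
        _ = _ := by ring
    · exact ⟨fun _ => 0, fun _ => 0, Ad_zero _ _ _, Ad_zero _ _ _, by simp, by simp, by rw [ha2 r hr]; exact zero_le⟩
  refine (H sx sy D n1 n2 _ a hD (SN_nice hm N) hF).trans (mul_le_mul_right ?_ _)
  refine Nm_mono_ae (by linarith) ?_
  filter_upwards [hae] with z hz
  rw [hz]
  exact enorm_indicator_le_enorm_self _ _

structure AdS (S : ℕ) (D : EN) (k q : ℤ) (φ : ℝ → ℂ) : Prop where
  meas : Measurable φ
  bd : ∀ x, ‖φ x‖ₑ ≤ D * wd (5+S) (fl k x - q)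
  lip : ∀ (j : ℕ) (x y : ℝ), fl (k-j) x = fl (k-j) y → ‖φ x - φ y‖ₑ ≤ D * wd (5+S) (fl k x - q) * (2⁻¹)^j

lemma AdS.conj {S : ℕ} {D : EN} {k q : ℤ} {φ : ℝ → ℂ} (h : AdS S D k q φ) : AdS S D k q (fun x => (starRingEnd ℂ) (φ x)) := by
  have e : ∀ z : ℂ, ‖(starRingEnd ℂ) z‖ₑ = ‖z‖ₑ := fun z => by rw [← ofReal_norm, ← ofReal_norm]; simp
  refine ⟨Complex.continuous_conj.measurable.comp h.meas, fun x => ?_, fun j x y hxy => ?_⟩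
  · rw [e]; exact h.bd x
  · rw [← map_sub, e]; exact h.lip j x y hxy

lemma wd_ofReal (a : ℕ) (s : ℤ) : wd a s = oR (((1 + |(s:ℝ)|)^a)⁻¹) := by
  unfold wd
  rw [ofReal_inv_of_pos (by positivity), ofReal_pow (by positivity)]
  congr 2
  rw [show 1 + |(s:ℝ)| = ((1 + s.natAbs : ℕ) : ℝ) by push_cast [Nat.cast_natAbs]; rfl, ofReal_natCast]

lemma dist_lb (k q : ℤ) (x : ℝ) : (1 + |((fl k x - q : ℤ) : ℝ)|) / 2 ≤ 1 + Metric.infDist x (Set.Icc ((2:ℝ)^k * q) ((2:ℝ)^k * q + 2^k)) / 2^k := by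
  have hk : (0:ℝ) < 2^k := by positivity
  set s := fl k x - q with hs
  have hx1 : (2:ℝ)^k * (q + s) ≤ x ∧ x < (2:ℝ)^k * (q + s + 1) := by
    have : x ∈ Dy k (q+s) := by simp [Dy, hs]
    rw [Dy_eq] at this; push_cast at this; exact this
  have hne : (Set.Icc ((2:ℝ)^k * q) ((2:ℝ)^k * q + 2^k)).Nonempty := Set.nonempty_Icc.2 (by linarith)
  have h0 : 0 ≤ Metric.infDist x (Set.Icc ((2:ℝ)^k * q) ((2:ℝ)^k * q + 2^k)) := Metric.infDist_nonneg
  have key : 2^k * (|(s:ℝ)| - 1) ≤ Metric.infDist x (Set.Icc ((2:ℝ)^k * q) ((2:ℝ)^k * q + 2^k)) := by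
    rw [Metric.le_infDist hne]
    intro y hy
    rw [Real.dist_eq]
    rcases le_total 0 (s:ℝ) with h | h
    · rw [abs_of_nonneg h]; refine le_trans ?_ (le_abs_self _); nlinarith [hy.1, hy.2, hx1.1]
    · rw [abs_of_nonpos h]; refine le_trans ?_ (neg_le_abs _); nlinarith [hy.1, hy.2, hx1.2]
  have h2 : |(s:ℝ)| - 1 ≤ Metric.infDist x (Set.Icc ((2:ℝ)^k * q) ((2:ℝ)^k * q + 2^k)) / 2^k := by
    rw [le_div_iff₀ hk]; linarith
  have h3 : 0 ≤ Metric.infDist x (Set.Icc ((2:ℝ)^k * q) ((2:ℝ)^k * q + 2^k)) / 2^k := by positivity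
  by_cases h : |(s:ℝ)| ≤ 1 <;> linarith

lemma bump_AdS {Cad : ℕ → ℝ} {k q : ℤ} {φ : ℝ → ℂ} (h : IsBumpAdapted Cad ((2:ℝ)^k * (q:ℝ)) ((2:ℝ)^k) φ) (S : ℕ) :
    AdS S (oR (Cad (5+S) * 2^(5+S))) k q φ := by
  obtain ⟨hsm, hb⟩ := h
  have hk : (0:ℝ) < 2^k := by positivity
  have hmain : ∀ α : ℕ, α ≤ 5 → ∀ x, ‖iteratedDeriv α φ x‖ * (2^k)^α ≤ Cad (5+S) * 2^(5+S) * ((1 + |((fl k x - q : ℤ):ℝ)|)^(5+S))⁻¹ := by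
    intro α hα x
    have h1 := hb α hα (5+S) x
    have h2 := dist_lb k q x
    have h3 : ((1 + |((fl k x - q : ℤ):ℝ)|)/2)^(5+S) ≤ (1 + Metric.infDist x (Set.Icc ((2:ℝ)^k * q) ((2:ℝ)^k * q + 2^k)) / 2^k)^(5+S) := by gcongr
    have h4 : ‖iteratedDeriv α φ x‖ * (2^k)^α * ((1 + |((fl k x - q : ℤ):ℝ)|)/2)^(5+S) ≤ Cad (5+S) := (mul_le_mul_of_nonneg_left h3 (by positivity)).trans h1
    rw [← div_eq_mul_inv, le_div_iff₀ (by positivity)]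
    rw [div_pow, mul_div_assoc', div_le_iff₀ (by positivity)] at h4
    exact h4
  have hbd : ∀ x, ‖φ x‖ₑ ≤ oR (Cad (5+S) * 2^(5+S)) * wd (5+S) (fl k x - q) := by
    intro x
    have := hmain 0 (by norm_num) x
    simp only [iteratedDeriv_zero, pow_zero, mul_one] at this
    rw [wd_ofReal, ← ofReal_mul' (by positivity), ← ofReal_norm]
    exact ofReal_le_ofReal this
  refine ⟨hsm.continuous.measurable, hbd, fun j x y hxy => ?_⟩
  have hfl : ∀ u, u ∈ Dy (k-j) (fl (k-j) x) → fl k u = fl k x := by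
    intro u hu
    have e := fl_add (k-j) j u
    have e' := fl_add (k-j) j x
    rw [sub_add_cancel] at e e'
    rw [e, e', show fl (k-j) u = fl (k-j) x from hu]
  have hdiff : ∀ u ∈ Dy (k-j) (fl (k-j) x), DifferentiableAt ℝ φ u := fun u _ => (hsm.differentiable (by norm_num)).differentiableAt
  have hder : ∀ u ∈ Dy (k-j) (fl (k-j) x), ‖deriv φ u‖ ≤ Cad (5+S) * 2^(5+S) * ((1 + |((fl k x - q : ℤ):ℝ)|)^(5+S))⁻¹ * ((2:ℝ)^k)⁻¹ := by
    intro u hu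
    have := hmain 1 (by norm_num) u
    rw [iteratedDeriv_one, pow_one, hfl u hu] at this
    rw [← div_eq_mul_inv _ ((2:ℝ)^k), le_div_iff₀ hk]; exact this
  have hconv : Convex ℝ (Dy (k-j) (fl (k-j) x)) := by rw [Dy_eq]; exact convex_Ico _ _
  have hy : y ∈ Dy (k-j) (fl (k-j) x) := hxy.symm
  have hx : x ∈ Dy (k-j) (fl (k-j) x) := rfl
  have hmv := hconv.norm_image_sub_le_of_norm_deriv_le hdiff hder hy hx
  have hdist : ‖x - y‖ ≤ 2^(k-j) := by
    rw [Dy_eq] at hx hy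
    have := hx.1; have := hx.2; have := hy.1; have := hy.2
    rw [Real.norm_eq_abs, abs_le]; constructor <;> nlinarith
  have hge : 0 ≤ Cad (5+S) * 2^(5+S) * ((1 + |((fl k x - q : ℤ):ℝ)|)^(5+S))⁻¹ := le_trans (by positivity) (hmain 0 (by norm_num) x)
  have hfin : ‖φ x - φ y‖ ≤ Cad (5+S) * 2^(5+S) * ((1 + |((fl k x - q : ℤ):ℝ)|)^(5+S))⁻¹ * (2⁻¹)^j := by
    refine hmv.trans ((mul_le_mul_of_nonneg_left hdist (by positivity)).trans (le_of_eq ?_))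
    rw [mul_assoc]; congr 1
    rw [zpow_sub₀ (by norm_num), zpow_natCast]; field_simp; simp
  rw [wd_ofReal, ← ofReal_mul' (by positivity), ← ofReal_norm]
  have e2 : ((2:EN)⁻¹)^j = oR ((2⁻¹)^j) := by rw [ofReal_pow (by norm_num), ofReal_inv_of_pos (by norm_num)]; simp
  rw [e2, ← ofReal_mul' (by positivity)]
  exact ofReal_le_ofReal hfin

lemma AdS.toAd {S : ℕ} {D : EN} {k q : ℤ} {φ : ℝ → ℂ} (h : AdS S D k q φ) : Ad D k q φ :=
  ⟨h.meas, fun x => (h.bd x).trans (mul_le_mul_right (wd_mono (by omega) _) _),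
    fun j x y hxy => (h.lip j x y hxy).trans (mul_le_mul_left (mul_le_mul_right (wd_mono (by omega) _) _) _)⟩

lemma Ad.mono {D D' : EN} {k q : ℤ} {φ : ℝ → ℂ} (h : Ad D k q φ) (hD : D ≤ D') : Ad D' k q φ :=
  ⟨h.meas, fun x => (h.bd x).trans (mul_le_mul_left hD _),
    fun j x y hxy => (h.lip j x y hxy).trans (mul_le_mul_left (mul_le_mul_left hD _) _)⟩

/-- multiply by function of cell -/
lemma AdS.cut {S : ℕ} {D : EN} {k q : ℤ} {φ : ℝ → ℂ} (h : AdS S D k q φ) (P : ℤ → Prop) [DecidablePred P] (E : EN) (hP : ∀ s, P s → wd S s ≤ E) :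
    Ad (D * E) k q (fun x => if P (fl k x - q) then φ x else 0) := by
  have hw : ∀ s, P s → D * wd (5+S) s ≤ D * E * wd 5 s := fun s hs => by
    rw [wd_add, mul_assoc]; refine mul_le_mul_right ?_ _; rw [mul_comm]; exact mul_le_mul_left (hP s hs) _
  refine ⟨?_, fun x => ?_, fun j x y hxy => ?_⟩
  · refine Measurable.ite ?_ h.meas measurable_const
    exact measurable_fl k (MeasurableSet.of_discrete (s := {m | P (m - q)}))
  · beta_reduce
    split_ifs with hs
    · exact (h.bd x).trans (hw _ hs)
    · simp
  · have hfl : fl k y = fl k x := by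
      have e := fl_add (k-j) j y
      have e' := fl_add (k-j) j x
      rw [sub_add_cancel] at e e'
      rw [e, e', hxy]
    beta_reduce
    rw [hfl]
    split_ifs with hs
    · exact (h.lip j x y hxy).trans (mul_le_mul_left (hw _ hs) _)
    · simp

lemma Ad.add {D D' : EN} {k q : ℤ} {φ ψ : ℝ → ℂ} (h : Ad D k q φ) (h' : Ad D' k q ψ) : Ad (D + D') k q (fun x => φ x + ψ x) := by
  refine ⟨h.meas.add h'.meas, fun x => ?_, fun j x y hxy => ?_⟩
  · rw [add_mul]; exact (enorm_add_le _ _).trans (add_le_add (h.bd x) (h'.bd x))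
  · rw [add_sub_add_comm, add_mul, add_mul]; exact (enorm_add_le _ _).trans (add_le_add (h.lip j x y hxy) (h'.lip j x y hxy))

lemma Ad_cell (k q : ℤ) (c : ℂ) : Ad ‖c‖ₑ k q (fun x => if fl k x - q = 0 then c else 0) := by
  refine ⟨?_, fun x => ?_, fun j x y hxy => ?_⟩
  · exact meas_cellC k (fun m => if m - q = 0 then c else 0)
  · beta_reduce
    split_ifs with hs
    · rw [hs]; simp [wd]
    · simp
  · have hfl : fl k y = fl k x := by
      have e := fl_add (k-j) j y
      have e' := fl_add (k-j) j x
      rw [sub_add_cancel] at e e'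
      rw [e, e', hxy]
    simp [hfl]

lemma split_bump (S : ℕ) : ∃ C : EN, C ≠ ⊤ ∧ 1 ≤ C ∧ ∀ (D : EN) (k q : ℤ) (φ : ℝ → ℂ) (b : Bool) (T : ℕ), AdS S D k q φ → D ≠ ⊤ → (b = true → ∫ x, φ x = 0) →
    ∃ φ1 φ2 : ℝ → ℂ, (∀ x, φ x = φ1 x + φ2 x) ∧ Ad (C * D) k q φ1 ∧ Ad (C * D * wd S T) k q φ2 ∧ (b = true → ∫ x, φ1 x = 0) ∧ (b = true → ∫ x, φ2 x = 0) ∧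
      ∀ x, T < (fl k x - q).natAbs → φ1 x = 0 := by
  set W := ∑' s, wd 2 s with hW
  refine ⟨1 + W, by simpa using wd_sum, le_self_add, fun D k q φ b T h hD hb => ?_⟩
  have hWT : wd S T ≤ 1 := wd_le_one _ _
  set g1 : ℝ → ℂ := fun x => if (fl k x - q).natAbs ≤ T then φ x else 0 with hg1
  set g2 : ℝ → ℂ := fun x => if T < (fl k x - q).natAbs then φ x else 0 with hg2
  have a1 : Ad (D * 1) k q g1 := h.cut (fun s => s.natAbs ≤ T) 1 (fun s _ => wd_le_one _ _)
  have a2 : Ad (D * wd S T) k q g2 := h.cut (fun s => T < s.natAbs) (wd S T) (fun s hs => wd_anti S (by simpa using hs.le))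
  have hsum : ∀ x, φ x = g1 x + g2 x := fun x => by
    simp only [hg1, hg2]; by_cases hx : (fl k x - q).natAbs ≤ T
    · simp [hx, not_lt.2 hx]
    · simp [hx, not_le.1 hx]
  have hD2 : D * wd S T ≠ ⊤ := mul_ne_top hD (ne_top_of_le_ne_top (by simp) hWT)
  cases b with
  | false =>
    refine ⟨g1, g2, hsum, a1.mono ?_, a2.mono ?_, by simp, by simp, fun x hx => ?_⟩
    · rw [mul_one]; exact le_mul_of_one_le_left' le_self_add
    · rw [mul_assoc]; exact le_mul_of_one_le_left' le_self_add
    · simp [hg1, not_le.2 hx]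
  | true =>
    have i1 : Integrable g1 := a1.integrable (by simpa using hD)
    have i2 : Integrable g2 := a2.integrable hD2
    have hz : (∫ x, g1 x) + ∫ x, g2 x = 0 := by
      rw [← hb rfl, ← integral_add i1 i2]; congr 1; ext x; exact (hsum x).symm
    set c : ℂ := ((2:ℝ)^(-k)) • ∫ x, g2 x with hc
    have hcn : ‖c‖ₑ ≤ W * D * wd S T := by
      rw [hc, enorm_smul, Real.enorm_eq_ofReal (by positivity), ofReal_two_zpow]
      have t := TAIL a2 (measurable_const (a := (1:EN)))
      simp only [one_mul, av_const, mul_one] at t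
      have t2 : ∑' s, wd 3 s ≤ W := ENNReal.tsum_le_tsum fun s => wd_mono (by norm_num) s
      calc _ ≤ 2^(-k) * (D * wd S T * 2^k * W) := mul_le_mul_right ((enorm_integral_le_lintegral_enorm _).trans (t.trans (mul_le_mul_right t2 _))) _
        _ = W * D * wd S T * (2^k * 2^(-k)) := by ring
        _ = _ := by rw [zp_mul', mul_one]
    have hci : ∀ c' : ℂ, Integrable (fun x => if fl k x - q = 0 then c' else 0) ∧ ∫ x, (if fl k x - q = 0 then c' else 0) = ((2:ℝ)^k) • c' := by
      intro c'
      refine ⟨(Ad_cell k q c').integrable (by simp), ?_⟩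
      have : (fun x => if fl k x - q = 0 then c' else 0) = (Dy k q).indicator (fun _ => c') := by
        ext x; simp only [Set.indicator, Dy, Set.mem_setOf_eq, sub_eq_zero]
      rw [this, integral_indicator (meas_Dy _ _), setIntegral_const, Measure.real, vol_Dy, ← ofReal_two_zpow, toReal_ofReal (by positivity)]
    have hcc : ((2:ℝ)^k) • c = ∫ x, g2 x := by
      rw [hc, smul_smul, ← zpow_add₀ (by norm_num)]; simp
    refine ⟨fun x => g1 x + (if fl k x - q = 0 then c else 0), fun x => g2 x + (if fl k x - q = 0 then -c else 0), fun x => ?_, (a1.add (Ad_cell k q c)).mono ?_,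
      (a2.add (Ad_cell k q (-c))).mono ?_, fun _ => ?_, fun _ => ?_, fun x hx => ?_⟩
    · rw [hsum x]; beta_reduce; split_ifs <;> ring
    · rw [mul_one, add_mul, one_mul]; refine add_le_add le_rfl (hcn.trans ?_); exact mul_le_of_le_one_right' hWT
    · rw [enorm_neg, mul_assoc, add_mul, one_mul, ← mul_assoc]; exact add_le_add le_rfl hcn
    · rw [integral_add i1 (hci c).1, (hci c).2, hcc, hz]
    · rw [integral_add i2 (hci (-c)).1, (hci (-c)).2, smul_neg, hcc]; ring
    · have h1 : fl k x - q ≠ 0 := by intro h; rw [h] at hx; simp at hx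
      simp [hg1, not_le.2 hx, h1]

lemma cs_tsum {ι : Type*} (u v : ι → EN) : ∑' i, u i * v i ≤ l2 u * l2 v := by
  letI : MeasurableSpace ι := ⊤
  have h := lintegral_mul_le_Lp_mul_Lq (Measure.count : Measure ι) Real.HolderConjugate.two_two
    (measurable_from_top (f := u)).aemeasurable (measurable_from_top (f := v)).aemeasurable
  simp only [lintegral_count, Pi.mul_apply] at h
  exact h

lemma le_XX (b : Bool) (B : ℤ → EN) (k : ℤ) : B k ≤ XX b B := by
  unfold XX; split_ifs
  · exact le_l2 B k
  · exact le_iSup B k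

lemma meas_XX {α : Type*} [MeasurableSpace α] (b : Bool) {B : ℤ → α → EN} (h : ∀ k, Measurable (B k)) : Measurable (fun x => XX b (fun k => B k x)) := by
  unfold XX; split_ifs
  · exact meas_l2 h
  · exact Measurable.iSup h

lemma meas_FF (sx sy : Bool) (a : Rc → EN) : Measurable (fun z => FF sx sy (fun k1 k2 => AC a k1 k2 z)) := by
  unfold FF
  exact meas_XX sx (B := fun k1 z => XX sy (fun k2 => AC a k1 k2 z)) fun k1 => meas_XX sy (B := fun k2 z => AC a k1 k2 z) fun k2 => AC_meas a k1 k2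

lemma hol1 {T : Type*} [Fintype T] [DecidableEq T] (B : T → ℤ → EN) {j j' : T} (hj : j ≠ j') (s : T → Bool) (h1 : s j = true) (h2 : s j' = true) :
    ∑' k, ∏ t, B t k ≤ ∏ t, XX (s t) (B t) := by
  have hm : j' ∈ Finset.univ.erase j := Finset.mem_erase.2 ⟨hj.symm, Finset.mem_univ _⟩
  have e : ∀ g : T → EN, ∏ t, g t = g j * g j' * ∏ t ∈ (Finset.univ.erase j).erase j', g t := fun g => by
    rw [mul_assoc, Finset.mul_prod_erase _ g hm, Finset.mul_prod_erase _ g (Finset.mem_univ j)]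
  rw [e]
  calc ∑' k, ∏ t, B t k ≤ ∑' k, (B j k * B j' k) * ∏ t ∈ (Finset.univ.erase j).erase j', XX (s t) (B t) := by
        refine ENNReal.tsum_le_tsum fun k => ?_
        rw [e]
        exact mul_le_mul_right (Finset.prod_le_prod' fun t _ => le_XX _ _ k) _
    _ = (∑' k, B j k * B j' k) * ∏ t ∈ (Finset.univ.erase j).erase j', XX (s t) (B t) := ENNReal.tsum_mul_right
    _ ≤ _ := by
        refine mul_le_mul_left ?_ _
        simp only [XX, h1, h2, if_true]
        exact cs_tsum _ _

lemma hol2 {T : Type*} [Fintype T] [DecidableEq T] (A : T → ℤ → ℤ → EN) {j j' i i' : T} (hj : j ≠ j') (hi : i ≠ i') (sx sy : T → Bool)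
    (h1 : sx j = true) (h2 : sx j' = true) (h3 : sy i = true) (h4 : sy i' = true) :
    ∑' k1, ∑' k2, ∏ t, A t k1 k2 ≤ ∏ t, FF (sx t) (sy t) (A t) := by
  refine (ENNReal.tsum_le_tsum fun k1 => hol1 (fun t k2 => A t k1 k2) hi sy h3 h4).trans ?_
  exact hol1 (fun t k1 => XX (sy t) (fun k2 => A t k1 k2)) hj sx h1 h2

def cel (r : Rc) : Set (RR) := Dy r.1.1 r.1.2 ×ˢ Dy r.2.1 r.2.2

lemma cel_meas (r : Rc) : MeasurableSet (cel r) := (meas_Dy _ _).prod (meas_Dy _ _)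

lemma cel_vol (r : Rc) : volume (cel r) = 2^r.1.1 * 2^r.2.1 := by
  unfold cel; rw [Measure.volume_eq_prod, Measure.prod_prod, vol_Dy, vol_Dy]

lemma ptsum (𝓡 : Finset Rc) (x : Rc → EN) (z : RR) : ∑ r ∈ 𝓡, (cel r).indicator (fun _ => x r) z ≤ ∑' k1, ∑' k2, AC x k1 k2 z := by
  classical
  have e : ∑ r ∈ 𝓡, (cel r).indicator (fun _ => x r) z = ∑ r ∈ 𝓡.filter (fun r => z ∈ cel r), x r := by
    rw [Finset.sum_filter]; exact Finset.sum_congr rfl fun r _ => by simp [Set.indicator]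
  have hz : ∀ r ∈ 𝓡.filter (fun r => z ∈ cel r), r = ((r.1.1, fl r.1.1 z.1), (r.2.1, fl r.2.1 z.2)) := fun r hr => by
    have h := (Finset.mem_filter.1 hr).2
    have h1 : fl r.1.1 z.1 = r.1.2 := h.1
    have h2 : fl r.2.1 z.2 = r.2.2 := h.2
    rw [h1, h2]
  have e2 : ∑ r ∈ 𝓡.filter (fun r => z ∈ cel r), x r = ∑ k ∈ (𝓡.filter (fun r => z ∈ cel r)).image (fun r => (r.1.1, r.2.1)), AC x k.1 k.2 z := by
    rw [Finset.sum_image]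
    · exact Finset.sum_congr rfl fun r hr => by unfold AC; rw [← hz r hr]
    · intro r hr r' hr' h
      rw [hz r hr, hz r' hr']
      simp only [Prod.mk.injEq] at h
      rw [h.1, h.2]
  rw [e, e2, ← ENNReal.tsum_prod (f := fun k1 k2 => AC x k1 k2 z)]
  exact ENNReal.sum_le_tsum _

lemma loc (𝓡 : Finset Rc) (x : Rc → EN) {U : Set (RR)} (hU : MeasurableSet U) (h : ∀ r ∈ 𝓡, volume (cel r) ≤ 2 * volume (cel r ∩ U)) :
    ∑ r ∈ 𝓡, volume (cel r) * x r ≤ 2 * ∫⁻ z in U, ∑' k1, ∑' k2, AC x k1 k2 z := by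
  calc ∑ r ∈ 𝓡, volume (cel r) * x r ≤ ∑ r ∈ 𝓡, 2 * ∫⁻ z in U, (cel r).indicator (fun _ => x r) z := by
        refine Finset.sum_le_sum fun r hr => ?_
        rw [lintegral_indicator_const (cel_meas r), Measure.restrict_apply (cel_meas r), mul_comm (x r), ← mul_assoc]
        exact mul_le_mul_left (h r hr) _
    _ = 2 * ∫⁻ z in U, ∑ r ∈ 𝓡, (cel r).indicator (fun _ => x r) z := by
        rw [← Finset.mul_sum, lintegral_finset_sum _ fun r _ => measurable_const.indicator (cel_meas r)]
    _ ≤ _ := by gcongr with z; exact ptsum _ _ _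

lemma core {l : ℕ} (a : Fin l → Rc → EN) (c : Rc → EN) (𝓡 : Finset Rc) {U : Set (RR)} (hU : MeasurableSet U)
    (h : ∀ r ∈ 𝓡, volume (cel r) ≤ 2 * volume (cel r ∩ U)) {j j' i i' : Fin (l+1)} (hj : j ≠ j') (hi : i ≠ i') (sx sy : Fin (l+1) → Bool)
    (h1 : sx j = true) (h2 : sx j' = true) (h3 : sy i = true) (h4 : sy i' = true) :
    ∑ r ∈ 𝓡, volume (cel r) * ((∏ i, a i r) * c r) ≤ 2 * ∫⁻ z in U, (∏ i : Fin l, FF (sx i.castSucc) (sy i.castSucc) (fun k1 k2 => AC (a i) k1 k2 z)) * FF (sx (Fin.last l)) (sy (Fin.last l)) (fun k1 k2 => AC c k1 k2 z) := by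
  refine (loc 𝓡 (fun r => (∏ i, a i r) * c r) hU h).trans ?_
  gcongr with z
  have H := hol2 (fun (t : Fin (l+1)) k1 k2 => AC (Fin.snoc (α := fun _ => Rc → EN) a c t) k1 k2 z) hj hi sx sy h1 h2 h3 h4
  simp only [Fin.prod_univ_castSucc, Fin.snoc_castSucc, Fin.snoc_last] at H
  exact H

noncomputable def QQ (g : RR → EN) (s t : ℤ) (z : RR) : EN := Mx s (fun x => Mx t (fun y => g (x, y)) z.2) z.1

lemma QQ_meas {g : RR → EN} (hg : Measurable g) (s t : ℤ) : Measurable (QQ g s t) :=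
  Mx_joint (g := fun z => Mx t (fun y => g (z.1, y)) z.2) (Mx_joint' hg t) s

lemma QQ_int : ∃ C : EN, C ≠ ⊤ ∧ ∀ (g : RR → EN) (s t : ℤ), Measurable g → ∫⁻ z, QQ g s t z ^ (2:ℝ) ≤ C * kap s * kap t * ∫⁻ z, g z ^ (2:ℝ) := by
  obtain ⟨C, hC, H⟩ := strongM (q := 2) (by norm_num)
  refine ⟨C * C, by finiteness, fun g s t hg => ?_⟩
  have hm : Measurable (fun z : RR => Mx t (fun y => g (z.1, y)) z.2) := Mx_joint' hg t
  have i1 : ∫⁻ z, QQ g s t z ^ (2:ℝ) ≤ C * kap s * ∫⁻ z : RR, (Mx t (fun y => g (z.1, y)) z.2) ^ (2:ℝ) := by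
    rw [Measure.volume_eq_prod, lintegral_prod_symm' _ ((QQ_meas hg s t).pow_const _), lintegral_prod_symm' _ (hm.pow_const _),
      ← lintegral_const_mul' _ _ (mul_ne_top hC (kap_netop s))]
    refine lintegral_mono fun y => ?_
    have hx : Measurable (fun x : ℝ => (x, y)) := measurable_id.prodMk measurable_const
    have hmy : Measurable (fun x => Mx t (fun y => g (x, y)) y) := by simpa only [Function.comp_def] using hm.comp hx
    exact H s _ hmy
  have i2 : ∫⁻ z : RR, (Mx t (fun y => g (z.1, y)) z.2) ^ (2:ℝ) ≤ C * kap t * ∫⁻ z, g z ^ (2:ℝ) := by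
    rw [Measure.volume_eq_prod, lintegral_prod _ (hm.pow_const _).aemeasurable, lintegral_prod _ (hg.pow_const _).aemeasurable,
      ← lintegral_const_mul' _ _ (mul_ne_top hC (kap_netop t))]
    refine lintegral_mono fun x => ?_
    have hx : Measurable (fun y : ℝ => (x, y)) := measurable_const.prodMk measurable_id
    exact H t (fun y => g (x, y)) (hg.comp hx)
  refine i1.trans ((mul_le_mul_right i2 _).trans (le_of_eq (by ring)))

lemma QQ_ge {Ω : Set (RR)} (hΩ : MeasurableSet Ω) (r : Rc) (h : volume (cel r) ≤ 2 * volume (cel r ∩ Ω)) (z : RR) :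
    1 ≤ 2 * QQ (Ω.indicator fun _ => 1) (r.1.2 - fl r.1.1 z.1) (r.2.2 - fl r.2.1 z.2) z := by
  set g : RR → EN := Ω.indicator fun _ => 1 with hg
  have hgm : Measurable g := measurable_const.indicator hΩ
  have h1 : av r.1.1 r.1.2 (fun x => av r.2.1 r.2.2 (fun y => g (x,y))) ≤ QQ g (r.1.2 - fl r.1.1 z.1) (r.2.2 - fl r.2.1 z.2) z := by
    unfold QQ
    refine le_trans ?_ (av_le_Mx r.1.1 _ _ _)
    rw [add_sub_cancel]
    refine av_mono fun x => ?_
    refine le_trans ?_ (av_le_Mx r.2.1 _ _ _)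
    rw [add_sub_cancel]
  have h2 : av r.1.1 r.1.2 (fun x => av r.2.1 r.2.2 (fun y => g (x,y))) = 2^(-r.1.1) * 2^(-r.2.1) * volume (cel r ∩ Ω) := by
    unfold av
    rw [lintegral_const_mul' _ _ (zp_netop _), mul_assoc]
    congr 2
    have : volume (cel r ∩ Ω) = ∫⁻ z in cel r, g z := by
      rw [hg, lintegral_indicator_const hΩ, one_mul, Measure.restrict_apply hΩ, Set.inter_comm]
    rw [this, cel, Measure.volume_eq_prod, ← Measure.prod_restrict, lintegral_prod _ hgm.aemeasurable]
  calc (1:EN) = 2^(-r.1.1) * 2^(-r.2.1) * volume (cel r) := by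
        rw [cel_vol, show (2:EN)^(-r.1.1) * 2^(-r.2.1) * (2^r.1.1 * 2^r.2.1) = (2^(-r.1.1) * 2^r.1.1) * (2^(-r.2.1) * 2^r.2.1) by ring, zp_mul, zp_mul, one_mul]
    _ ≤ 2^(-r.1.1) * 2^(-r.2.1) * (2 * volume (cel r ∩ Ω)) := mul_le_mul_right h _
    _ = 2 * av r.1.1 r.1.2 (fun x => av r.2.1 r.2.2 (fun y => g (x,y))) := by rw [h2]; ring
    _ ≤ _ := mul_le_mul_right h1 _

def ExS (Ω : Set (RR)) (k : ℕ) : Set (RR) :=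
  ⋃ i ∈ (Finset.Icc (-(2^k:ℤ)) (2^k)) ×ˢ (Finset.Icc (-(2^k:ℤ)) (2^k)), {z | 1 ≤ 2 * QQ (Ω.indicator fun _ => 1) i.1 i.2 z}

lemma ExS_meas {Ω : Set (RR)} (hΩ : MeasurableSet Ω) (k : ℕ) : MeasurableSet (ExS Ω k) := by
  refine Finset.measurableSet_biUnion _ fun i _ => measurableSet_le measurable_const ?_
  exact (QQ_meas (measurable_const.indicator hΩ) i.1 i.2).const_mul 2

lemma kap_le {s : ℤ} {k : ℕ} (h : s.natAbs ≤ 2^k) : kap s ≤ 4 * 2^k := by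
  unfold kap
  have h1 : Nat.size s.natAbs ≤ k + 1 := by rw [Nat.size_le]; rw [pow_succ]; have := Nat.one_le_two_pow (n := k); omega
  have h2 : k < 2^k := Nat.lt_two_pow_self
  exact_mod_cast (show Nat.size s.natAbs + 2 ≤ 4 * 2^k by have := Nat.one_le_two_pow (n := k); omega)

lemma ExS_vol : ∃ C : EN, C ≠ ⊤ ∧ ∀ (Ω : Set (RR)) (k : ℕ), MeasurableSet Ω → volume (ExS Ω k) ≤ C * 2^(4*k) * volume Ω := by
  obtain ⟨C, hC, H⟩ := QQ_int
  refine ⟨9 * (4 * C * 16), by finiteness, fun Ω k hΩ => ?_⟩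
  have hgm : Measurable (Ω.indicator fun _ => (1:EN)) := measurable_const.indicator hΩ
  have hg2 : ∫⁻ z, (Ω.indicator (fun _ => (1:EN)) z) ^ (2:ℝ) = volume Ω := by
    rw [← one_mul (volume Ω), ← lintegral_indicator_const hΩ]
    congr 1; ext z; by_cases h : z ∈ Ω <;> simp [h]
  have key : ∀ i ∈ (Finset.Icc (-(2^k:ℤ)) (2^k)) ×ˢ (Finset.Icc (-(2^k:ℤ)) (2^k)), volume {z | 1 ≤ 2 * QQ (Ω.indicator fun _ => 1) i.1 i.2 z} ≤ 4 * C * 16 * 2^(2*k) * volume Ω := by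
    intro i hi
    rw [Finset.mem_product, Finset.mem_Icc, Finset.mem_Icc] at hi
    have hk1 : kap i.1 ≤ 4 * 2^k := kap_le (by zify; exact abs_le.2 hi.1)
    have hk2 : kap i.2 ≤ 4 * 2^k := kap_le (by zify; exact abs_le.2 hi.2)
    have hq := QQ_meas hgm i.1 i.2
    have m := mul_meas_ge_le_lintegral (μ := volume) (f := fun z => (2 * QQ (Ω.indicator fun _ => 1) i.1 i.2 z)^(2:ℝ)) ((hq.const_mul 2).pow_const _) 1
    rw [one_mul] at m
    have ms : {z | 1 ≤ 2 * QQ (Ω.indicator fun _ => 1) i.1 i.2 z} ⊆ {z | (1:EN) ≤ (2 * QQ (Ω.indicator fun _ => 1) i.1 i.2 z)^(2:ℝ)} := fun z hz => one_le_rpow hz (by norm_num)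
    refine (measure_mono ms).trans (m.trans ?_)
    have e : ∫⁻ z, (2 * QQ (Ω.indicator fun _ => 1) i.1 i.2 z)^(2:ℝ) = 4 * ∫⁻ z, (QQ (Ω.indicator fun _ => 1) i.1 i.2 z)^(2:ℝ) := by
      rw [← lintegral_const_mul _ (hq.pow_const _)]
      congr 1; ext z; rw [mul_rpow_of_nonneg _ _ (by norm_num)]; congr 1; norm_num
    rw [e]
    calc _ ≤ 4 * (C * kap i.1 * kap i.2 * volume Ω) := mul_le_mul_right (by rw [← hg2]; exact H _ _ _ hgm) _
      _ ≤ 4 * (C * (4 * 2^k) * (4 * 2^k) * volume Ω) := by gcongr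
      _ = _ := by ring
  unfold ExS
  refine (measure_biUnion_finset_le _ _).trans ((Finset.sum_le_sum key).trans ?_)
  rw [Finset.sum_const, nsmul_eq_mul, Finset.card_product, Int.card_Icc]
  have hc : ((2^k + 1 - -(2^k:ℤ)).toNat : EN) ≤ 3 * 2^k := by
    have h0 : (2^k + 1 - -(2^k:ℤ)).toNat = 2 * 2^k + 1 := by
      have : (2^k + 1 - -(2^k:ℤ)) = ((2 * 2^k + 1 : ℕ) : ℤ) := by push_cast; ring
      rw [this, Int.toNat_natCast]
    rw [h0]
    exact_mod_cast (show 2 * 2^k + 1 ≤ 3 * 2^k by have := Nat.one_le_two_pow (n := k); omega)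
  push_cast
  calc _ ≤ (3 * 2^k) * (3 * 2^k) * (4 * C * 16 * 2^(2*k) * volume Ω) := by gcongr
    _ = _ := by ring

lemma exc {p : ℝ} (hp : 0 < p) : ∃ b a' : ℕ, ∀ (G : RR → EN) (N : EN), Measurable G → N ≠ ⊤ → 1 ≤ N → ∫⁻ z, G z ^ p ≤ N ^ p →
    ∃ (Ω : ℕ → Set (RR)) (Ex : Set (RR)), (∀ k, MeasurableSet (Ω k)) ∧ MeasurableSet Ex ∧ volume Ex ≤ 1/2 ∧
      (∀ k r, volume (cel r) ≤ 2 * volume (cel r ∩ Ω k) → ∀ z, (fl r.1.1 z.1 - r.1.2).natAbs ≤ 2^k → (fl r.2.1 z.2 - r.2.2).natAbs ≤ 2^k → z ∈ Ex) ∧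
      ∀ k, (∫⁻ z in (Ω k)ᶜ, G z ^ (p+2)) ^ (1/(p+2)) ≤ N * 2^(b*(a'+k)) := by
  obtain ⟨C, hC, H⟩ := ExS_vol
  obtain ⟨b, hb⟩ := exists_nat_ge (5/p)
  obtain ⟨a', ha'⟩ : ∃ a' : ℕ, C * 4 ≤ 2^a' := by
    obtain ⟨m, hm⟩ := ENNReal.exists_nat_gt (show C * 4 ≠ ⊤ by finiteness)
    refine ⟨m, hm.le.trans ?_⟩
    exact_mod_cast (Nat.lt_two_pow_self (n := m)).le
  refine ⟨b, a', fun G N hG hN hN1 hGN => ?_⟩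
  have hbp : 5 ≤ p * b := by rw [div_le_iff₀ hp] at hb; linarith
  set L : ℕ → EN := fun k => N * 2^(b*(a'+k)) with hL
  have hLt : ∀ k, L k ≠ ⊤ := fun k => by simp only [hL]; finiteness
  have hNL : ∀ k, N ≤ L k := fun k => le_mul_of_one_le_right' (one_le_pow₀ (by norm_num))
  set Ω : ℕ → Set (RR) := fun k => {z | L k < G z} with hΩd
  have hΩ : ∀ k, MeasurableSet (Ω k) := fun k => measurableSet_lt measurable_const hG
  have hvol : ∀ k, 2^(5*(a'+k)) * volume (Ω k) ≤ 1 := by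
    intro k
    have m := mul_meas_ge_le_lintegral (μ := volume) (hG.pow_const p) (L k ^ p)
    have ms : Ω k ⊆ {z | L k ^ p ≤ G z ^ p} := fun z hz => rpow_le_rpow (le_of_lt hz) hp.le
    have m2 : L k ^ p * volume (Ω k) ≤ N ^ p := (mul_le_mul_right (measure_mono ms) _).trans (m.trans hGN)
    have e : L k ^ p = N ^ p * (2^(b*(a'+k)))^p := mul_rpow_of_nonneg _ _ hp.le
    rw [e, mul_assoc] at m2
    have hNp0 : N ^ p ≠ 0 := by
      have : N ≠ 0 := (lt_of_lt_of_le (by norm_num) hN1).ne'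
      simp [rpow_eq_zero_iff, this, hN]
    have hNpt : N ^ p ≠ ⊤ := rpow_ne_top_of_nonneg hp.le hN
    have m3 : (2^(b*(a'+k)))^p * volume (Ω k) ≤ 1 := by
      rw [← ENNReal.mul_le_mul_iff_right hNp0 hNpt, mul_one]; exact m2
    refine le_trans (mul_le_mul_left ?_ _) m3
    rw [← rpow_natCast, ← rpow_natCast, ← rpow_mul]
    refine rpow_le_rpow_of_exponent_le (by norm_num) ?_
    push_cast
    have : (0:ℝ) ≤ (a':ℝ) + k := by positivity
    nlinarith
  have hex : ∀ k, volume (ExS (Ω k) k) ≤ 2⁻¹^2 * 2⁻¹^k := by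
    intro k
    refine (H (Ω k) k (hΩ k)).trans ?_
    have h1 := hvol k
    have h2 : C * 2^(4*k) * 2^(k+2) * volume (Ω k) ≤ 1 := by
      refine le_trans (mul_le_mul_left ?_ _) h1
      calc C * 2^(4*k) * 2^(k+2) = (C * 4) * 2^(5*k) := by ring
        _ ≤ 2^a' * 2^(5*k) := mul_le_mul_left ha' _
        _ ≤ 2^(5*a') * 2^(5*k) := mul_le_mul_left (pow_le_pow_right₀ (by norm_num) (by omega)) _
        _ = _ := by ring
    rw [← pow_add, add_comm 2 k, ENNReal.inv_pow.symm]
    rw [← one_div, ENNReal.le_div_iff_mul_le (by left; positivity) (by left; finiteness)]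
    calc _ = C * 2^(4*k) * 2^(k+2) * volume (Ω k) := by ring
      _ ≤ 1 := h2
  refine ⟨Ω, ⋃ k, ExS (Ω k) k, hΩ, MeasurableSet.iUnion fun k => ExS_meas (hΩ k) k, ?_, ?_, ?_⟩
  · refine (measure_iUnion_le _).trans ((ENNReal.tsum_le_tsum hex).trans ?_)
    rw [ENNReal.tsum_mul_left, tsum_geometric]
    rw [one_sub_inv_two, inv_inv, one_div, pow_two, mul_assoc, ENNReal.inv_mul_cancel (by norm_num) (by norm_num), mul_one]
  · intro k r hr z h1 h2
    refine Set.mem_iUnion.2 ⟨k, ?_⟩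
    unfold ExS
    refine Set.mem_biUnion (x := (r.1.2 - fl r.1.1 z.1, r.2.2 - fl r.2.1 z.2)) ?_ (QQ_ge (hΩ k) r hr z)
    have q1 : |fl r.1.1 z.1 - r.1.2| ≤ 2^k := by zify at h1; exact h1
    have q2 : |fl r.2.1 z.2 - r.2.2| ≤ 2^k := by zify at h2; exact h2
    rw [abs_le] at q1 q2
    simp only [Finset.coe_product, Set.mem_prod, Finset.coe_Icc, Set.mem_Icc]
    refine ⟨⟨?_, ?_⟩, ⟨?_, ?_⟩⟩ <;> linarith
  · intro k
    have h1 : ∫⁻ z in (Ω k)ᶜ, G z ^ (p+2) ≤ L k ^ (p+2) := by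
      calc ∫⁻ z in (Ω k)ᶜ, G z ^ (p+2) ≤ ∫⁻ z in (Ω k)ᶜ, L k ^ (2:ℝ) * G z ^ p := by
            refine setLIntegral_mono' (hΩ k).compl fun z hz => ?_
            rw [add_comm p 2, rpow_add_of_nonneg _ _ (by norm_num) hp.le]
            have : G z ≤ L k := not_lt.1 hz
            gcongr
        _ ≤ ∫⁻ z, L k ^ (2:ℝ) * G z ^ p := setLIntegral_le_lintegral _ _
        _ = L k ^ (2:ℝ) * ∫⁻ z, G z ^ p := lintegral_const_mul _ (hG.pow_const _)
        _ ≤ L k ^ (2:ℝ) * L k ^ p := by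
            refine mul_le_mul_right (hGN.trans ?_) _
            exact rpow_le_rpow (hNL k) hp.le
        _ = _ := by rw [add_comm p 2, rpow_add_of_nonneg _ _ (by norm_num) hp.le]
    calc _ ≤ (L k ^ (p+2)) ^ (1/(p+2)) := rpow_le_rpow h1 (by positivity)
      _ = L k := by rw [← rpow_mul, mul_one_div_cancel (by positivity), rpow_one]

lemma Ad.smul {D : EN} {k q : ℤ} {φ : ℝ → ℂ} (h : Ad D k q φ) (c : ℂ) : Ad (‖c‖ₑ * D) k q (fun x => c * φ x) := by
  refine ⟨h.meas.const_mul c, fun x => ?_, fun j x y hxy => ?_⟩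
  · rw [enorm_mul, mul_assoc]; exact mul_le_mul_right (h.bd x) _
  · rw [← mul_sub, enorm_mul, mul_assoc ‖c‖ₑ, mul_assoc ‖c‖ₑ]; exact mul_le_mul_right (h.lip j x y hxy) _

lemma Nm_ind {q : ℝ} (hq : 0 < q) {E : Set (RR)} (hE : MeasurableSet E) (h1 : volume E ≤ 1) :
    Nm q volume (fun z => ‖E.indicator (fun _ => (1:ℂ)) z‖ₑ) ≤ 1 := by
  unfold Nm
  have e : ∀ z, ‖E.indicator (fun _ => (1:ℂ)) z‖ₑ ^ q = E.indicator (fun _ => (1:EN)) z := fun z => by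
    by_cases h : z ∈ E <;> simp [h, hq]
  simp_rw [e]
  rw [lintegral_indicator_const hE, one_mul]
  exact rpow_le_one h1 (by positivity)

lemma int_ind {D D' : EN} {k q k' q' : ℤ} {φ ψ : ℝ → ℂ} (h : Ad D k q φ) (h' : Ad D' k' q' ψ) (hD : D ≠ ⊤) (hD' : D' ≠ ⊤) {E : Set (RR)} (hE : MeasurableSet E) :
    Integrable (fun z : RR => E.indicator (fun _ => (1:ℂ)) z * (φ z.1 * ψ z.2)) := by
  have h0 : Integrable (fun z : RR => φ z.1 * ψ z.2) := (h.integrable hD).mul_prod (h'.integrable hD')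
  have e : (fun z : RR => E.indicator (fun _ => (1:ℂ)) z * (φ z.1 * ψ z.2)) = E.indicator (fun z : RR => φ z.1 * ψ z.2) := by
    ext z; by_cases hz : z ∈ E <;> simp [hz]
  rw [e]; exact h0.indicator hE

lemma tailL {q : ℝ} (hq : 1 < q) (S : ℕ) : ∃ K : EN, K ≠ ⊤ ∧ ∀ (D : EN) (𝓡 : Finset Rc) (sx sy : Bool) (E : Set (RR)) (φ ψ : Rc → ℝ → ℂ) (T : ℕ),
    D ≠ ⊤ → MeasurableSet E → volume E ≤ 1 →
    (∀ r ∈ 𝓡, AdS S D r.1.1 r.1.2 (φ r) ∧ AdS S D r.2.1 r.2.2 (ψ r) ∧ (sx = true → ∫ x, φ r x = 0) ∧ (sy = true → ∫ x, ψ r x = 0)) →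
    (∀ r ∈ 𝓡, ∀ z ∈ E, (fl r.1.1 z.1 - r.1.2).natAbs ≤ T → (fl r.2.1 z.2 - r.2.2).natAbs ≤ T → False) →
    ∃ b b' : Rc → EN, Nm q volume (fun z => FF sx sy (fun k1 k2 => AC b k1 k2 z)) ≤ K * D^2 ∧
      Nm q volume (fun z => FF sx sy (fun k1 k2 => AC b' k1 k2 z)) ≤ K * D^2 ∧
      ∀ r ∈ 𝓡, 2^(-r.1.1) * 2^(-r.2.1) * ‖∫ z : RR, E.indicator (fun _ => (1:ℂ)) z * (φ r z.1 * ψ r z.2)‖ₑ ≤ wd S T * (b r + b' r) := by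
  obtain ⟨C0, hC0, H⟩ := THF hq
  obtain ⟨C, hC, hC1, HS⟩ := split_bump S
  refine ⟨C0 * C^2 * kap 0 * kap 0, by have := kap_netop 0; finiteness, fun D 𝓡 sx sy E φ ψ T hD hE hE1 hr hfar => ?_⟩
  have hq0 : 0 < q := by linarith
  choose φ1 φ2 hφ hφ1 hφ2 hφ1z hφ2z hφ1s using fun r (h : r ∈ 𝓡) => HS D r.1.1 r.1.2 (φ r) sx T (hr r h).1 hD (hr r h).2.2.1
  choose ψ1 ψ2 hψ hψ1 hψ2 hψ1z hψ2z hψ1s using fun r (h : r ∈ 𝓡) => HS D r.2.1 r.2.2 (ψ r) sy T (hr r h).2.1 hD (hr r h).2.2.2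
  set ω : ℝ := ((1 + |((T:ℤ):ℝ)|)^S)⁻¹ with hω
  have hω0 : 0 < ω := by positivity
  have hw : wd S T = oR ω := wd_ofReal S T
  have hw0 : wd S T ≠ ⊤ := by rw [hw]; finiteness
  have hcω : ‖((ω⁻¹ : ℝ) : ℂ)‖ₑ * oR ω = 1 := by
    rw [← ofReal_norm, ← ofReal_mul (norm_nonneg _)]
    rw [Complex.norm_real, Real.norm_of_nonneg (by positivity), inv_mul_cancel₀ hω0.ne', ofReal_one]
  set f : RR → ℂ := E.indicator (fun _ => (1:ℂ)) with hf
  have hfm : AEStronglyMeasurable f volume := (measurable_const.indicator hE).aestronglyMeasurable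
  have hN := Nm_ind hq0 hE hE1
  have hψA : ∀ r (h : r ∈ 𝓡), Ad (C * D) r.2.1 r.2.2 (ψ r) := fun r h => (hr r h).2.1.toAd.mono (le_mul_of_one_le_left' hC1)
  have hsc : ∀ {k m : ℤ} {g : ℝ → ℂ}, Ad (C * D * wd S T) k m g → Ad (C * D) k m (fun x => ((ω⁻¹ : ℝ) : ℂ) * g x) := fun h => by
    refine (h.smul _).mono (le_of_eq ?_)
    rw [hw, mul_comm (C*D), ← mul_assoc, hcω, one_mul]
  have hCD : C * D ≠ ⊤ := by finiteness
  have fin : ∀ x : Rc → EN, HypG 𝓡 (C * D) 0 0 sx sy f x → Nm q volume (fun z => FF sx sy (fun k1 k2 => AC x k1 k2 z)) ≤ C0 * C^2 * kap 0 * kap 0 * D^2 := by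
    intro x hx
    calc _ ≤ C0 * (C*D)^2 * kap 0 * kap 0 * Nm q volume (fun z => ‖f z‖ₑ) := H 𝓡 sx sy (C*D) 0 0 f x hCD hfm hx
      _ ≤ C0 * (C*D)^2 * kap 0 * kap 0 * 1 := by gcongr
      _ = _ := by ring
  classical
  refine ⟨fun r => if h : r ∈ 𝓡 then 2^(-r.1.1) * 2^(-r.2.1) * ‖∫ z : RR, f z * ((((ω⁻¹:ℝ):ℂ) * φ2 r h z.1) * ψ r z.2)‖ₑ else 0,
    fun r => if h : r ∈ 𝓡 then 2^(-r.1.1) * 2^(-r.2.1) * ‖∫ z : RR, f z * (φ1 r h z.1 * (((ω⁻¹:ℝ):ℂ) * ψ2 r h z.2))‖ₑ else 0, fin _ ⟨fun r h => ?_, fun r h => by simp [h]⟩, fin _ ⟨fun r h => ?_, fun r h => by simp [h]⟩, fun r h => ?_⟩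
  · refine ⟨fun x => ((ω⁻¹ : ℝ) : ℂ) * φ2 r h x, ψ r, by rw [add_zero]; exact hsc (hφ2 r h), by rw [add_zero]; exact hψA r h, fun hs => ?_, (hr r h).2.2.2, ?_⟩
    · rw [integral_const_mul, hφ2z r h hs, mul_zero]
    · simp [h]
  · refine ⟨φ1 r h, fun x => ((ω⁻¹ : ℝ) : ℂ) * ψ2 r h x, by rw [add_zero]; exact hφ1 r h, by rw [add_zero]; exact hsc (hψ2 r h), hφ1z r h, fun hs => ?_, ?_⟩
    · rw [integral_const_mul, hψ2z r h hs, mul_zero]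
    · simp [h]
  · simp only [h, dif_pos]
    have i1 : Integrable (fun z : RR => f z * (φ2 r h z.1 * ψ r z.2)) := int_ind (hφ2 r h) (hψA r h) (by finiteness) hCD hE
    have i2 : Integrable (fun z : RR => f z * (φ1 r h z.1 * ψ2 r h z.2)) := int_ind (hφ1 r h) (hψ2 r h) hCD (by finiteness) hE
    have e1 : ∫ z : RR, f z * (φ r z.1 * ψ r z.2) = (∫ z : RR, f z * (φ2 r h z.1 * ψ r z.2)) + ∫ z : RR, f z * (φ1 r h z.1 * ψ2 r h z.2) := by
      rw [← integral_add i1 i2]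
      congr 1; ext z
      have h0 : f z * (φ1 r h z.1 * ψ1 r h z.2) = 0 := by
        by_cases hz : z ∈ E
        · by_cases c1 : (fl r.1.1 z.1 - r.1.2).natAbs ≤ T
          · by_cases c2 : (fl r.2.1 z.2 - r.2.2).natAbs ≤ T
            · exact (hfar r h z hz c1 c2).elim
            · rw [hψ1s r h _ (not_le.1 c2)]; simp
          · rw [hφ1s r h _ (not_le.1 c1)]; simp
        · simp [hf, hz]
      have e3 := hφ r h z.1
      have e4 := hψ r h z.2
      rw [e3]
      linear_combination h0 + f z * φ1 r h z.1 * e4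
    have e5 : ∫ z : RR, f z * ((((ω⁻¹:ℝ):ℂ) * φ2 r h z.1) * ψ r z.2) = ((ω⁻¹:ℝ):ℂ) * ∫ z : RR, f z * (φ2 r h z.1 * ψ r z.2) := by
      rw [← integral_const_mul]; congr 1; ext z; ring
    have e6 : ∫ z : RR, f z * (φ1 r h z.1 * (((ω⁻¹:ℝ):ℂ) * ψ2 r h z.2)) = ((ω⁻¹:ℝ):ℂ) * ∫ z : RR, f z * (φ1 r h z.1 * ψ2 r h z.2) := by
      rw [← integral_const_mul]; congr 1; ext z; ring
    rw [e1, e5, e6, enorm_mul, enorm_mul, hw]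
    set A := ‖∫ z : RR, f z * (φ2 r h z.1 * ψ r z.2)‖ₑ
    set B := ‖∫ z : RR, f z * (φ1 r h z.1 * ψ2 r h z.2)‖ₑ
    set κ := ‖((ω⁻¹ : ℝ) : ℂ)‖ₑ
    calc _ ≤ 2^(-r.1.1) * 2^(-r.2.1) * (A + B) := mul_le_mul_right (enorm_add_le _ _) _
      _ = (κ * oR ω) * (2^(-r.1.1) * 2^(-r.2.1) * (A + B)) := by rw [hcω, one_mul]
      _ = _ := by ring

lemma mhol {l : ℕ} (hl : 1 ≤ l) (p : Fin l → ℝ) (hp : ∀ i, 1 < p i) : ∃ P : ℝ, 0 < P ∧ ∀ (F : Fin l → RR → EN) (N : Fin l → EN), (∀ i, Measurable (F i)) →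
    (∀ i, Nm (p i) volume (F i) ≤ N i) → ∫⁻ z, (∏ i, F i z) ^ P ≤ (∏ i, N i) ^ P := by
  have hpos : ∀ i, 0 < p i := fun i => by linarith [hp i]
  have hs : 0 < ∑ i, (p i)⁻¹ := Finset.sum_pos (fun i _ => inv_pos.2 (hpos i)) ⟨⟨0, hl⟩, Finset.mem_univ _⟩
  refine ⟨(∑ i, (p i)⁻¹)⁻¹, inv_pos.2 hs, fun F N hF hN => ?_⟩
  set P := (∑ i, (p i)⁻¹)⁻¹ with hP
  have hP0 : 0 < P := inv_pos.2 hs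
  have h := lintegral_prod_norm_pow_le (μ := (volume : Measure (RR))) Finset.univ (f := fun i z => F i z ^ p i) (fun i _ => ((hF i).pow_const _).aemeasurable)
    (p := fun i => (p i)⁻¹ * P) (by rw [← Finset.sum_mul, hP, mul_inv_cancel₀ hs.ne']) (fun i _ => by have := hpos i; positivity)
  have e : ∀ i (x : EN), (x ^ p i) ^ ((p i)⁻¹ * P) = x ^ P := fun i x => by
    rw [← rpow_mul, ← mul_assoc, mul_inv_cancel₀ (hpos i).ne', one_mul]
  simp only [e] at h
  simp only [← prod_rpow_of_nonneg hP0.le]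
  refine h.trans (Finset.prod_le_prod' fun i _ => ?_)
  rw [← Nm_pow (hpos i), e]
  exact rpow_le_rpow (hN i) hP0.le

lemma wd_geo (b m : ℕ) : (2:EN)^(b*m) * wd (b+1) ((2^m:ℕ):ℤ) ≤ (2⁻¹)^m := by
  have h1 : wd (b+1) ((2^m:ℕ):ℤ) ≤ (2⁻¹)^(m*(b+1)) := by
    unfold wd
    rw [Int.natAbs_natCast, ← ENNReal.inv_pow, ENNReal.inv_le_inv, pow_mul]
    refine pow_le_pow_left₀ (by positivity) ?_ _
    push_cast; exact le_add_self
  calc _ ≤ (2:EN)^(b*m) * (2⁻¹)^(m*(b+1)) := mul_le_mul_right h1 _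
    _ = ((2:EN) * 2⁻¹)^(b*m) * (2⁻¹)^m := by ring
    _ = _ := by rw [ENNReal.mul_inv_cancel (by norm_num) (by norm_num), one_pow, one_mul]

lemma light {Ω : Set (RR)} (hΩ : MeasurableSet Ω) (r : Rc) (h : ¬ volume (cel r) ≤ 2 * volume (cel r ∩ Ω)) : volume (cel r) ≤ 2 * volume (cel r ∩ Ωᶜ) := by
  have hf : volume (cel r) ≠ ⊤ := by rw [cel_vol]; exact mul_ne_top (zp_netop _) (zp_netop _)
  have e : volume (cel r ∩ Ω) + volume (cel r ∩ Ωᶜ) = volume (cel r) := by rw [← Set.diff_eq]; exact MeasureTheory.measure_inter_add_diff _ hΩ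
  have h1 := (not_le.1 h).le
  have : volume (cel r) + volume (cel r) ≤ volume (cel r) + 2 * volume (cel r ∩ Ωᶜ) := by
    calc _ = 2 * volume (cel r ∩ Ω) + 2 * volume (cel r ∩ Ωᶜ) := by rw [← mul_add, e, two_mul]
      _ ≤ _ := add_le_add_left h1 _
  exact (ENNReal.add_le_add_iff_left hf).1 this

theorem MAIN {l : ℕ} (hl : 1 ≤ l) (p : Fin l → ℝ) (hp : ∀ i, 1 < p i) : ∃ S : ℕ, ∀ D : EN, D ≠ ⊤ → 1 ≤ D → ∃ C : EN, C ≠ ⊤ ∧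
    ∀ (𝓡 : Finset Rc) (n : Fin (l+1) → ℤ × ℤ) (φ ψ : Fin (l+1) → Rc → ℝ → ℂ) (sx sy : Fin (l+1) → Bool) (j j' i i' : Fin (l+1)), n (Fin.last l) = (0,0) →
    j ≠ j' → i ≠ i' → sx j = true → sx j' = true → sy i = true → sy i' = true →
    (∀ t, ∀ r ∈ 𝓡, AdS S D r.1.1 (r.1.2+(n t).1) (φ t r) ∧ AdS S D r.2.1 (r.2.2+(n t).2) (ψ t r) ∧ (sx t = true → ∫ x, φ t r x = 0) ∧ (sy t = true → ∫ x, ψ t r x = 0)) →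
    ∀ f : Fin l → RR → ℂ, (∀ i, AEStronglyMeasurable (f i) volume ∧ Nm (p i) volume (fun z => ‖f i z‖ₑ) ≤ 1) →
    ∀ E : Set (RR), MeasurableSet E → volume E = 1 → ∃ E' : Set (RR), E' ⊆ E ∧ MeasurableSet E' ∧ 1/2 ≤ volume E' ∧
      ∑ r ∈ 𝓡, volume (cel r) * ((∏ i : Fin l, 2^(-r.1.1) * 2^(-r.2.1) * ‖∫ z : RR, f i z * (φ i.castSucc r z.1 * ψ i.castSucc r z.2)‖ₑ) *
        (2^(-r.1.1) * 2^(-r.2.1) * ‖∫ z : RR, E'.indicator (fun _ => (1:ℂ)) z * (φ (Fin.last l) r z.1 * ψ (Fin.last l) r z.2)‖ₑ)) ≤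
      C * ∏ i : Fin l, kap (n i.castSucc).1 * kap (n i.castSucc).2 := by
  classical
  obtain ⟨P, hP, HP⟩ := mhol hl p hp
  obtain ⟨b, a', HE⟩ := exc hP
  have hpq : (P+2).HolderConjugate (P+2).conjExponent := Real.HolderConjugate.conjExponent (by linarith)
  set q := (P+2).conjExponent with hqd
  have hq1 : 1 < q := hpq.symm.lt
  obtain ⟨Cq, hCq, HTq⟩ := THF hq1
  obtain ⟨K, hK, HTL⟩ := tailL hq1 (b+1)
  choose Cp hCp HTp using fun i => THF (hp i)
  refine ⟨b+1, fun D hD hD1 => ?_⟩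
  set K0 := Cq * D^2 * kap 0 * kap 0 + K * D^2 with hK0
  set C1 := ∏ i, (max (Cp i) 1 * D^2) with hC1
  have hC1t : C1 ≠ ⊤ := prod_ne_top fun i _ => by
    have h0 : max (Cp i) 1 ≠ ⊤ := by simp [hCp i]
    finiteness
  refine ⟨2 * (4 * C1 * 2^(b*a') * K0 * 2^(b+1)), by have := kap_netop 0; finiteness, ?_⟩
  intro 𝓡 n φ ψ sx sy j j' i₀ i₀' hn hj hi h1 h2 h3 h4 hbump f hf E hE hE1
  set a : Fin l → Rc → EN := fun i r => if r ∈ 𝓡 then 2^(-r.1.1) * 2^(-r.2.1) * ‖∫ z : RR, f i z * (φ i.castSucc r z.1 * ψ i.castSucc r z.2)‖ₑ else 0 with ha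
  set F : Fin l → RR → EN := fun i z => FF (sx i.castSucc) (sy i.castSucc) (fun k1 k2 => AC (a i) k1 k2 z) with hF
  set N : EN := ∏ i : Fin l, (max (Cp i) 1 * D^2 * (kap (n i.castSucc).1 * kap (n i.castSucc).2)) with hN
  have hFm : ∀ i, Measurable (F i) := fun i => meas_FF _ _ _
  have hFN : ∀ i, Nm (p i) volume (F i) ≤ max (Cp i) 1 * D^2 * (kap (n i.castSucc).1 * kap (n i.castSucc).2) := by
    intro i
    refine (HTp i 𝓡 (sx i.castSucc) (sy i.castSucc) D (n i.castSucc).1 (n i.castSucc).2 (f i) (a i) hD (hf i).1 ⟨fun r hr => ?_, fun r hr => by simp [ha, hr]⟩).trans ?_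
    · obtain ⟨b1, b2, b3, b4⟩ := hbump i.castSucc r hr
      exact ⟨_, _, b1.toAd, b2.toAd, b3, b4, by simp [ha, hr]⟩
    · rw [mul_assoc (Cp i * D^2)]
      calc _ ≤ max (Cp i) 1 * D^2 * (kap (n i.castSucc).1 * kap (n i.castSucc).2) * 1 := by
            refine mul_le_mul' (mul_le_mul_left (mul_le_mul_left (le_max_left _ _) _) _) (hf i).2
        _ = _ := mul_one _
  have hGN := HP F _ hFm hFN
  have hNt : N ≠ ⊤ := prod_ne_top fun i _ => by
    have := hCp i; have := kap_netop (n i.castSucc).1; have := kap_netop (n i.castSucc).2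
    have h0 : max (Cp i) 1 ≠ ⊤ := by simp [hCp i]
    finiteness
  have hN1 : 1 ≤ N := Finset.one_le_prod' fun i _ =>
    one_le_mul (one_le_mul (le_max_right _ _) (one_le_pow₀ hD1)) (one_le_mul (kap_ge _) (kap_ge _))
  obtain ⟨Ω, Ex, hΩ, hEx, hExv, hdil, hGk⟩ := HE (fun z => ∏ i, F i z) N (Finset.measurable_fun_prod _ fun i _ => hFm i) hNt hN1 hGN
  have hE'm : MeasurableSet (E \ Ex) := hE.diff hEx
  refine ⟨E \ Ex, Set.diff_subset, hE'm, ?_, ?_⟩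
  · have := le_measure_diff (μ := volume) (s₁ := E) (s₂ := Ex)
    rw [hE1] at this
    refine le_trans ?_ ((tsub_le_tsub_left hExv 1).trans this)
    rw [one_div, one_sub_inv_two]
  have hE'1 : volume (E \ Ex) ≤ 1 := hE1 ▸ measure_mono Set.diff_subset
  set c : Rc → EN := fun r => if r ∈ 𝓡 then 2^(-r.1.1) * 2^(-r.2.1) * ‖∫ z : RR, (E \ Ex).indicator (fun _ => (1:ℂ)) z * (φ (Fin.last l) r z.1 * ψ (Fin.last l) r z.2)‖ₑ else 0 with hc
  set Rk : ℕ → Finset Rc := fun k => 𝓡.filter fun r => volume (cel r) ≤ 2 * volume (cel r ∩ (Ω k)ᶜ) ∧ (k = 0 ∨ volume (cel r) ≤ 2 * volume (cel r ∩ Ω (k-1))) with hRk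
  have hcov : ∀ r ∈ 𝓡, ∃ k, r ∈ Rk k := by
    intro r hr
    have hex : ∃ k, ¬ volume (cel r) ≤ 2 * volume (cel r ∩ Ω k) := by
      by_contra hcon
      push Not at hcon
      have : Ex = Set.univ := by
        refine Set.eq_univ_of_forall fun z => ?_
        set m := max (fl r.1.1 z.1 - r.1.2).natAbs (fl r.2.1 z.2 - r.2.2).natAbs with hm
        have hmk : m ≤ 2^m := Nat.lt_two_pow_self.le
        exact hdil m r (hcon m) z ((le_max_left _ _).trans hmk) ((le_max_right _ _).trans hmk)
      rw [this, Measure.volume_eq_prod, Measure.prod_apply MeasurableSet.univ] at hExv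
      simp at hExv
    refine ⟨Nat.find hex, Finset.mem_filter.2 ⟨hr, light (hΩ _) r (Nat.find_spec hex), ?_⟩⟩
    rcases Nat.eq_zero_or_pos (Nat.find hex) with h0 | h0
    · exact Or.inl h0
    · right
      have := Nat.find_min hex (m := Nat.find hex - 1) (by omega)
      exact not_not.1 this
  have hold : ∀ k (x : Rc → EN) (K' : EN), Nm q volume (fun z => FF (sx (Fin.last l)) (sy (Fin.last l)) (fun k1 k2 => AC x k1 k2 z)) ≤ K' →
      ∑ r ∈ Rk k, volume (cel r) * ((∏ i, a i r) * x r) ≤ 2 * (N * 2^(b*(a'+k)) * K') := by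
    intro k x K' hx
    refine (core a x (Rk k) (hΩ k).compl (fun r hr => (Finset.mem_filter.1 hr).2.1) hj hi sx sy h1 h2 h3 h4).trans (mul_le_mul_right ?_ _)
    have hh := lintegral_mul_le_Lp_mul_Lq (volume.restrict (Ω k)ᶜ) hpq (f := fun z => ∏ i, F i z)
      (g := fun z => FF (sx (Fin.last l)) (sy (Fin.last l)) (fun k1 k2 => AC x k1 k2 z)) (Finset.measurable_fun_prod _ fun i _ => hFm i).aemeasurable (meas_FF _ _ _).aemeasurable
    refine le_trans hh (mul_le_mul' (hGk k) (le_trans ?_ hx))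
    unfold Nm
    exact rpow_le_rpow (setLIntegral_le_lintegral _ _) (by have := hpq.symm.pos; positivity)
  have hSk : ∀ k, ∑ r ∈ Rk k, volume (cel r) * ((∏ i, a i r) * c r) ≤ 4 * N * 2^(b*a') * K0 * 2^(b+1) * (2⁻¹)^k := by
    intro k
    cases k with
    | zero =>
      have hc0 : Nm q volume (fun z => FF (sx (Fin.last l)) (sy (Fin.last l)) (fun k1 k2 => AC c k1 k2 z)) ≤ K0 := by
        refine (HTq 𝓡 (sx (Fin.last l)) (sy (Fin.last l)) D 0 0 ((E \ Ex).indicator (fun _ => (1:ℂ))) c hD (measurable_const.indicator hE'm).aestronglyMeasurable ⟨fun r hr => ?_, fun r hr => by simp [hc, hr]⟩).trans ?_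
        · obtain ⟨b1, b2, b3, b4⟩ := hbump (Fin.last l) r hr
          rw [hn] at b1 b2
          exact ⟨_, _, b1.toAd, b2.toAd, b3, b4, by simp [hc, hr]⟩
        · calc _ ≤ Cq * D^2 * kap 0 * kap 0 * 1 := mul_le_mul_right (Nm_ind (by linarith) hE'm hE'1) _
            _ ≤ K0 := by rw [mul_one]; exact le_self_add
      refine (hold 0 c K0 hc0).trans ?_
      rw [pow_zero, mul_one, add_zero]
      calc 2 * (N * 2^(b*a') * K0) = 2 * N * 2^(b*a') * K0 * 1 := by ring
        _ ≤ 4 * N * 2^(b*a') * K0 * 2^(b+1) := by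
          refine mul_le_mul' ?_ (one_le_pow₀ (by norm_num))
          gcongr; norm_num
    | succ m =>
      obtain ⟨x, x', hx, hx', hle⟩ := HTL D (Rk (m+1)) (sx (Fin.last l)) (sy (Fin.last l)) (E \ Ex) (φ (Fin.last l)) (ψ (Fin.last l)) (2^m) hD hE'm hE'1
        (fun r hr => by
          have := hbump (Fin.last l) r (Finset.mem_filter.1 hr).1
          rw [hn] at this; simpa using this)
        (fun r hr z hz g1 g2 => by
          have := (Finset.mem_filter.1 hr).2.2
          rcases this with h0 | h0
          · omega
          · exact hz.2 (hdil m r h0 z g1 g2))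
      have hw := wd_geo b m
      set w := wd (b+1) ((2^m:ℕ):ℤ) with hwd
      have hKK : K * D^2 ≤ K0 := le_add_self
      calc ∑ r ∈ Rk (m+1), volume (cel r) * ((∏ i, a i r) * c r) ≤ ∑ r ∈ Rk (m+1), w * (volume (cel r) * ((∏ i, a i r) * x r) + volume (cel r) * ((∏ i, a i r) * x' r)) := by
            refine Finset.sum_le_sum fun r hr => ?_
            have hcr : c r ≤ w * (x r + x' r) := by
              have := hle r hr
              simp only [hc, (Finset.mem_filter.1 hr).1, if_true]; exact this
            calc _ ≤ volume (cel r) * ((∏ i, a i r) * (w * (x r + x' r))) := by gcongr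
              _ = _ := by ring
        _ = w * (∑ r ∈ Rk (m+1), volume (cel r) * ((∏ i, a i r) * x r) + ∑ r ∈ Rk (m+1), volume (cel r) * ((∏ i, a i r) * x' r)) := by
            rw [← Finset.mul_sum, Finset.sum_add_distrib]
        _ ≤ w * (2 * (N * 2^(b*(a'+(m+1))) * K0) + 2 * (N * 2^(b*(a'+(m+1))) * K0)) :=
            mul_le_mul_right (add_le_add (hold _ _ _ (hx.trans hKK)) (hold _ _ _ (hx'.trans hKK))) _
        _ = 4 * N * 2^(b*a') * K0 * 2^b * (2^(b*m) * w) := by ring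
        _ ≤ 4 * N * 2^(b*a') * K0 * 2^b * (2⁻¹)^m := mul_le_mul_right hw _
        _ = 4 * N * 2^(b*a') * K0 * 2^b * (2⁻¹)^m * (2 * 2⁻¹) := by rw [ENNReal.mul_inv_cancel (by norm_num) (by norm_num), mul_one]
        _ = _ := by ring
  calc _ = ∑ r ∈ 𝓡, volume (cel r) * ((∏ i, a i r) * c r) := by
        refine Finset.sum_congr rfl fun r hr => ?_
        simp only [ha, hc, hr, if_true]
    _ ≤ ∑ r ∈ 𝓡, ∑' k, if r ∈ Rk k then volume (cel r) * ((∏ i, a i r) * c r) else 0 := by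
        refine Finset.sum_le_sum fun r hr => ?_
        obtain ⟨k, hk⟩ := hcov r hr
        refine le_trans (le_of_eq ?_) (ENNReal.le_tsum k)
        simp [hk]
    _ = ∑' k, ∑ r ∈ 𝓡, if r ∈ Rk k then volume (cel r) * ((∏ i, a i r) * c r) else 0 := (Summable.tsum_finsetSum fun _ _ => ENNReal.summable).symm
    _ = ∑' k, ∑ r ∈ Rk k, volume (cel r) * ((∏ i, a i r) * c r) := by
        refine tsum_congr fun k => ?_
        rw [← Finset.sum_filter, show 𝓡.filter (fun r => r ∈ Rk k) = Rk k by ext r; simp [hRk]]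
    _ ≤ ∑' k, 4 * N * 2^(b*a') * K0 * 2^(b+1) * (2⁻¹)^k := ENNReal.tsum_le_tsum hSk
    _ = 4 * N * 2^(b*a') * K0 * 2^(b+1) * 2 := by
        rw [ENNReal.tsum_mul_left, tsum_geometric, one_sub_inv_two, inv_inv]
    _ = _ := by
        rw [hN, Finset.prod_mul_distrib, ← hC1]; ring

lemma kap_log (m : ℤ) : kap m ≤ oR (16 * (Real.log (2 + |(m:ℝ)|))^2) := by
  unfold kap
  rw [← ofReal_natCast]
  refine ofReal_le_ofReal ?_
  set x := Real.log (2 + |(m:ℝ)|) with hx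
  have h2 := Real.log_two_gt_d9
  have hx2 : Real.log 2 ≤ x := Real.log_le_log (by norm_num) (by linarith [abs_nonneg (m:ℝ)])
  have hsz : ((Nat.size m.natAbs : ℕ) : ℝ) * Real.log 2 ≤ Real.log 2 + x := by
    rcases Nat.eq_zero_or_pos m.natAbs with h0 | h0
    · rw [h0]; simp; linarith
    · have h1 : 1 ≤ Nat.size m.natAbs := Nat.size_pos.2 h0
      have h3 : 2^(Nat.size m.natAbs - 1) ≤ m.natAbs := by rw [← Nat.lt_size]; omega
      have h4 : (2:ℝ)^(Nat.size m.natAbs - 1) ≤ 2 + |(m:ℝ)| := by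
        have : ((2^(Nat.size m.natAbs - 1) : ℕ) : ℝ) ≤ (m.natAbs : ℝ) := by exact_mod_cast h3
        rw [Nat.cast_natAbs, Int.cast_abs] at this
        push_cast at this; linarith
      have h5 := Real.log_le_log (by positivity) h4
      rw [Real.log_pow, Nat.cast_sub h1] at h5
      push_cast at h5; nlinarith
  push_cast
  have h6 : (Nat.size m.natAbs : ℝ) * 0.69 ≤ 0.69 + x := by
    have h7 : ((Nat.size m.natAbs : ℝ) - 1) * Real.log 2 ≤ x := by linarith
    rcases Nat.eq_zero_or_pos (Nat.size m.natAbs) with h0 | h0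
    · rw [h0]; push_cast; linarith
    · have : (1:ℝ) ≤ Nat.size m.natAbs := by exact_mod_cast h0
      nlinarith
  nlinarith [sq_nonneg (x - 0.69)]

lemma pair_rect (k₁ k₂ : ℤ) (g h : ℝ → ℂ) (f : RR → ℂ) : ‖pairing f (rectBumpProd k₁ k₂ g h)‖ =
    ((2:ℝ)^k₁ * (2:ℝ)^k₂)^(-(1/2):ℝ) * ‖∫ z : RR, f z * ((starRingEnd ℂ) (g z.1) * (starRingEnd ℂ) (h z.2))‖ := by
  unfold pairing rectBumpProd
  rw [Real.mul_rpow (by positivity) (by positivity)]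
  set c : ℝ := ((2:ℝ)^k₁) ^ (-(1/2) : ℝ) * ((2:ℝ)^k₂) ^ (-(1/2) : ℝ) with hc
  have hc0 : 0 ≤ c := by positivity
  have e : ∀ z : RR, f z * (starRingEnd ℂ) ((c:ℂ) * g z.1 * h z.2) = (c:ℂ) * (f z * ((starRingEnd ℂ) (g z.1) * (starRingEnd ℂ) (h z.2))) := fun z => by
    rw [map_mul, map_mul, Complex.conj_ofReal]; ring
  simp_rw [e]
  rw [integral_const_mul, norm_mul, Complex.norm_real, Real.norm_of_nonneg hc0]

lemma termR {l : ℕ} {A : ℝ} (hA : 0 < A) (I : Fin l → ℝ) (J : ℝ) :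
    A ^ (-(((l:ℝ) - 1)/2)) * (∏ i, A^(-(1/2):ℝ) * I i) * (A^(-(1/2):ℝ) * J) = A * ((∏ i, A⁻¹ * I i) * (A⁻¹ * J)) := by
  rw [Finset.prod_mul_distrib, Finset.prod_mul_distrib, Finset.prod_const, Finset.prod_const, Finset.card_univ, Fintype.card_fin]
  have e : A ^ (-(((l:ℝ) - 1)/2)) * (A^(-(1/2):ℝ))^l * A^(-(1/2):ℝ) = (A⁻¹)^l := by
    rw [← Real.rpow_natCast, ← Real.rpow_mul hA.le, ← Real.rpow_add hA, ← Real.rpow_add hA, inv_pow, ← Real.rpow_natCast, ← Real.rpow_neg hA.le]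
    congr 1; ring
  calc _ = (A ^ (-(((l:ℝ) - 1)/2)) * (A^(-(1/2):ℝ))^l * A^(-(1/2):ℝ)) * (∏ i, I i) * J := by ring
    _ = (A * A⁻¹) * ((A⁻¹)^l * (∏ i, I i) * J) := by rw [e, mul_inv_cancel₀ hA.ne']; ring
    _ = _ := by ring

lemma termE {l : ℕ} (r : Rc) (I : Fin l → ℂ) (J : ℂ) :
    oR (((2:ℝ)^r.1.1 * (2:ℝ)^r.2.1) * ((∏ i, ((2:ℝ)^r.1.1 * (2:ℝ)^r.2.1)⁻¹ * ‖I i‖) * (((2:ℝ)^r.1.1 * (2:ℝ)^r.2.1)⁻¹ * ‖J‖))) =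
    volume (cel r) * ((∏ i, 2^(-r.1.1) * 2^(-r.2.1) * ‖I i‖ₑ) * (2^(-r.1.1) * 2^(-r.2.1) * ‖J‖ₑ)) := by
  have e : ∀ w : ℂ, oR (((2:ℝ)^r.1.1 * (2:ℝ)^r.2.1)⁻¹ * ‖w‖) = 2^(-r.1.1) * 2^(-r.2.1) * ‖w‖ₑ := fun w => by
    rw [ofReal_mul (by positivity), mul_inv, ofReal_mul (by positivity), ← zpow_neg, ← zpow_neg, ofReal_two_zpow, ofReal_two_zpow, ofReal_norm]
  rw [ofReal_mul (by positivity), ofReal_mul (Finset.prod_nonneg fun i _ => by positivity), ofReal_prod_of_nonneg fun i _ => by positivity, cel_vol,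
    ofReal_mul (by positivity), ofReal_two_zpow, ofReal_two_zpow, e]
  simp_rw [e]

/-- Restricted-type estimate for the discrete model operators: for normalized
`fⱼ ∈ L^{pⱼ}` and `E` of measure `1` there is a major subset `E' ⊆ E` with
`|E'| ≥ ½|E|` such that, with `f_{l+1} = χ_{E'}`,
`∑_{R ∈ 𝓡} |R|^{-(l-1)/2} |⟨f₁,Φ¹_{R_{n₁}}⟩| ⋯ |⟨f_l,Φ^l_{R_{n_l}}⟩| |⟨f_{l+1},Φ^{l+1}_R⟩|
≤ C ∏_{j=1}^{2} log²⟨n₁^j⟩ ⋯ log²⟨n_l^j⟩`, with `C` independent of `𝓡` and the shifts. -/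
theorem stmt8 (l : ℕ) (hl : 1 ≤ l) (Cad : ℕ → ℝ)
    (p : Fin l → ℝ≥0∞) (hp : ∀ i, 1 < p i ∧ p i < ⊤) :
    ∃ C : ℝ, 0 < C ∧
      ∀ (𝓡 : Finset ((ℤ × ℤ) × (ℤ × ℤ))) (n : Fin (l + 1) → ℤ × ℤ),
        n (Fin.last l) = (0, 0) →
        ∀ (φa φb : Fin (l + 1) → ((ℤ × ℤ) × (ℤ × ℤ)) → ℝ → ℂ)
          (Φ : Fin (l + 1) → ((ℤ × ℤ) × (ℤ × ℤ)) → ℝ × ℝ → ℂ),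
          (∀ j r, Φ j r = rectBumpProd r.1.1 r.2.1 (φa j r) (φb j r)) →
          (∀ j, ∀ r ∈ 𝓡,
            IsBumpAdapted Cad ((2:ℝ)^r.1.1 * ((r.1.2 + (n j).1 : ℤ) : ℝ)) ((2:ℝ)^r.1.1)
              (φa j r) ∧
            IsBumpAdapted Cad ((2:ℝ)^r.2.1 * ((r.2.2 + (n j).2 : ℤ) : ℝ)) ((2:ℝ)^r.2.1)
              (φb j r)) →
          (∃ j j' : Fin (l + 1), j ≠ j' ∧ ∀ r ∈ 𝓡,
            (∫ x : ℝ, φa j r x) = 0 ∧ (∫ x : ℝ, φa j' r x) = 0) →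
          (∃ j j' : Fin (l + 1), j ≠ j' ∧ ∀ r ∈ 𝓡,
            (∫ x : ℝ, φb j r x) = 0 ∧ (∫ x : ℝ, φb j' r x) = 0) →
          ∀ f : Fin l → ℝ × ℝ → ℂ,
            (∀ i, MemLp (f i) (p i) (volume : Measure (ℝ × ℝ)) ∧
              eLpNorm (f i) (p i) (volume : Measure (ℝ × ℝ)) = 1) →
          ∀ E : Set (ℝ × ℝ), MeasurableSet E → volume E = 1 →
            ∃ E' : Set (ℝ × ℝ), E' ⊆ E ∧ MeasurableSet E' ∧
              (1 / 2 : ℝ≥0∞) * volume E ≤ volume E' ∧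
              ∑ r ∈ 𝓡,
                  ((2:ℝ)^r.1.1 * (2:ℝ)^r.2.1) ^ (-(((l : ℝ) - 1) / 2)) *
                    (∏ i : Fin l, ‖pairing (f i) (Φ i.castSucc r)‖) *
                    ‖pairing (Set.indicator E' (fun _ => (1 : ℂ))) (Φ (Fin.last l) r)‖ ≤
                C * ∏ j : Fin l,
                  (Real.log (2 + |((n j.castSucc).1 : ℝ)|)) ^ 2 *
                    (Real.log (2 + |((n j.castSucc).2 : ℝ)|)) ^ 2 := by
  classical
  have hp1 : ∀ i, 1 < (p i).toReal := fun i => by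
    rw [← toReal_one]; exact (toReal_lt_toReal (by simp) (hp i).2.ne).2 (hp i).1
  obtain ⟨S, HS⟩ := MAIN hl (fun i => (p i).toReal) hp1
  obtain ⟨C, hC, H⟩ := HS (oR (Cad (5+S) * 2^(5+S)) + 1) (by finiteness) le_add_self
  refine ⟨(C.toReal + 1) * 256^l, by positivity, ?_⟩
  intro 𝓡 n hn φa φb Φ hΦ hb ⟨j, j', hj, hjz⟩ ⟨i, i', hi, hiz⟩ f hf E hE hE1
  have hAS : ∀ {k q : ℤ} {φ : ℝ → ℂ}, IsBumpAdapted Cad ((2:ℝ)^k * (q:ℝ)) ((2:ℝ)^k) φ → AdS S (oR (Cad (5+S) * 2^(5+S)) + 1) k q (fun x => (starRingEnd ℂ) (φ x)) := fun h => by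
    have h1 := (bump_AdS h S).conj
    exact ⟨h1.meas, fun x => (h1.bd x).trans (mul_le_mul_left le_self_add _), fun j x y hxy => (h1.lip j x y hxy).trans (mul_le_mul_left (mul_le_mul_left le_self_add _) _)⟩
  obtain ⟨E', hE's, hE'm, hE'v, hsum⟩ := H 𝓡 n (fun t r x => (starRingEnd ℂ) (φa t r x)) (fun t r x => (starRingEnd ℂ) (φb t r x))
    (fun t => decide (∀ r ∈ 𝓡, ∫ x, φa t r x = 0)) (fun t => decide (∀ r ∈ 𝓡, ∫ x, φb t r x = 0)) j j' i i' hn hj hi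
    (by simpa using fun r h => (hjz r h).1) (by simpa using fun r h => (hjz r h).2) (by simpa using fun r h => (hiz r h).1) (by simpa using fun r h => (hiz r h).2)
    (fun t r hr => ⟨hAS (hb t r hr).1, hAS (hb t r hr).2, fun h => by
      rw [integral_conj, of_decide_eq_true h r hr, map_zero], fun h => by rw [integral_conj, of_decide_eq_true h r hr, map_zero]⟩)
    f (fun i => ⟨(hf i).1.1, by
      have := (hf i).2
      rw [eLpNorm_eq_lintegral_rpow_enorm_toReal (ne_of_gt (lt_trans zero_lt_one (hp i).1)) (hp i).2.ne] at this
      exact le_of_eq this⟩) E hE hE1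
  refine ⟨E', hE's, hE'm, by rw [hE1, mul_one]; exact hE'v, ?_⟩
  have hRn : 0 ≤ ∏ j : Fin l, (Real.log (2 + |((n j.castSucc).1 : ℝ)|)) ^ 2 * (Real.log (2 + |((n j.castSucc).2 : ℝ)|)) ^ 2 := Finset.prod_nonneg fun i _ => by positivity
  rw [← ofReal_le_ofReal_iff (by positivity), ofReal_sum_of_nonneg (fun r _ => by positivity)]
  calc _ = _ := Finset.sum_congr rfl fun r _ => by
        simp_rw [hΦ, pair_rect]
        rw [termR (by positivity), termE]
    _ ≤ _ := hsum
    _ ≤ oR (C.toReal + 1) * ∏ j : Fin l, oR (256 * ((Real.log (2 + |((n j.castSucc).1 : ℝ)|)) ^ 2 * (Real.log (2 + |((n j.castSucc).2 : ℝ)|)) ^ 2)) := by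
        refine mul_le_mul' ?_ (Finset.prod_le_prod' fun j _ => ?_)
        · rw [← ofReal_toReal hC]; refine ofReal_le_ofReal ?_
          rw [toReal_ofReal (by positivity)]; linarith
        · refine (mul_le_mul' (kap_log _) (kap_log _)).trans (le_of_eq ?_)
          rw [← ofReal_mul (by positivity)]; congr 1; ring
    _ = _ := by
        rw [← ofReal_prod_of_nonneg fun i _ => by positivity, ← ofReal_mul (by positivity), Finset.prod_mul_distrib, Finset.prod_const, Finset.card_univ, Fintype.card_fin, mul_assoc]
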